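/- arXiv:2208.06629 — 3 statements merged into one kernel-verified Lean document; each statement's English description precedes it below -/
import Mathlib

section
/- There exists a real number ε > 0 such that for every integer n ≥ 6, U(n) ≤ (1 − ε)·(n choose 2). -/
open scoped BigOperators

/-- A lazy transposition on `n` positions, encoded as a triple `(a, b, p)`. -/
abbrev LazyT (n : ℕ) := Fin n × Fin n × ℝ

/-- The triple `(a, b, p)` is a valid lazy transposition: `a ≠ b` and `p ∈ [0,1]`. -/
def LazyT.Valid {n : ℕ} (e : LazyT n) : Prop :=
  e.1 ≠ e.2.1 ∧ 0 ≤ e.2.2 ∧ e.2.2 ≤ 1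

/-- A star transposition: its first coordinate is position `1` (index `0` in `Fin n`). -/
def LazyT.IsStar {n : ℕ} (e : LazyT n) : Prop := (e.1 : ℕ) = 0

/-- `permDist L σ` is the probability that the composition of the independent lazy
transpositions in `L` (applied in order) equals the permutation `σ`. -/
noncomputable def permDist {n : ℕ} : List (LazyT n) → Equiv.Perm (Fin n) → ℝ
  | [], σ => if σ = 1 then 1 else 0
  | e :: L, σ =>
      e.2.2 * permDist L (σ * Equiv.swap e.1 e.2.1) + (1 - e.2.2) * permDist L σ

/-- `L` is a transposition shuffle on `n` points: all entries are valid lazy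
transpositions and the composition is uniformly distributed on `Perm (Fin n)`. -/
def IsShuffle {n : ℕ} (L : List (LazyT n)) : Prop :=
  (∀ e ∈ L, e.Valid) ∧
  ∀ σ : Equiv.Perm (Fin n), permDist L σ = 1 / (n.factorial : ℝ)

/-- `U n` is the minimum length of a transposition shuffle on `n` points. -/
noncomputable def U (n : ℕ) : ℕ :=
  sInf { ℓ : ℕ | ∃ L : List (LazyT n), L.length = ℓ ∧ IsShuffle L }

/-- The probability that, after applying the lazy transpositions in `L`, the `t`
labelled counters starting in positions `1, …, t` end up placed according to the
map `f` (counter `i` in position `f i`). -/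
noncomputable def placeProb {n t : ℕ} (ht : t ≤ n) (L : List (LazyT n))
    (f : Fin t → Fin n) : ℝ :=
  ∑ σ : Equiv.Perm (Fin n),
    if ∀ i : Fin t, σ (Fin.castLE ht i) = f i then permDist L σ else 0

/-- `L` is a `(t,n)`-shuffle: all entries are valid and the final placement of the
`t` counters is uniform over all `n!/(n-t)!` injections. -/
def IsTShuffle {n t : ℕ} (ht : t ≤ n) (L : List (LazyT n)) : Prop :=
  (∀ e ∈ L, e.Valid) ∧
  ∀ f : Fin t → Fin n, Function.Injective f →
    placeProb ht L f = ((n - t).factorial : ℝ) / (n.factorial : ℝ)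

/-- `Ut t n` is the minimum length of a `(t,n)`-shuffle. -/
noncomputable def Ut (t n : ℕ) : ℕ :=
  sInf { ℓ : ℕ | ∃ (ht : t ≤ n) (L : List (LazyT n)), L.length = ℓ ∧ IsTShuffle ht L }

/-- The probability that after applying `L` the set of positions occupied by the
`t` (indistinguishable) counters starting in positions `1, …, t` is exactly `S`. -/
noncomputable def occProb {n t : ℕ} (ht : t ≤ n) (L : List (LazyT n))
    (S : Finset (Fin n)) : ℝ :=
  ∑ σ : Equiv.Perm (Fin n),
    if Finset.image (fun i : Fin t => σ (Fin.castLE ht i)) Finset.univ = S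
    then permDist L σ else 0

/-- `L` shuffles `t` indistinguishable counters over `n` positions: all entries are
valid and the occupied set is uniform over all `n.choose t` subsets of size `t`. -/
def IsIndShuffle {n t : ℕ} (ht : t ≤ n) (L : List (LazyT n)) : Prop :=
  (∀ e ∈ L, e.Valid) ∧
  ∀ S : Finset (Fin n), S.card = t → occProb ht L S = 1 / (n.choose t : ℝ)

/-- `Uhat t n` is the minimum length of a sequence of lazy transpositions shuffling
`t` indistinguishable counters uniformly over `n` positions. -/
noncomputable def Uhat (t n : ℕ) : ℕ :=
  sInf { ℓ : ℕ | ∃ (ht : t ≤ n) (L : List (LazyT n)), L.length = ℓ ∧ IsIndShuffle ht L }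

/-- `Ustar n` is the minimum length of a transposition shuffle on `n` points all of
whose lazy transpositions are star transpositions. -/
noncomputable def Ustar (n : ℕ) : ℕ :=
  sInf { ℓ : ℕ | ∃ L : List (LazyT n), L.length = ℓ ∧ IsShuffle L ∧ ∀ e ∈ L, e.IsStar }

/-- `Utstar t n` is the minimum length of a `(t,n)`-shuffle all of whose lazy
transpositions are star transpositions. -/
noncomputable def Utstar (t n : ℕ) : ℕ :=
  sInf { ℓ : ℕ | ∃ (ht : t ≤ n) (L : List (LazyT n)),
    L.length = ℓ ∧ IsTShuffle ht L ∧ ∀ e ∈ L, e.IsStar }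

open Equiv Finset
open scoped Pointwise

namespace Shf

variable {n : ℕ}

abbrev GA (n : ℕ) := MonoidAlgebra ℝ (Perm (Fin n))

/-- permutations supported on `A` -/
def G (A : Finset (Fin n)) : Finset (Perm (Fin n)) :=
  Finset.univ.filter (fun h => ∀ x, x ∉ A → h x = x)

lemma mem_G {A : Finset (Fin n)} {h : Perm (Fin n)} :
    h ∈ G A ↔ ∀ x, x ∉ A → h x = x := by simp [G]

lemma one_mem_G (A : Finset (Fin n)) : (1 : Perm (Fin n)) ∈ G A := by simp [mem_G]

lemma mul_mem_G {A : Finset (Fin n)} {g h : Perm (Fin n)} (hg : g ∈ G A) (hh : h ∈ G A) :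
    g * h ∈ G A := by
  rw [mem_G] at *
  intro x hx
  rw [Perm.mul_apply, hh x hx, hg x hx]

lemma inv_mem_G {A : Finset (Fin n)} {g : Perm (Fin n)} (hg : g ∈ G A) : g⁻¹ ∈ G A := by
  rw [mem_G] at *
  intro x hx
  rw [Perm.inv_eq_iff_eq, hg x hx]

lemma G_mono {A B : Finset (Fin n)} (h : A ⊆ B) {g : Perm (Fin n)} (hg : g ∈ G A) : g ∈ G B := by
  rw [mem_G] at *
  exact fun x hx => hg x (fun hxa => hx (h hxa))

lemma swap_mem_G {A : Finset (Fin n)} {a b : Fin n} (ha : a ∈ A) (hb : b ∈ A) :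
    swap a b ∈ G A := by
  rw [mem_G]
  intro x hx
  apply swap_apply_of_ne_of_ne
  · rintro rfl; exact hx ha
  · rintro rfl; exact hx hb

lemma apply_mem_of_G {A : Finset (Fin n)} {g : Perm (Fin n)} (hg : g ∈ G A) {x : Fin n}
    (hx : x ∈ A) : g x ∈ A := by
  by_contra h
  have := (mem_G.1 hg) _ h
  rw [g.injective this] at h
  exact h hx

lemma G_comm {A B : Finset (Fin n)} (hAB : Disjoint A B) {g h : Perm (Fin n)}
    (hg : g ∈ G A) (hh : h ∈ G B) : g * h = h * g := by
  ext x
  simp only [Perm.mul_apply]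
  by_cases hx : x ∈ A
  · have h1 : x ∉ B := Finset.disjoint_left.1 hAB hx
    have h2 : g x ∉ B := Finset.disjoint_left.1 hAB (apply_mem_of_G hg hx)
    rw [mem_G.1 hh x h1, mem_G.1 hh _ h2]
  · rw [mem_G.1 hg x hx]
    by_cases hxB : x ∈ B
    · have h2 : h x ∉ A := Finset.disjoint_right.1 hAB (apply_mem_of_G hh hxB)
      rw [mem_G.1 hg _ h2]
    · rw [mem_G.1 hh x hxB, mem_G.1 hg x hx]

noncomputable def of (σ : Perm (Fin n)) : GA n := MonoidAlgebra.of ℝ _ σ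

lemma of_mul (σ τ : Perm (Fin n)) : of (σ * τ) = of σ * of τ := map_mul _ _ _
lemma of_one : of (1 : Perm (Fin n)) = 1 := map_one _

lemma coeff_of (σ τ : Perm (Fin n)) : (of σ).coeff τ = if τ = σ then 1 else 0 := by
  rw [of, MonoidAlgebra.of_apply, MonoidAlgebra.coeff_single, Finsupp.single_apply]
  simp only [eq_comm]

noncomputable def av (A : Finset (Fin n)) : GA n := ((G A).card : ℝ)⁻¹ • ∑ h ∈ G A, of h

lemma card_G_ne (A : Finset (Fin n)) : ((G A).card : ℝ) ≠ 0 := by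
  have : 0 < (G A).card := Finset.card_pos.2 ⟨1, one_mem_G A⟩
  positivity

lemma of_mul_av {A : Finset (Fin n)} {g : Perm (Fin n)} (hg : g ∈ G A) :
    of g * av A = av A := by
  rw [av, mul_smul_comm, Finset.mul_sum]
  congr 1
  refine Finset.sum_bij (fun h _ => g * h) ?_ ?_ ?_ ?_
  · intro h hh; exact mul_mem_G hg hh
  · intro a _ b _ h; exact mul_left_cancel h
  · intro b hb; exact ⟨g⁻¹ * b, mul_mem_G (inv_mem_G hg) hb, by simp⟩
  · intro h _; rw [of_mul]

lemma av_mul_of {A : Finset (Fin n)} {g : Perm (Fin n)} (hg : g ∈ G A) :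
    av A * of g = av A := by
  rw [av, smul_mul_assoc, Finset.sum_mul]
  congr 1
  refine Finset.sum_bij (fun h _ => h * g) ?_ ?_ ?_ ?_
  · intro h hh; exact mul_mem_G hh hg
  · intro a _ b _ h; exact mul_right_cancel h
  · intro b hb; exact ⟨b * g⁻¹, mul_mem_G hb (inv_mem_G hg), by simp⟩
  · intro h _; rw [of_mul]

lemma av_mul_av {A B : Finset (Fin n)} (h : B ⊆ A) : av B * av A = av A := by
  conv_lhs => rw [av]
  rw [smul_mul_assoc, Finset.sum_mul,
    Finset.sum_congr rfl (fun g hg => of_mul_av (G_mono h hg)), Finset.sum_const,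
    ← Nat.cast_smul_eq_nsmul ℝ, smul_smul, inv_mul_cancel₀ (card_G_ne B), one_smul]

lemma av_mul_av' {A B : Finset (Fin n)} (h : B ⊆ A) : av A * av B = av A := by
  conv_lhs => arg 2; rw [av]
  rw [mul_smul_comm, Finset.mul_sum,
    Finset.sum_congr rfl (fun g hg => av_mul_of (G_mono h hg)), Finset.sum_const,
    ← Nat.cast_smul_eq_nsmul ℝ, smul_smul, inv_mul_cancel₀ (card_G_ne B), one_smul]

/-- elements of the group algebra supported on permutations of `A` -/
noncomputable def M (A : Finset (Fin n)) : Submodule ℝ (GA n) :=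
  Submodule.span ℝ (of '' (G A : Set (Perm (Fin n))))

lemma of_mem_M {A : Finset (Fin n)} {g : Perm (Fin n)} (hg : g ∈ G A) : of g ∈ M A :=
  Submodule.subset_span ⟨g, hg, rfl⟩

lemma M_induct {A : Finset (Fin n)} {P : GA n → Prop} (h0 : P 0)
    (h1 : ∀ g ∈ G A, P (of g)) (h2 : ∀ x y, P x → P y → P (x + y))
    (h3 : ∀ (r : ℝ) x, P x → P (r • x)) {z : GA n} (hz : z ∈ M A) : P z := by
  induction hz using Submodule.span_induction with
  | mem x hx => obtain ⟨g, hg, rfl⟩ := hx; exact h1 g hg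
  | zero => exact h0
  | add x y _ _ hx hy => exact h2 x y hx hy
  | smul r x _ hx => exact h3 r x hx

lemma M_mono {A B : Finset (Fin n)} (h : A ⊆ B) {z : GA n} (hz : z ∈ M A) : z ∈ M B :=
  M_induct (P := fun z => z ∈ M B) (zero_mem _) (fun _ hg => of_mem_M (G_mono h hg))
    (fun _ _ hx hy => add_mem hx hy) (fun r _ hx => Submodule.smul_mem _ r hx) hz

lemma M_mul {A : Finset (Fin n)} {y z : GA n} (hy : y ∈ M A) (hz : z ∈ M A) : y * z ∈ M A := by
  refine M_induct (P := fun y => y * z ∈ M A) (by simp) ?_ ?_ ?_ hy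
  · intro g hg
    refine M_induct (P := fun z => of g * z ∈ M A) (by simp) ?_ ?_ ?_ hz
    · intro h hh; rw [← of_mul]; exact of_mem_M (mul_mem_G hg hh)
    · intro x y hx hy; rw [mul_add]; exact add_mem hx hy
    · intro r x hx; rw [mul_smul_comm]; exact Submodule.smul_mem _ r hx
  · intro x y hx hy; rw [add_mul]; exact add_mem hx hy
  · intro r x hx; rw [smul_mul_assoc]; exact Submodule.smul_mem _ r hx

lemma M_comm {A B : Finset (Fin n)} (hAB : Disjoint A B) {y z : GA n}
    (hy : y ∈ M A) (hz : z ∈ M B) : y * z = z * y := by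
  refine M_induct (P := fun y => y * z = z * y) (by simp) ?_ ?_ ?_ hy
  · intro g hg
    refine M_induct (P := fun z => of g * z = z * of g) (by simp) ?_ ?_ ?_ hz
    · intro h hh; rw [← of_mul, ← of_mul, G_comm hAB hg hh]
    · intro x y hx hy; rw [mul_add, add_mul, hx, hy]
    · intro r x hx; rw [mul_smul_comm, smul_mul_assoc, hx]
  · intro x y hx hy; rw [add_mul, mul_add, hx, hy]
  · intro r x hx; rw [smul_mul_assoc, mul_smul_comm, hx]

lemma av_mem_M (A : Finset (Fin n)) : av A ∈ M A :=
  Submodule.smul_mem _ _ (Submodule.sum_mem _ fun _ hg => of_mem_M hg)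

/-- group algebra element of one lazy transposition -/
noncomputable def stp (t : LazyT n) : GA n :=
  t.2.2 • of (swap t.1 t.2.1) + (1 - t.2.2) • (1 : GA n)

noncomputable def mu : List (LazyT n) → GA n
  | [] => 1
  | t :: L => mu L * stp t

lemma mu_append (L₁ L₂ : List (LazyT n)) : mu (L₁ ++ L₂) = mu L₂ * mu L₁ := by
  induction L₁ with
  | nil => simp [mu]
  | cons t L ih => simp [mu, ih, mul_assoc]

lemma coeff_mu (L : List (LazyT n)) (σ : Perm (Fin n)) : (mu L).coeff σ = permDist L σ := by
  induction L generalizing σ with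
  | nil =>
    rw [mu, ← of_one, coeff_of, permDist]
  | cons t L ih =>
    rw [mu, permDist, stp, mul_add, mul_smul_comm, mul_smul_comm, mul_one, of]
    simp [ih]

/-- lists acting within `A` -/
def Inside (A : Finset (Fin n)) (L : List (LazyT n)) : Prop :=
  ∀ t ∈ L, t.Valid ∧ t.1 ∈ A ∧ t.2.1 ∈ A

lemma Inside.append {A : Finset (Fin n)} {L₁ L₂ : List (LazyT n)} (h1 : Inside A L₁)
    (h2 : Inside A L₂) : Inside A (L₁ ++ L₂) := by
  intro t ht
  rcases List.mem_append.1 ht with h | h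
  · exact h1 t h
  · exact h2 t h

lemma Inside.mono {A B : Finset (Fin n)} {L : List (LazyT n)} (h : Inside A L) (hAB : A ⊆ B) :
    Inside B L := fun t ht => ⟨(h t ht).1, hAB (h t ht).2.1, hAB (h t ht).2.2⟩

lemma stp_mem_M {A : Finset (Fin n)} {t : LazyT n} (h1 : t.1 ∈ A) (h2 : t.2.1 ∈ A) :
    stp t ∈ M A := by
  refine add_mem (Submodule.smul_mem _ _ (of_mem_M (swap_mem_G h1 h2))) (Submodule.smul_mem _ _ ?_)
  rw [← of_one]; exact of_mem_M (one_mem_G A)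

lemma mu_mem_M {A : Finset (Fin n)} {L : List (LazyT n)} (h : Inside A L) : mu L ∈ M A := by
  induction L with
  | nil => rw [mu, ← of_one]; exact of_mem_M (one_mem_G A)
  | cons t L ih =>
    rw [mu]
    exact M_mul (ih fun s hs => h s (List.mem_cons_of_mem _ hs))
      (stp_mem_M (h t List.mem_cons_self).2.1 (h t List.mem_cons_self).2.2)

/-- expectation of `θ` at the random image of `F` -/
noncomputable def I (z : GA n) (θ : Finset (Fin n) → ℝ) (F : Finset (Fin n)) : ℝ :=
  z.coeff.sum fun σ r => r * θ (σ • F)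

lemma I_eq (z : GA n) (θ : Finset (Fin n) → ℝ) (F : Finset (Fin n)) :
    I z θ F = ∑ σ, z.coeff σ * θ (σ • F) := by
  rw [I, Finsupp.sum_fintype]; simp

lemma I_add (y z : GA n) (θ) (F : Finset (Fin n)) : I (y + z) θ F = I y θ F + I z θ F := by
  simp [I_eq, add_mul, Finset.sum_add_distrib]

lemma I_smul (r : ℝ) (z : GA n) (θ) (F : Finset (Fin n)) : I (r • z) θ F = r * I z θ F := by
  simp [I_eq, Finset.mul_sum, mul_assoc]

lemma I_zero (θ) (F : Finset (Fin n)) : I (0 : GA n) θ F = 0 := by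
  simp [I_eq]

lemma I_of (σ : Perm (Fin n)) (θ) (F : Finset (Fin n)) : I (of σ) θ F = θ (σ • F) := by
  simp [I_eq, coeff_of]

lemma I_sum {ι : Type*} (s : Finset ι) (f : ι → GA n) (θ) (F : Finset (Fin n)) :
    I (∑ i ∈ s, f i) θ F = ∑ i ∈ s, I (f i) θ F := by
  classical
  induction s using Finset.induction_on with
  | empty => simp [I_zero]
  | insert a s ha ih => rw [Finset.sum_insert ha, Finset.sum_insert ha, I_add, ih]

lemma I_fadd (z : GA n) (θ θ' : Finset (Fin n) → ℝ) (F : Finset (Fin n)) :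
    I z (fun S => θ S + θ' S) F = I z θ F + I z θ' F := by
  simp [I_eq, mul_add, Finset.sum_add_distrib]

lemma I_fsmul (z : GA n) (r : ℝ) (θ : Finset (Fin n) → ℝ) (F : Finset (Fin n)) :
    I z (fun S => r * θ S) F = r * I z θ F := by
  simp only [I_eq, Finset.mul_sum]
  exact Finset.sum_congr rfl fun _ _ => by ring

lemma I_mul (y z : GA n) (θ) (F : Finset (Fin n)) : I (y * z) θ F = I z (I y θ) F := by
  induction y using MonoidAlgebra.induction_on with
  | of σ =>
    induction z using MonoidAlgebra.induction_on with
    | of τ =>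
      change I (of σ * of τ) θ F = I (of τ) (I (of σ) θ) F
      rw [← of_mul, I_of, I_of, I_of, mul_smul]
    | add x y hx hy => rw [mul_add, I_add, hx, hy, I_add]
    | smul r x hx => rw [mul_smul_comm, I_smul, hx, I_smul]
  | add x y hx hy =>
    have : I (x + y) θ = fun S => I x θ S + I y θ S := by ext S; rw [I_add]
    rw [add_mul, I_add, hx, hy, this, I_fadd]
  | smul r x hx =>
    have : I (r • x) θ = fun S => r * I x θ S := by ext S; rw [I_smul]
    rw [smul_mul_assoc, I_smul, hx, this, I_fsmul]

lemma I_one (θ) (F : Finset (Fin n)) : I (1 : GA n) θ F = θ F := by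
  rw [← of_one, I_of, one_smul]

lemma I_stp (t : LazyT n) (θ) (F : Finset (Fin n)) :
    I (stp t) θ F = t.2.2 * θ (swap t.1 t.2.1 • F) + (1 - t.2.2) * θ F := by
  rw [stp, I_add, I_smul, I_smul, I_of, I_one]

lemma I_av (A : Finset (Fin n)) (θ) (F : Finset (Fin n)) :
    I (av A) θ F = ((G A).card : ℝ)⁻¹ * ∑ h ∈ G A, θ (h • F) := by
  rw [av, I_smul, I_sum]
  simp only [I_of]

lemma exists_G (B F F' : Finset (Fin n)) (h1 : F \ B = F' \ B) (h2 : F.card = F'.card) :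
    ∃ k ∈ G B, k • F = F' := by
  induction hm : (F \ F').card generalizing F with
  | zero =>
    rw [Finset.card_eq_zero, Finset.sdiff_eq_empty_iff_subset] at hm
    exact ⟨1, one_mem_G B, by rw [one_smul]; exact Finset.eq_of_subset_of_card_le hm h2.ge⟩
  | succ m ih =>
    have hc : (F' \ F).card = (F \ F').card := (Finset.card_sdiff_comm h2).symm
    obtain ⟨x, hx⟩ : (F \ F').Nonempty := Finset.card_pos.1 (by omega)
    obtain ⟨y, hy⟩ : (F' \ F).Nonempty := Finset.card_pos.1 (by omega)
    rw [Finset.mem_sdiff] at hx hy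
    have hxB : x ∈ B := by
      by_contra hxB
      have : x ∈ F' \ B := h1 ▸ Finset.mem_sdiff.2 ⟨hx.1, hxB⟩
      exact hx.2 (Finset.mem_sdiff.1 this).1
    have hyB : y ∈ B := by
      by_contra hyB
      have : y ∈ F \ B := h1 ▸ Finset.mem_sdiff.2 ⟨hy.1, hyB⟩
      exact hy.2 (Finset.mem_sdiff.1 this).1
    have hxy : x ≠ y := by rintro rfl; exact hy.2 hx.1
    have hm' : ∀ a, a ∈ swap x y • F ↔ swap x y a ∈ F := by
      intro a
      rw [← Finset.inv_smul_mem_iff]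
      simp
    have h3 : (swap x y • F) \ F' = (F \ F').erase x := by
      ext a
      rw [Finset.mem_sdiff, hm', Finset.mem_erase, Finset.mem_sdiff]
      rcases eq_or_ne a x with rfl | hax
      · simp [hy.2]
      rcases eq_or_ne a y with rfl | hay
      · simp [hx.1, hy.1]
      rw [swap_apply_of_ne_of_ne hax hay]; tauto
    obtain ⟨k, hk, hkF⟩ := ih (swap x y • F) (by
        rw [← h1]
        ext a
        rw [Finset.mem_sdiff, hm', Finset.mem_sdiff]
        refine and_congr_left fun ha => ?_
        rw [swap_apply_of_ne_of_ne]
        · rintro rfl; exact ha hxB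
        · rintro rfl; exact ha hyB)
      (by rw [Finset.card_smul_finset, h2])
      (by rw [h3, Finset.card_erase_of_mem (Finset.mem_sdiff.2 hx), hm]; rfl)
    exact ⟨k * swap x y, mul_mem_G hk (swap_mem_G hxB hyB), by rw [mul_smul, hkF]⟩

lemma I_av_smul {B : Finset (Fin n)} {k : Perm (Fin n)} (hk : k ∈ G B) (θ) (F : Finset (Fin n)) :
    I (av B) θ (k • F) = I (av B) θ F := by
  conv_rhs => rw [← av_mul_of hk, I_mul, I_of]

lemma sum_I_av (B : Finset (Fin n)) (𝒮 : Finset (Finset (Fin n)))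
    (h : ∀ σ ∈ G B, ∀ S ∈ 𝒮, σ • S ∈ 𝒮) (θ) :
    ∑ S ∈ 𝒮, I (av B) θ S = ∑ S ∈ 𝒮, θ S := by
  simp only [I_av]
  rw [← Finset.mul_sum, Finset.sum_comm]
  have : ∀ σ ∈ G B, ∑ S ∈ 𝒮, θ (σ • S) = ∑ S ∈ 𝒮, θ S := by
    intro σ hσ
    refine Finset.sum_bij (fun S _ => σ • S) (fun S hS => h σ hσ S hS) ?_ ?_ (fun _ _ => rfl)
    · intro a _ b _ hab; exact smul_left_cancel σ hab
    · intro b hb; exact ⟨σ⁻¹ • b, h _ (inv_mem_G hσ) b hb, by simp⟩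
  rw [Finset.sum_congr rfl this, Finset.sum_const, nsmul_eq_mul, ← mul_assoc,
    inv_mul_cancel₀ (card_G_ne B), one_mul]

lemma I_of_const (z : GA n) (θ) (𝒮 : Finset (Finset (Fin n)))
    (hc : ∀ S ∈ 𝒮, ∀ S' ∈ 𝒮, I z θ S = I z θ S')
    (hs : ∑ S ∈ 𝒮, I z θ S = ∑ S ∈ 𝒮, θ S) {S : Finset (Fin n)} (hS : S ∈ 𝒮) :
    I z θ S = (∑ S ∈ 𝒮, θ S) / (𝒮.card : ℝ) := by
  rw [← hs, Finset.sum_congr rfl (fun S' hS' => hc S' hS' S hS), Finset.sum_const, nsmul_eq_mul]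
  have : 0 < 𝒮.card := Finset.card_pos.2 ⟨S, hS⟩
  field_simp

lemma smul_subset_of_G {A F : Finset (Fin n)} {σ : Perm (Fin n)} (hσ : σ ∈ G A) (hF : F ⊆ A) :
    σ • F ⊆ A := by
  intro x hx
  obtain ⟨y, hy, rfl⟩ := Finset.mem_smul_finset.1 hx
  exact apply_mem_of_G hσ (hF hy)

lemma I_av_uniform {A E : Finset (Fin n)} (hE : E ⊆ A) (θ) :
    I (av A) θ E = (∑ S ∈ Finset.powersetCard E.card A, θ S) / (A.card.choose E.card : ℝ) := by
  rw [← Finset.card_powersetCard]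
  apply I_of_const
  · intro S hS S' hS'
    rw [Finset.mem_powersetCard] at hS hS'
    obtain ⟨k, hk, rfl⟩ := exists_G A S S' (by
      rw [Finset.sdiff_eq_empty_iff_subset.2 hS.1, Finset.sdiff_eq_empty_iff_subset.2 hS'.1])
      (by rw [hS.2, hS'.2])
    rw [I_av_smul hk]
  · apply sum_I_av
    intro σ hσ S hS
    rw [Finset.mem_powersetCard] at hS ⊢
    exact ⟨smul_subset_of_G hσ hS.1, by rw [Finset.card_smul_finset, hS.2]⟩
  · exact Finset.mem_powersetCard.2 ⟨hE, rfl⟩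

lemma of_mul_avK {A E : Finset (Fin n)} {h : Perm (Fin n)} (hh : h ∈ G A)
    (hE : h • E = E) : of h * (av E * av (A \ E)) = av E * av (A \ E) := by
  have hp : ∀ x, h x ∈ E ↔ x ∈ E := by
    intro x
    conv_lhs => rw [← hE]
    exact Finset.smul_mem_smul_finset_iff (a := h) (b := x)
  let k : Perm (Fin n) := Perm.ofSubtype (h.subtypePerm (p := (· ∈ E)) hp)
  have hk1 : ∀ x ∈ E, k x = h x := by
    intro x hx
    rw [Perm.ofSubtype_apply_of_mem _ hx]; rfl
  have hk2 : ∀ x, x ∉ E → k x = x := fun x hx => Perm.ofSubtype_apply_of_not_mem _ hx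
  have hk : k ∈ G E := mem_G.2 hk2
  have hr : k⁻¹ * h ∈ G (A \ E) := by
    rw [mem_G]
    intro x hx
    rw [Perm.mul_apply, Perm.inv_eq_iff_eq]
    by_cases hxE : x ∈ E
    · exact (hk1 x hxE).symm
    · rw [hk2 x hxE]
      exact mem_G.1 hh x fun hxA => hx (Finset.mem_sdiff.2 ⟨hxA, hxE⟩)
  have : h = k * (k⁻¹ * h) := by simp
  rw [this, of_mul]
  have hc := M_comm (Finset.disjoint_sdiff (s := E) (t := A)) (av_mem_M E) (of_mem_M hr)
  calc of k * of (k⁻¹ * h) * (av E * av (A \ E))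
      = of k * (of (k⁻¹ * h) * av E) * av (A \ E) := by simp only [mul_assoc]
    _ = (of k * av E) * (of (k⁻¹ * h) * av (A \ E)) := by rw [← hc]; simp only [mul_assoc]
    _ = _ := by rw [of_mul_av hk, of_mul_av hr]

lemma coset_eq {A E : Finset (Fin n)} {z z' : GA n} (hz : z ∈ M A) (hz' : z' ∈ M A)
    (h : ∀ θ, I z θ E = I z' θ E) :
    z * (av E * av (A \ E)) = z' * (av E * av (A \ E)) := by
  classical
  set K := av E * av (A \ E) with hK
  have key : ∀ g : Perm (Fin n), ∃ θ : Finset (Fin n) → ℝ, ∀ z ∈ M A,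
      (z * K).coeff g = I z θ E := by
    intro g
    refine ⟨fun S => if hS : ∃ σ ∈ G A, σ • E = S then (of hS.choose * K).coeff g else 0, ?_⟩
    intro z hz
    refine M_induct (P := fun z => (z * K).coeff g = I z _ E) ?_ ?_ ?_ ?_ hz
    · rw [I_zero]; simp
    · intro σ hσ
      have hS : ∃ τ ∈ G A, τ • E = σ • E := ⟨σ, hσ, rfl⟩
      rw [I_of, dif_pos hS]
      obtain ⟨hc1, hc2⟩ := hS.choose_spec
      set τ := hS.choose
      congr 2
      have h1 : τ⁻¹ * σ ∈ G A := mul_mem_G (inv_mem_G hc1) hσ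
      have h2 : (τ⁻¹ * σ) • E = E := by rw [mul_smul, ← hc2, inv_smul_smul]
      have h3 := of_mul_avK h1 h2
      rw [← hK] at h3
      calc of σ * K = of (τ * (τ⁻¹ * σ)) * K := by simp
        _ = of τ * K := by rw [of_mul, mul_assoc, h3]
    · intro x y hx hy; rw [add_mul, I_add, ← hx, ← hy]; simp
    · intro r x hx; rw [smul_mul_assoc, I_smul, ← hx]; simp
  apply MonoidAlgebra.ext
  ext g
  obtain ⟨θ, hθ⟩ := key g
  rw [hθ z hz, hθ z' hz', h]

lemma hat_main {A E : Finset (Fin n)} (hE : E ⊆ A) {z : GA n} (hz : z ∈ M A)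
    (h : ∀ θ, I z θ E =
      (∑ S ∈ Finset.powersetCard E.card A, θ S) / (A.card.choose E.card : ℝ)) :
    z * (av E * av (A \ E)) = av A := by
  rw [coset_eq hz (av_mem_M A) (fun θ => by rw [h, I_av_uniform hE]), ← mul_assoc,
    av_mul_av' hE, av_mul_av' Finset.sdiff_subset]

def Sh (A : Finset (Fin n)) (l : ℕ) : Prop :=
  ∃ L : List (LazyT n), L.length = l ∧ Inside A L ∧ mu L = av A

def Hat (E A : Finset (Fin n)) (l : ℕ) : Prop :=
  ∃ L : List (LazyT n), L.length = l ∧ Inside A L ∧ mu L * (av E * av (A \ E)) = av A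

lemma Sh.step {E A : Finset (Fin n)} (hE : E ⊆ A) {a b c : ℕ} (h1 : Sh E a) (h2 : Sh (A \ E) b)
    (h3 : Hat E A c) : Sh A (a + b + c) := by
  obtain ⟨L1, l1, i1, e1⟩ := h1
  obtain ⟨L2, l2, i2, e2⟩ := h2
  obtain ⟨L3, l3, i3, e3⟩ := h3
  refine ⟨L2 ++ L1 ++ L3, by simp; omega,
    ((i2.mono Finset.sdiff_subset).append (i1.mono hE)).append i3, ?_⟩
  rw [mu_append, mu_append, e1, e2, e3]

lemma G_small {A : Finset (Fin n)} (h : A.card ≤ 1) : G A = {1} := by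
  ext g
  rw [Finset.mem_singleton]
  constructor
  · intro hg
    ext x
    by_cases hx : x ∈ A
    · rw [Finset.card_le_one.1 h _ (apply_mem_of_G hg hx) _ hx]; rfl
    · rw [mem_G.1 hg x hx]; rfl
  · rintro rfl; exact one_mem_G A

lemma Sh_small {A : Finset (Fin n)} (h : A.card ≤ 1) : Sh A 0 := by
  refine ⟨[], rfl, by intro t ht; simp at ht, ?_⟩
  rw [av, G_small h]; simp [mu, of_one]

/-- one counter -/
lemma one_counter (a : Fin n) (B : Finset (Fin n)) (ha : a ∉ B) :
    ∃ L : List (LazyT n), L.length = B.card ∧ Inside (insert a B) L ∧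
      ∀ θ, I (mu L) θ {a} = (∑ x ∈ insert a B, θ {x}) / ((insert a B).card : ℝ) := by
  suffices h : ∃ L : List (LazyT n), L.length = B.card ∧ Inside (insert a B) L ∧
      ∀ θ, I (mu L) θ {a} = (∑ x ∈ insert a B, θ {x}) / ((insert a B).card : ℝ) by
    exact h
  induction B using Finset.induction_on with
  | empty =>
    refine ⟨[], rfl, by intro t ht; simp at ht, ?_⟩
    intro θ; simp [mu, I_one]
  | insert x B hx ih =>
    have hax : a ≠ x := by rintro rfl; exact ha (Finset.mem_insert_self _ _)
    have haB : a ∉ B := fun h => ha (Finset.mem_insert_of_mem h)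
    obtain ⟨L, l, i, e⟩ := ih haB
    have hxB : x ∉ insert a B := by
      rw [Finset.mem_insert]; rintro (h | h)
      · exact hax h.symm
      · exact hx h
    refine ⟨(a, x, 1 / ((B.card : ℝ) + 2)) :: L, by simp [l, hx], ?_, ?_⟩
    · intro t ht
      rcases List.mem_cons.1 ht with rfl | ht
      · refine ⟨⟨hax, by positivity, ?_⟩, by simp, by simp⟩
        rw [div_le_one (by positivity)]
        have : (0 : ℝ) ≤ B.card := by positivity
        linarith
      · exact (i.mono (Finset.insert_subset_insert a (Finset.subset_insert x B))) t ht
    · intro θ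
      rw [mu, I_mul, I_stp, e]
      have h1 : swap a x • ({a} : Finset (Fin n)) = {x} := by
        simp
      have h2 : ∀ θ, I (mu L) θ {x} = θ {x} := by
        intro θ
        have hM := mu_mem_M i
        have : I (mu L) θ {x} = I (mu L) (fun _ => θ {x}) {a} := by
          refine M_induct (P := fun z => I z θ {x} = I z (fun _ => θ {x}) {a}) ?_ ?_ ?_ ?_ hM
          · rw [I_zero, I_zero]
          · intro g hg
            rw [I_of, I_of]
            have : g • ({x} : Finset (Fin n)) = {x} := by
              rw [Finset.smul_finset_singleton]
              exact congrArg _ (mem_G.1 hg x hxB)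
            rw [this]
          · intro y z hy hz; rw [I_add, I_add, hy, hz]
          · intro r y hy; rw [I_smul, I_smul, hy]
        rw [this, e, Finset.sum_const, nsmul_eq_mul]
        have : 0 < (insert a B).card := by simp
        field_simp
      simp only [h1, h2]
      rw [Finset.insert_comm, Finset.sum_insert hxB, Finset.card_insert_of_notMem hxB,
        Finset.card_insert_of_notMem haB]
      push_cast
      have : (0 : ℝ) ≤ B.card := by positivity
      field_simp
      ring

lemma Hat_one {a : Fin n} {A : Finset (Fin n)} (ha : a ∈ A) : Hat {a} A (A.card - 1) := by
  obtain ⟨L, l, i, e⟩ := one_counter a (A.erase a) (Finset.notMem_erase a A)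
  rw [Finset.insert_erase ha] at i e
  refine ⟨L, by rw [l, Finset.card_erase_of_mem ha], i, ?_⟩
  apply hat_main (Finset.singleton_subset_iff.2 ha) (mu_mem_M i)
  intro θ
  rw [e, Finset.card_singleton, Nat.choose_one_right, Finset.powersetCard_one, Finset.sum_map]
  rfl

lemma Sh_succ {l b : ℕ} (h : ∀ B : Finset (Fin n), B.card = b → Sh B l)
    (B : Finset (Fin n)) (hB : B.card = b + 1) : Sh B (l + b) := by
  obtain ⟨a, ha⟩ : B.Nonempty := Finset.card_pos.1 (by omega)
  have := Sh.step (Finset.singleton_subset_iff.2 ha) (Sh_small (A := {a}) (by simp))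
    (h (B \ {a}) (by rw [Finset.card_sdiff_of_subset (Finset.singleton_subset_iff.2 ha)]; simp [hB]))
    (Hat_one ha)
  rw [hB] at this
  simpa using this

lemma cubic_roots (m : ℝ) (hm : 6 ≤ m) (c3 c2 N : ℝ) (h3 : c3 = m * (m - 1) * (m - 2) / 6)
    (h2 : c2 = m * (m - 1) / 2) (hN : N = c3 + 6 * c2 + 15 * m + 20) :
    ∃ p q r : ℝ, (0 ≤ p ∧ p ≤ 1) ∧ (0 ≤ q ∧ q ≤ 1) ∧ (0 ≤ r ∧ r ≤ 1) ∧
      N * ((1 - p) * (1 - q) * (1 - r)) = c3 ∧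
      N * (p * (1 - q) * (1 - r) + (1 - p) * q * (1 - r) + (1 - p) * (1 - q) * r) = 6 * c2 ∧
      N * (p * q * (1 - r) + p * (1 - q) * r + (1 - p) * q * r) = 15 * m ∧
      N * (p * q * r) = 20 := by
  let g : ℝ → ℝ := fun x => N * x ^ 3 - (6 * c2 + 30 * m + 60) * x ^ 2 + (15 * m + 60) * x - 20
  have hg : Continuous g := by fun_prop
  have g' : ∀ x, g x = c3 * x ^ 3 - 6 * c2 * x ^ 2 * (1 - x) + 15 * m * x * (1 - x) ^ 2
      - 20 * (1 - x) ^ 3 := by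
    intro x; simp only [g]; rw [hN]; ring
  have h0 : g 0 < 0 := by rw [g']; norm_num
  have h1 : 0 < g 1 := by
    rw [g', h3]
    have : 0 < m * (m - 1) * (m - 2) := by
      apply mul_pos (mul_pos _ _) <;> linarith
    norm_num; linarith
  set u := 4 / (m + 4) with hu
  set v := 8 / (m + 8) with hv
  have hm4 : (0 : ℝ) < m + 4 := by linarith
  have hm8 : (0 : ℝ) < m + 8 := by linarith
  have hu0 : 0 < u := by positivity
  have huv : u < v := by
    rw [hu, hv, div_lt_div_iff₀ hm4 hm8]; linarith
  have hv1 : v < 1 := by rw [hv, div_lt_one hm8]; linarith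
  have hgu : 0 < g u := by
    have : g u = (64 * (m ^ 3 / 24 + m ^ 2 / 4 + m / 3)) / (m + 4) ^ 3 := by
      rw [g', hu, h3, h2]; field_simp; ring
    rw [this]; positivity
  have hgv : g v < 0 := by
    have : g v = -(512 * (m ^ 3 * (5 / 384) + m ^ 2 / 8 - m / 3)) / (m + 8) ^ 3 := by
      rw [g', hv, h3, h2]; field_simp; ring
    rw [this]
    apply div_neg_of_neg_of_pos _ (by positivity)
    nlinarith [mul_pos (show (0:ℝ) < m by linarith) (show (0:ℝ) < m by linarith), pow_pos (show (0:ℝ) < m by linarith) 3]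
  obtain ⟨p, hp, gp⟩ := intermediate_value_Ioo hu0.le hg.continuousOn ⟨h0, hgu⟩
  obtain ⟨q, hq, gq⟩ := intermediate_value_Ioo' huv.le hg.continuousOn ⟨hgv, hgu⟩
  obtain ⟨r, hr, gr⟩ := intermediate_value_Ioo hv1.le hg.continuousOn ⟨hgv, h1⟩
  obtain ⟨hp1, hp2⟩ := hp
  obtain ⟨hq1, hq2⟩ := hq
  obtain ⟨hr1, hr2⟩ := hr
  simp only [g] at gp gq gr
  have d1 : N * (p ^ 2 + p * q + q ^ 2) - (6 * c2 + 30 * m + 60) * (p + q) + (15 * m + 60) = 0 := by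
    have : p - q ≠ 0 := by apply ne_of_lt; linarith
    apply mul_left_cancel₀ this; linear_combination gp - gq
  have d2 : N * (r ^ 2 + r * q + q ^ 2) - (6 * c2 + 30 * m + 60) * (r + q) + (15 * m + 60) = 0 := by
    have : r - q ≠ 0 := by apply ne_of_gt; linarith
    apply mul_left_cancel₀ this; linear_combination gr - gq
  have e1 : N * (p + q + r) = 6 * c2 + 30 * m + 60 := by
    have : p - r ≠ 0 := by apply ne_of_lt; linarith
    apply mul_left_cancel₀ this; linear_combination d1 - d2
  have e2 : N * (p * q + q * r + p * r) = 15 * m + 60 := by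
    linear_combination (p + q) * e1 - d1
  have e3 : N * (p * q * r) = 20 := by
    linear_combination gp - p ^ 2 * e1 + p * e2
  refine ⟨p, q, r, ⟨by linarith, by linarith⟩, ⟨by linarith, by linarith⟩,
    ⟨by linarith, by linarith⟩, ?_, ?_, ?_, e3⟩
  · linear_combination hN - e1 + e2 - e3
  · linear_combination e1 - 2 * e2 + 3 * e3
  · linear_combination e2 - 3 * e3

/-- weighted counting of the outcomes of a rational shuffle on six positions -/
def cnt : List (Fin 6 × Fin 6 × ℕ × ℕ) → Finset (Fin 6) → Finset (Fin 6) → ℕ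
  | [], F, S => if F = S then 1 else 0
  | t :: L, F, S =>
      t.2.2.1 * cnt L (F.map (swap t.1 t.2.1).toEmbedding) S + t.2.2.2 * cnt L F S

def den (L : List (Fin 6 × Fin 6 × ℕ × ℕ)) : ℕ := (L.map fun t => t.2.2.1 + t.2.2.2).prod

noncomputable def toL (v : Fin 6 ↪ Fin n) (t : Fin 6 × Fin 6 × ℕ × ℕ) : LazyT n :=
  (v t.1, v t.2.1, (t.2.2.1 : ℝ) / ((t.2.2.1 : ℝ) + t.2.2.2))

lemma swap_smul_map (v : Fin 6 ↪ Fin n) (a b : Fin 6) (F : Finset (Fin 6)) :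
    swap (v a) (v b) • F.map v = (F.map (swap a b).toEmbedding).map v := by
  ext x
  simp only [Finset.mem_smul_finset, Finset.mem_map, Perm.smul_def]
  constructor
  · rintro ⟨y, ⟨z, hz, rfl⟩, rfl⟩
    exact ⟨swap a b z, ⟨z, hz, rfl⟩, (v.injective.swap_apply a b z).symm⟩
  · rintro ⟨y, ⟨z, hz, rfl⟩, rfl⟩
    exact ⟨v z, ⟨z, hz, rfl⟩, v.injective.swap_apply a b z⟩

lemma I_cnt (v : Fin 6 ↪ Fin n) (L : List (Fin 6 × Fin 6 × ℕ × ℕ)) (hL : den L ≠ 0)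
    (θ : Finset (Fin n) → ℝ) (F : Finset (Fin 6)) :
    (den L : ℝ) * I (mu (L.map (toL v))) θ (F.map v) = ∑ S, (cnt L F S : ℝ) * θ (S.map v) := by
  induction L generalizing F with
  | nil => simp [den, mu, I_one, cnt]
  | cons t L ih =>
    have hd : den (t :: L) = (t.2.2.1 + t.2.2.2) * den L := by simp [den]
    rw [hd] at hL
    have hL' := right_ne_zero_of_mul hL
    have hp := left_ne_zero_of_mul hL
    have hp' : (t.2.2.1 : ℝ) + t.2.2.2 ≠ 0 := by exact_mod_cast hp
    have i1 := ih hL' F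
    have i2 := ih hL' (F.map (swap t.1 t.2.1).toEmbedding)
    rw [List.map_cons, mu, I_mul, I_stp]
    simp only [toL]
    rw [swap_smul_map, hd]
    simp only [cnt]
    push_cast
    simp only [add_mul, Finset.sum_add_distrib, mul_assoc, ← Finset.mul_sum]
    rw [← i1, ← i2]
    field_simp
    ring

def L8 : List (Fin 6 × Fin 6 × ℕ × ℕ) :=
  [(0, 3, 4, 1), (0, 1, 1, 1), (0, 4, 1, 1), (3, 5, 1, 1), (2, 3, 1, 1), (0, 3, 1, 1),
    (1, 5, 1, 1), (2, 4, 1, 1)]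

lemma cnt_L8 : ∀ S : Finset (Fin 6), cnt L8 {0, 1, 2} S = if S.card = 3 then 32 else 0 := by
  decide +kernel

lemma Hat_six {E A : Finset (Fin n)} (hE : E ⊆ A) (hE3 : E.card = 3) (hA : A.card = 6) :
    Hat E A 8 := by
  have hR : (A \ E).card = 3 := by rw [Finset.card_sdiff_of_subset hE]; omega
  obtain ⟨a, b, c, hab, hac, hbc, rfl⟩ := Finset.card_eq_three.1 hE3
  obtain ⟨d, e, f, hde, hdf, hef, hR'⟩ := Finset.card_eq_three.1 hR
  have hd : ∀ x ∈ ({d, e, f} : Finset (Fin n)), x ∈ A ∧ x ≠ a ∧ x ≠ b ∧ x ≠ c := by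
    intro x hx
    rw [← hR'] at hx
    simpa using hx
  have hd' := hd d (by simp)
  have he' := hd e (by simp)
  have hf' := hd f (by simp)
  have haA : a ∈ A := hE (by simp)
  have hbA : b ∈ A := hE (by simp)
  have hcA : c ∈ A := hE (by simp)
  let v0 : Fin 6 → Fin n := ![a, b, c, d, e, f]
  have hinj : Function.Injective v0 := by
    intro i j hij
    fin_cases i <;> fin_cases j <;> simp [v0] at hij ⊢ <;> grind
  let v : Fin 6 ↪ Fin n := ⟨v0, hinj⟩
  have hvA : ∀ i, v i ∈ A := by
    intro i
    change v0 i ∈ A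
    fin_cases i <;> simp [v0] <;> grind
  have hv3 : ({a, b, c} : Finset (Fin n)) = ({0, 1, 2} : Finset (Fin 6)).map v := by
    simp [v, v0, Finset.map_insert]
  have hAv : (Finset.univ : Finset (Fin 6)).map v = A := by
    apply Finset.eq_of_subset_of_card_le
    · intro x hx
      obtain ⟨i, _, rfl⟩ := Finset.mem_map.1 hx
      exact hvA i
    · rw [Finset.card_map, hA]; simp
  have hin : Inside A (L8.map (toL v)) := by
    intro t ht
    obtain ⟨s, hs, rfl⟩ := List.mem_map.1 ht
    refine ⟨⟨?_, ?_, ?_⟩, hvA _, hvA _⟩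
    · intro h
      have h := v.injective h
      have : ∀ s ∈ L8, s.1 ≠ s.2.1 := by decide
      exact this s hs h
    · simp only [toL]; positivity
    · simp only [toL]
      apply div_le_one_of_le₀
      · have : (0:ℝ) ≤ s.2.2.2 := by positivity
        linarith
      · positivity
  refine ⟨L8.map (toL v), by simp [L8], hin, ?_⟩
  apply hat_main hE (mu_mem_M hin)
  intro θ
  have hden : den L8 = 640 := by decide
  have h := I_cnt v L8 (by rw [hden]; norm_num) θ {0, 1, 2}
  rw [← hv3, hden] at h
  simp only [cnt_L8] at h
  rw [hE3, hA]
  have hch : (Nat.choose 6 3 : ℝ) = 20 := by norm_num [Nat.choose]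
  have hsum : ∑ S ∈ Finset.powersetCard 3 A, θ S =
      ∑ S : Finset (Fin 6), if S.card = 3 then θ (S.map v) else 0 := by
    rw [← Finset.sum_filter, ← hAv, Finset.powersetCard_map, Finset.sum_map]
    refine Finset.sum_congr ?_ fun _ _ => rfl
    ext S; simp [Finset.mem_powersetCard]
  rw [hsum, hch]
  have h' : ∑ S : Finset (Fin 6), ((if S.card = 3 then 32 else 0 : ℕ) : ℝ) * θ (S.map v) =
      32 * ∑ S : Finset (Fin 6), if S.card = 3 then θ (S.map v) else 0 := by
    rw [Finset.mul_sum]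
    refine Finset.sum_congr rfl fun S _ => ?_
    split_ifs <;> simp
  rw [h'] at h
  push_cast at h
  linarith


/-- three-element subsets with `j` elements in `D` -/
def cls (C D : Finset (Fin n)) (j : ℕ) : Finset (Finset (Fin n)) :=
  (Finset.powersetCard 3 (C ∪ D)).filter fun S => (S ∩ D).card = j

lemma mem_cls {C D S : Finset (Fin n)} {j : ℕ} :
    S ∈ cls C D j ↔ S ⊆ C ∪ D ∧ S.card = 3 ∧ (S ∩ D).card = j := by
  rw [cls, Finset.mem_filter, Finset.mem_powersetCard, and_assoc]

lemma smul_inter_of_G {B D S : Finset (Fin n)} {σ : Perm (Fin n)} (hσ : σ ∈ G B)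
    (hD : ∀ g ∈ G B, ∀ x ∈ D, g x ∈ D) : (σ • S ∩ D).card = (S ∩ D).card := by
  have : σ • D = D := by
    apply Finset.eq_of_subset_of_card_le
    · intro x hx
      obtain ⟨y, hy, rfl⟩ := Finset.mem_smul_finset.1 hx
      exact hD σ hσ y hy
    · rw [Finset.card_smul_finset]
  conv_lhs => rw [← this]
  rw [← Finset.smul_finset_inter, Finset.card_smul_finset]

lemma cls_smul {C D : Finset (Fin n)} (j : ℕ) {B : Finset (Fin n)} (hB : B ⊆ C ∪ D)
    (hD : ∀ g ∈ G B, ∀ x ∈ D, g x ∈ D) :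
    ∀ σ ∈ G B, ∀ S ∈ cls C D j, σ • S ∈ cls C D j := by
  intro σ hσ S hS
  rw [mem_cls] at hS ⊢
  exact ⟨smul_subset_of_G (G_mono hB hσ) hS.1, by rw [Finset.card_smul_finset, hS.2.1],
    by rw [smul_inter_of_G hσ hD, hS.2.2]⟩

lemma I_cls {C D : Finset (Fin n)} (hCD : Disjoint C D) (θ) {j : ℕ} {S : Finset (Fin n)}
    (hS : S ∈ cls C D j) :
    I (av D * av C) θ S = (∑ T ∈ cls C D j, θ T) / ((cls C D j).card : ℝ) := by
  have hcomm : av D * av C = av C * av D := M_comm hCD.symm (av_mem_M D) (av_mem_M C)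
  apply I_of_const _ _ _ _ _ hS
  · intro S hS S' hS'
    rw [mem_cls] at hS hS'
    have hsp : ∀ S : Finset (Fin n), S ⊆ C ∪ D → (S ∩ C).card + (S ∩ D).card = S.card := by
      intro S hS
      rw [← Finset.card_union_of_disjoint
        (hCD.mono Finset.inter_subset_right Finset.inter_subset_right),
        ← Finset.inter_union_distrib_left, Finset.inter_eq_left.2 hS]
    have h1 := hsp S hS.1
    have h2 := hsp S' hS'.1
    have hdj := Finset.disjoint_left.1 hCD
    set S'' := (S' ∩ C) ∪ (S ∩ D) with hS''
    have h3 : S''.card = 3 := by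
      rw [hS'', Finset.card_union_of_disjoint
        (hCD.mono Finset.inter_subset_right Finset.inter_subset_right)]
      omega
    obtain ⟨k, hk, hk'⟩ := exists_G C S S'' (by
      ext x
      have := @hS.1 x
      have := @hdj x
      simp only [hS'', Finset.mem_sdiff, Finset.mem_union, Finset.mem_inter] at *
      tauto) (by omega)
    obtain ⟨k2, hk2, hk2'⟩ := exists_G D S'' S' (by
      ext x
      have := @hS'.1 x
      have := @hdj x
      simp only [hS'', Finset.mem_sdiff, Finset.mem_union, Finset.mem_inter] at *
      tauto) (by omega)
    have e1 : I (av D * av C) θ S = I (av D * av C) θ S'' := by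
      rw [← hk', I_mul, I_mul, I_av_smul hk]
    have e2 : I (av D * av C) θ S'' = I (av D * av C) θ S' := by
      rw [← hk2', hcomm, I_mul, I_mul, I_av_smul hk2]
    rw [e1, e2]
  · have : ∀ S, I (av D * av C) θ S = I (av C) (I (av D) θ) S := fun S => I_mul _ _ _ _
    simp only [this]
    rw [sum_I_av, sum_I_av]
    · exact cls_smul j Finset.subset_union_right fun g hg x hx => apply_mem_of_G hg hx
    · apply cls_smul j Finset.subset_union_left
      intro g hg x hx
      rw [mem_G.1 hg x (Finset.disjoint_right.1 hCD hx)]; exact hx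

lemma card_cls {C D : Finset (Fin n)} (hCD : Disjoint C D) {j k : ℕ} (hj : j + k = 3) :
    (cls C D j).card = D.card.choose j * C.card.choose k := by
  rw [← Finset.card_powersetCard, ← Finset.card_powersetCard, ← Finset.card_product]
  have hdj := Finset.disjoint_left.1 hCD
  refine Finset.card_nbij' (fun S => (S ∩ D, S ∩ C)) (fun P => P.1 ∪ P.2) ?_ ?_ ?_ ?_
  · intro S hS
    rw [Finset.mem_coe, mem_cls] at hS
    have : (S ∩ C).card + (S ∩ D).card = S.card := by
      rw [← Finset.card_union_of_disjoint
        (hCD.mono Finset.inter_subset_right Finset.inter_subset_right),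
        ← Finset.inter_union_distrib_left, Finset.inter_eq_left.2 hS.1]
    simp only [Finset.coe_product, Set.mem_prod, Finset.mem_coe, Finset.mem_powersetCard]
    refine ⟨⟨Finset.inter_subset_right, hS.2.2⟩, Finset.inter_subset_right, by omega⟩
  · rintro ⟨P, Q⟩ h
    simp only [Finset.coe_product, Set.mem_prod, Finset.mem_coe, Finset.mem_powersetCard] at h
    obtain ⟨⟨h1, h2⟩, h3, h4⟩ := h
    rw [Finset.mem_coe, mem_cls]
    refine ⟨?_, ?_, ?_⟩
    · exact Finset.union_subset (h1.trans Finset.subset_union_right)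
        (h3.trans Finset.subset_union_left)
    · rw [Finset.card_union_of_disjoint (hCD.symm.mono h1 h3)]; omega
    · rw [← h2]; congr 1
      ext x
      have := @h1 x
      have := @h3 x
      have := @hdj x
      simp only [Finset.mem_union, Finset.mem_inter] at *
      tauto
  · intro S hS
    rw [Finset.mem_coe, mem_cls] at hS
    ext x
    have := @hS.1 x
    simp only [Finset.mem_union, Finset.mem_inter] at *
    tauto
  · rintro ⟨P, Q⟩ h
    simp only [Finset.coe_product, Set.mem_prod, Finset.mem_coe, Finset.mem_powersetCard] at h
    obtain ⟨⟨h1, h2⟩, h3, h4⟩ := h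
    ext x
    all_goals
      have := @h1 x
      have := @h3 x
      have := @hdj x
      simp only [Finset.mem_union, Finset.mem_inter] at *
      tauto

lemma sum_cls (C D : Finset (Fin n)) (θ : Finset (Fin n) → ℝ) :
    ∑ S ∈ Finset.powersetCard 3 (C ∪ D), θ S =
      ∑ S ∈ cls C D 0, θ S + ∑ S ∈ cls C D 1, θ S + ∑ S ∈ cls C D 2, θ S
        + ∑ S ∈ cls C D 3, θ S := by
  rw [← Finset.sum_fiberwise_of_maps_to (t := Finset.range 4) (g := fun S => (S ∩ D).card)]
  · simp only [Finset.sum_range_succ, Finset.sum_range_zero, zero_add]; rfl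
  · intro S hS
    rw [Finset.mem_powersetCard] at hS
    have := Finset.card_le_card (Finset.inter_subset_left (s₁ := S) (s₂ := D))
    rw [Finset.mem_range]; omega

lemma cls_triple {C D : Finset (Fin n)} {x y z : Fin n} (hx : x ∈ C ∪ D)
    (hy : y ∈ C ∪ D) (hz : z ∈ C ∪ D) (hxy : x ≠ y) (hxz : x ≠ z) (hyz : y ≠ z) :
    ({x, y, z} : Finset (Fin n)) ∈
      cls C D ((if x ∈ D then 1 else 0) + (if y ∈ D then 1 else 0) + if z ∈ D then 1 else 0) := by
  rw [mem_cls]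
  refine ⟨?_, Finset.card_eq_three.2 ⟨x, y, z, hxy, hxz, hyz, rfl⟩, ?_⟩
  · intro w hw
    simp only [Finset.mem_insert, Finset.mem_singleton] at hw
    rcases hw with rfl | rfl | rfl <;> assumption
  · rw [← Finset.filter_mem_eq_inter, Finset.card_filter,
      Finset.sum_insert (by simp [hxy, hxz]), Finset.sum_insert (by simp [hyz]),
      Finset.sum_singleton, add_assoc]

lemma swap_triple {c d x y : Fin n} (hcx : x ≠ c) (hcy : y ≠ c) (hdx : x ≠ d) (hdy : y ≠ d) :
    swap c d • ({c, x, y} : Finset (Fin n)) = {d, x, y} := by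
  rw [Finset.smul_finset_insert, Finset.smul_finset_insert, Finset.smul_finset_singleton]
  simp only [Perm.smul_def, swap_apply_left, swap_apply_of_ne_of_ne hcx hdx,
    swap_apply_of_ne_of_ne hcy hdy]

lemma choose_cast_three (m : ℕ) :
    ((m.choose 3 : ℕ) : ℝ) = (m : ℝ) * ((m : ℝ) - 1) * ((m : ℝ) - 2) / 6 := by
  rw [Nat.cast_choose_eq_descPochhammer_div]
  simp [descPochhammer_succ_right, descPochhammer_zero, Nat.factorial]

set_option maxHeartbeats 4000000 in
lemma split {C D E E' : Finset (Fin n)} (hCD : Disjoint C D) (hE : E ⊆ C) (hE' : E' ⊆ D)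
    (hE3 : E.card = 3) (hE3' : E'.card = 3) (hD : D.card = 6) (hC : 6 ≤ C.card) {a b : ℕ}
    (s1 : Sh E 3) (s2 : Sh E' 3) (h1 : Hat E C a) (h2 : Hat E' D b) :
    Hat E (C ∪ D) (a + b + 9) := by
  obtain ⟨LE, lE, iE, eE⟩ := s1
  obtain ⟨LE', lE', iE', eE'⟩ := s2
  obtain ⟨LC, lC, iC, eC⟩ := h1
  obtain ⟨LD, lD, iD, eD⟩ := h2
  obtain ⟨p, q, r, hp, hq, hr, g0, g1, g2, g3⟩ := cubic_roots (C.card : ℝ) (by exact_mod_cast hC)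
    _ _ _ rfl rfl rfl
  obtain ⟨c1, c2, c3, hc12, hc13, hc23, hEe⟩ := Finset.card_eq_three.1 hE3
  obtain ⟨d1, d2, d3, hd12, hd13, hd23, hEe'⟩ := Finset.card_eq_three.1 hE3'
  have mc1 : c1 ∈ E := by simp [hEe]
  have mc2 : c2 ∈ E := by simp [hEe]
  have mc3 : c3 ∈ E := by simp [hEe]
  have md1 : d1 ∈ E' := by simp [hEe']
  have md2 : d2 ∈ E' := by simp [hEe']
  have md3 : d3 ∈ E' := by simp [hEe']
  have hne : ∀ x ∈ E, ∀ y ∈ E', x ≠ y := by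
    rintro x hx y hy rfl
    exact Finset.disjoint_left.1 hCD (hE hx) (hE' hy)
  set ν : List (LazyT n) := [(c1, d1, p), (c2, d2, q), (c3, d3, r)] with hν
  have iν : Inside (E ∪ E') ν := by
    intro t ht
    simp only [hν, List.mem_cons, List.not_mem_nil, or_false] at ht
    rcases ht with rfl | rfl | rfl
    · exact ⟨⟨hne _ mc1 _ md1, hp.1, hp.2⟩, Finset.mem_union_left _ mc1, Finset.mem_union_right _ md1⟩
    · exact ⟨⟨hne _ mc2 _ md2, hq.1, hq.2⟩, Finset.mem_union_left _ mc2, Finset.mem_union_right _ md2⟩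
    · exact ⟨⟨hne _ mc3 _ md3, hr.1, hr.2⟩, Finset.mem_union_left _ mc3, Finset.mem_union_right _ md3⟩
  have hEA : E ⊆ C ∪ D := hE.trans Finset.subset_union_left
  have hUA : E ∪ E' ⊆ C ∪ D := Finset.union_subset_union hE hE'
  refine ⟨ν ++ (LE ++ LC) ++ (LE' ++ LD), ?_, ?_, ?_⟩
  · simp [hν]; omega
  · exact ((iν.mono hUA).append ((iE.mono hEA).append (iC.mono Finset.subset_union_left))).append
      ((iE'.mono (hE'.trans Finset.subset_union_right)).append (iD.mono Finset.subset_union_right))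
  rw [mu_append, mu_append, mu_append, mu_append, eE, eE']
  set c := av (C \ E)
  set d := av (D \ E')
  set R := av ((C ∪ D) \ E)
  set N := mu ν
  have hN : N ∈ M (E ∪ E') := mu_mem_M iν
  have dcE : Disjoint (C \ E) E := Finset.sdiff_disjoint
  have dcU : Disjoint (C \ E) (E ∪ E') := Finset.disjoint_union_right.2
    ⟨dcE, hCD.mono Finset.sdiff_subset hE'⟩
  have ddC : Disjoint (D \ E') C := hCD.symm.mono_left Finset.sdiff_subset
  have ddE : Disjoint (D \ E') E := ddC.mono_right hE
  have ddU : Disjoint (D \ E') (E ∪ E') := Finset.disjoint_union_right.2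
    ⟨ddE, Finset.sdiff_disjoint⟩
  have cR : c * R = R := av_mul_av (Finset.sdiff_subset_sdiff Finset.subset_union_left subset_rfl)
  have dR : d * R = R := av_mul_av (by
    intro x hx
    rw [Finset.mem_sdiff, Finset.mem_union]
    exact ⟨Or.inr (Finset.mem_sdiff.1 hx).1, Finset.disjoint_left.1 ddE hx⟩)
  have cE : av E * c = c * av E := (M_comm dcE (av_mem_M _) (av_mem_M _)).symm
  have cN : N * c = c * N := (M_comm dcU (av_mem_M _) hN).symm
  have dE : av E * d = d * av E := (M_comm ddE (av_mem_M _) (av_mem_M _)).symm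
  have dN : N * d = d * N := (M_comm ddU (av_mem_M _) hN).symm
  have dC : av C * d = d * av C := (M_comm ddC (av_mem_M _) (av_mem_M _)).symm
  have st1 : mu LD * av E' * (mu LC * av E * N) * (av E * R)
      = mu LD * av E' * (av C * N) * (av E * R) := by
    calc mu LD * av E' * (mu LC * av E * N) * (av E * R)
        = mu LD * av E' * (mu LC * av E * N) * (av E * (c * R)) := by rw [cR]
      _ = mu LD * av E' * (mu LC * av E * N) * ((c * av E) * R) := by rw [← mul_assoc (av E), cE]
      _ = mu LD * av E' * (mu LC * av E * (N * c)) * (av E * R) := by simp only [mul_assoc]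
      _ = mu LD * av E' * ((mu LC * (av E * c)) * N) * (av E * R) := by
          rw [cN]; simp only [mul_assoc]
      _ = _ := by rw [eC]
  have st2 : mu LD * av E' * (av C * N) * (av E * R) = av D * av C * N * (av E * R) := by
    calc mu LD * av E' * (av C * N) * (av E * R)
        = mu LD * av E' * (av C * N) * (av E * (d * R)) := by rw [dR]
      _ = mu LD * av E' * (av C * N) * ((d * av E) * R) := by rw [← mul_assoc (av E), dE]
      _ = mu LD * av E' * (av C * (N * d)) * (av E * R) := by simp only [mul_assoc]
      _ = mu LD * av E' * ((av C * d) * N) * (av E * R) := by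
          rw [dN]; simp only [mul_assoc]
      _ = (mu LD * (av E' * d)) * av C * N * (av E * R) := by
          rw [dC]; simp only [mul_assoc]
      _ = _ := by rw [eD]
  rw [st1, st2]
  apply hat_main hEA
  · exact M_mul (M_mul (M_mono Finset.subset_union_right (av_mem_M _))
      (M_mono Finset.subset_union_left (av_mem_M _))) (M_mono hUA hN)
  intro θ
  have hNe : N = 1 * stp (c3, d3, r) * stp (c2, d2, q) * stp (c1, d1, p) := rfl
  rw [I_mul, hE3, sum_cls, hNe]
  have hψ : ∀ {j S}, S ∈ cls C D j → _ := fun {j S} hS => I_cls hCD θ (j := j) (S := S) hS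
  set ψ := I (av D * av C) θ
  simp only [I_mul, I_stp, one_mul]
  have nc : ∀ {x}, x ∈ E → x ∉ D := fun hx => Finset.disjoint_left.1 hCD (hE hx)
  have inC : ∀ {x}, x ∈ E → x ∈ C ∪ D := fun hx => hEA hx
  have inD : ∀ {x}, x ∈ E' → x ∈ C ∪ D := fun hx => Finset.mem_union_right _ (hE' hx)
  have n11 := hne _ mc1 _ md1
  have n12 := hne _ mc1 _ md2
  have n13 := hne _ mc1 _ md3
  have n21 := hne _ mc2 _ md1
  have n22 := hne _ mc2 _ md2
  have n23 := hne _ mc2 _ md3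
  have n31 := hne _ mc3 _ md1
  have n32 := hne _ mc3 _ md2
  have n33 := hne _ mc3 _ md3
  have w1 : ∀ x y, x ≠ c1 → y ≠ c1 → x ≠ d1 → y ≠ d1 →
      swap c1 d1 • ({c1, x, y} : Finset (Fin n)) = {d1, x, y} := fun x y => swap_triple
  have w2 : ∀ x y, x ≠ c2 → y ≠ c2 → x ≠ d2 → y ≠ d2 →
      swap c2 d2 • ({x, c2, y} : Finset (Fin n)) = {x, d2, y} := fun x y h1 h2 h3 h4 => by
    rw [Finset.insert_comm, swap_triple h1 h2 h3 h4, Finset.insert_comm]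
  have w3 : ∀ x y, x ≠ c3 → y ≠ c3 → x ≠ d3 → y ≠ d3 →
      swap c3 d3 • ({x, y, c3} : Finset (Fin n)) = {x, y, d3} := fun x y h1 h2 h3 h4 => by
    have e : ∀ z : Fin n, ({x, y, z} : Finset (Fin n)) = {z, x, y} := by
      intro z; ext w; simp only [Finset.mem_insert, Finset.mem_singleton]; tauto
    rw [e, e, swap_triple h1 h2 h3 h4]
  have z1 := nc mc1
  have z2 := nc mc2
  have z3 := nc mc3
  have y1 := hE' md1
  have y2 := hE' md2
  have y3 := hE' md3
  have k000 := hψ (cls_triple (inC mc1) (inC mc2) (inC mc3) hc12 hc13 hc23)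
  have k100 := hψ (cls_triple (inD md1) (inC mc2) (inC mc3) n21.symm n31.symm hc23)
  have k010 := hψ (cls_triple (inC mc1) (inD md2) (inC mc3) n12 hc13 n32.symm)
  have k001 := hψ (cls_triple (inC mc1) (inC mc2) (inD md3) hc12 n13 n23)
  have k110 := hψ (cls_triple (inD md1) (inD md2) (inC mc3) hd12 n31.symm n32.symm)
  have k101 := hψ (cls_triple (inD md1) (inC mc2) (inD md3) n21.symm hd13 n23)
  have k011 := hψ (cls_triple (inC mc1) (inD md2) (inD md3) n12 n13 hd23)
  have k111 := hψ (cls_triple (inD md1) (inD md2) (inD md3) hd12 hd13 hd23)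
  simp only [z1, z2, z3, y1, y2, y3, if_true, if_false, zero_add, add_zero, Nat.reduceAdd]
    at k000 k100 k010 k001 k110 k101 k011 k111
  have q1 : swap c1 d1 • E = {d1, c2, c3} := by
    rw [hEe]; exact w1 _ _ hc12.symm hc13.symm n21 n31
  rw [q1, hEe, w2 d1 c3 n21.symm hc23.symm hd12 n32, w2 c1 c3 hc12 hc23.symm n12 n32,
    w3 d1 d2 n31.symm n32.symm hd13 hd23, w3 d1 c2 n31.symm hc23 hd13 n23,
    w3 c1 d2 hc13 n32.symm n13 hd23, w3 c1 c2 hc13 hc23 n13 n23,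
    k000, k100, k010, k001, k110, k101, k011, k111]
  rw [card_cls hCD (show 0 + 3 = 3 from rfl), card_cls hCD (show 1 + 2 = 3 from rfl),
    card_cls hCD (show 2 + 1 = 3 from rfl), card_cls hCD (show 3 + 0 = 3 from rfl), hD,
    Finset.card_union_of_disjoint hCD, hD]
  push_cast
  rw [choose_cast_three C.card, choose_cast_three (C.card + 6), Nat.cast_choose_two ℝ C.card]
  have v1 : ((Nat.choose 6 0 : ℕ) : ℝ) = 1 := by norm_num
  have v2 : ((Nat.choose 6 1 : ℕ) : ℝ) = 6 := by norm_num
  have v3 : ((Nat.choose 6 2 : ℕ) : ℝ) = 15 := by norm_num [Nat.choose]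
  have v4 : ((Nat.choose 6 3 : ℕ) : ℝ) = 20 := by norm_num [Nat.choose]
  rw [v1, v2, v3, v4, Nat.choose_one_right, Nat.choose_zero_right]
  push_cast
  have hm : (6 : ℝ) ≤ C.card := by exact_mod_cast hC
  generalize (C.card : ℝ) = m at *
  generalize ∑ S ∈ cls C D 0, θ S = T0
  generalize ∑ S ∈ cls C D 1, θ S = T1
  generalize ∑ S ∈ cls C D 2, θ S = T2
  generalize ∑ S ∈ cls C D 3, θ S = T3
  have e : (m + 6) * (m + 6 - 1) * (m + 6 - 2) / 6 =
    m * (m - 1) * (m - 2) / 6 + 6 * (m * (m - 1) / 2) + 15 * m + 20 := by ring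
  rw [e]
  have p3 : 0 < m * (m - 1) * (m - 2) / 6 := by
    apply div_pos (mul_pos (mul_pos _ _) _) <;> linarith
  have p2 : 0 < m * (m - 1) / 2 := by
    apply div_pos (mul_pos _ _) <;> linarith
  generalize m * (m - 1) * (m - 2) / 6 = X at *
  generalize m * (m - 1) / 2 = Y at *
  have hNN : 0 < X + 6 * Y + 15 * m + 20 := by linarith
  generalize X + 6 * Y + 15 * m + 20 = Z at *
  have hm0 : m ≠ 0 := by linarith
  rw [eq_div_iff hNN.ne']
  have f0 : Z * ((1 - p) * (1 - q) * (1 - r)) * (T0 / (1 * X)) = T0 := by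
    rw [g0]; field_simp
  have f1 : Z * (p * (1 - q) * (1 - r) + (1 - p) * q * (1 - r) + (1 - p) * (1 - q) * r)
      * (T1 / (6 * Y)) = T1 := by
    rw [g1]; field_simp
  have f2 : Z * (p * q * (1 - r) + p * (1 - q) * r + (1 - p) * q * r) * (T2 / (15 * m)) = T2 := by
    rw [g2]; field_simp
  have f3 : Z * (p * q * r) * (T3 / (20 * 1)) = T3 := by
    rw [g3]; field_simp
  linear_combination f0 + f1 + f2 + f3

lemma Sh_all (b : ℕ) : ∀ B : Finset (Fin n), B.card = b → Sh B (b.choose 2) := by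
  induction b with
  | zero => intro B hB; exact Sh_small (by omega)
  | succ b ih =>
    intro B hB
    have := Sh_succ ih B hB
    rwa [show b.choose 2 + b = (b + 1).choose 2 by
      rw [Nat.choose_succ_succ' b 1, Nat.choose_one_right, add_comm]] at this

lemma Sh_three {B : Finset (Fin n)} (hB : B.card = 3) : Sh B 3 := Sh_all 3 B hB

lemma Hat_three (q : ℕ) : ∀ A E : Finset (Fin n), E ⊆ A → E.card = 3 → A.card = 6 * (q + 1) →
    Hat E A (17 * q + 8) := by
  induction q with
  | zero => intro A E hE hE3 hA; exact Hat_six hE hE3 (by omega)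
  | succ q ih =>
    intro A E hE hE3 hA
    obtain ⟨C, hEC, hCA, hC⟩ := Finset.exists_subsuperset_card_eq hE
      (show E.card ≤ 6 * (q + 1) by omega) (by omega)
    have hD : (A \ C).card = 6 := by rw [Finset.card_sdiff_of_subset hCA]; omega
    obtain ⟨E', hE', hE3'⟩ := Finset.exists_subset_card_eq (show 3 ≤ (A \ C).card by omega)
    have := split Finset.disjoint_sdiff hEC hE' hE3 hE3' hD (by omega) (Sh_three hE3)
      (Sh_three hE3') (ih C E hEC hE3 hC) (Hat_six hE' hE3' hD)
    rw [Finset.union_sdiff_of_subset hCA] at this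
    convert this using 1
    omega

lemma Sh_mult (q : ℕ) : ∃ l, l + q * (q + 1) / 2 = (6 * q).choose 2 ∧
    ∀ B : Finset (Fin n), B.card = 6 * q → Sh B l := by
  induction q with
  | zero => exact ⟨0, rfl, fun B hB => Sh_small (by omega)⟩
  | succ q ih =>
    obtain ⟨l, hl, h⟩ := ih
    have h1 := Sh_succ h
    have h2 := Sh_succ h1
    have h3 := Sh_succ h2
    refine ⟨3 + (l + 6 * q + (6 * q + 1) + (6 * q + 1 + 1)) + (17 * q + 8), ?_, ?_⟩
    · have e1 : (6 * (q + 1)).choose 2 = (6 * q).choose 2 + 36 * q + 15 := by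
        have : 6 * (q + 1) = 6 * q + 1 + 1 + 1 + 1 + 1 + 1 := by ring
        rw [this]
        simp only [Nat.choose_succ_succ' _ 1, Nat.choose_one_right]
        ring
      have e2 : (q + 1) * (q + 1 + 1) / 2 = q * (q + 1) / 2 + (q + 1) := by
        rw [show (q + 1) * (q + 1 + 1) = q * (q + 1) + 2 * (q + 1) by ring]
        omega
      rw [e1, e2]; omega
    · intro B hB
      obtain ⟨E, hE, hE3⟩ := Finset.exists_subset_card_eq (show 3 ≤ B.card by omega)
      exact Sh.step hE (Sh_three hE3)
        (h3 (B \ E) (by rw [Finset.card_sdiff_of_subset hE]; omega)) (Hat_three q B E hE hE3 hB)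

lemma Sh_gen (q r : ℕ) : ∃ l, l + q * (q + 1) / 2 = (6 * q + r).choose 2 ∧
    ∀ B : Finset (Fin n), B.card = 6 * q + r → Sh B l := by
  induction r with
  | zero => exact Sh_mult q
  | succ r ih =>
    obtain ⟨l, hl, h⟩ := ih
    refine ⟨l + (6 * q + r), ?_, Sh_succ h⟩
    rw [← add_assoc (6 * q) r 1, Nat.choose_succ_succ' _ 1, Nat.choose_one_right, ← hl]; ring

lemma U_le {l : ℕ} (h : Sh (Finset.univ : Finset (Fin n)) l) : U n ≤ l := by
  obtain ⟨L, hl, hi, e⟩ := h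
  refine Nat.sInf_le ⟨L, hl, fun t ht => (hi t ht).1, fun σ => ?_⟩
  rw [← coeff_mu, e, av]
  have hG : G (Finset.univ : Finset (Fin n)) = Finset.univ := by
    ext g; simp [mem_G]
  rw [hG, Finset.card_univ, Fintype.card_perm, Fintype.card_fin]
  simp [coeff_of, MonoidAlgebra.coeff_sum]

end Shf

theorem lower_bound_beaten :
    ∃ ε : ℝ, 0 < ε ∧ ∀ n : ℕ, 6 ≤ n → (U n : ℝ) ≤ (1 - ε) * (n.choose 2 : ℝ) := by
  refine ⟨1 / 55, by norm_num, fun n hn => ?_⟩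
  obtain ⟨l, hl, h⟩ := Shf.Sh_gen (n := n) (n / 6) (n % 6)
  have hn' : 6 * (n / 6) + n % 6 = n := Nat.div_add_mod n 6
  rw [hn'] at hl h
  have hU := Shf.U_le (h Finset.univ (by simp))
  have hU' : (U n : ℝ) ≤ l := by exact_mod_cast hU
  have hev : 2 * ((n / 6) * (n / 6 + 1) / 2) = (n / 6) * (n / 6 + 1) :=
    Nat.mul_div_cancel' (Nat.even_mul_succ_self _).two_dvd
  have hq : 1 ≤ n / 6 := by omega
  have hr : n ≤ 6 * (n / 6) + 5 := by omega
  generalize n / 6 = q at *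
  generalize q * (q + 1) / 2 = s at *
  have hl' : (l : ℝ) + s = n.choose 2 := by exact_mod_cast hl
  have hev' : 2 * (s : ℝ) = q * (q + 1) := by exact_mod_cast hev
  have hq' : (1 : ℝ) ≤ q := by exact_mod_cast hq
  have hr' : (n : ℝ) ≤ 6 * q + 5 := by exact_mod_cast hr
  have hn6 : (6 : ℝ) ≤ n := by exact_mod_cast hn
  have hc := Nat.cast_choose_two ℝ n
  have : (n : ℝ) * (n - 1) ≤ (6 * q + 5) * (6 * q + 4) := by
    apply mul_le_mul <;> linarith
  nlinarith
end

section
/- There exists a constant C > 0 such that for every integer n ≥ 2, U(n) ≤ (2/3)·(n choose 2) + C·n·log n. -/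
open scoped BigOperators

section helpers
open Equiv Finset
open scoped Pointwise

/-- Expected value of `h (σ • x)`, where `σ` is the random permutation produced by `L`. -/
noncomputable def act {n : ℕ} {X : Type*} [MulAction (Perm (Fin n)) X] :
    List (LazyT n) → (X → ℝ) → X → ℝ
  | [], h, x => h x
  | e :: L, h, x =>
      e.2.2 * act L h (swap e.1 e.2.1 • x) + (1 - e.2.2) * act L h x

section act
variable {n : ℕ} {X : Type*} [MulAction (Perm (Fin n)) X]

theorem act_append (L M : List (LazyT n)) (h : X → ℝ) (x : X) :
    act (L ++ M) h x = act L (act M h) x := by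
  induction L generalizing x with
  | nil => rfl
  | cons e L ih => simp only [List.cons_append, act, ih]

theorem act_comm (L : List (LazyT n)) (τ : Perm (Fin n))
    (hτ : ∀ e ∈ L, τ * swap e.1 e.2.1 = swap e.1 e.2.1 * τ) (h : X → ℝ) (x : X) :
    act L (fun y => h (τ • y)) x = act L h (τ • x) := by
  induction L generalizing x with
  | nil => rfl
  | cons e L ih =>
    have h1 := ih (fun e he => hτ e (List.mem_cons_of_mem _ he))
    have h2 := hτ e List.mem_cons_self
    simp only [act, h1, smul_smul, h2]

theorem act_congr (L : List (LazyT n)) (Q : X → Prop)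
    (hQ : ∀ e ∈ L, ∀ x, Q x → Q (swap e.1 e.2.1 • x)) (g g' : X → ℝ)
    (hg : ∀ x, Q x → g x = g' x) (x : X) (hx : Q x) : act L g x = act L g' x := by
  induction L generalizing x with
  | nil => exact hg x hx
  | cons e L ih =>
    have h1 := ih (fun e he => hQ e (List.mem_cons_of_mem _ he))
    simp only [act]
    rw [h1 x hx, h1 _ (hQ e List.mem_cons_self x hx)]

theorem act_orbit (L : List (LazyT n)) (h : X → ℝ) (x : X) (σ : Perm (Fin n)) :
    act L (fun φ : Perm (Fin n) => h (φ • x)) σ = act L h (σ • x) := by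
  induction L generalizing σ with
  | nil => rfl
  | cons e L ih => simp only [act, ih, smul_eq_mul, mul_smul]

theorem act_sum {ι : Type*} (s : Finset ι) (L : List (LazyT n)) (c : ι → ℝ) (f : ι → X → ℝ)
    (x : X) : act L (fun y => ∑ i ∈ s, c i * f i y) x = ∑ i ∈ s, c i * act L (f i) x := by
  induction L generalizing x with
  | nil => rfl
  | cons e L ih =>
    simp only [act, ih, Finset.mul_sum, ← Finset.sum_add_distrib]
    exact Finset.sum_congr rfl fun i _ => by ring

theorem act_eq_sum (L : List (LazyT n)) (h : X → ℝ) (x : X) :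
    act L h x = ∑ σ, permDist L σ * h (σ • x) := by
  induction L generalizing x with
  | nil => simp [act, permDist]
  | cons e L ih =>
    simp only [act, ih, permDist, add_mul, Finset.sum_add_distrib, Finset.mul_sum]
    congr 1
    · rw [← Equiv.sum_comp (Equiv.mulRight (swap e.1 e.2.1))]
      refine Finset.sum_congr rfl fun σ _ => ?_
      simp [smul_smul, mul_assoc]
    · exact Finset.sum_congr rfl fun σ _ => by ring

end act

/-- All entries of `L` are valid and act inside `P`. -/
def OpsIn {n : ℕ} (P : Finset (Fin n)) (L : List (LazyT n)) : Prop :=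
  ∀ e ∈ L, e.Valid ∧ e.1 ∈ P ∧ e.2.1 ∈ P

theorem OpsIn.append {n : ℕ} {P : Finset (Fin n)} {L M : List (LazyT n)} (hL : OpsIn P L)
    (hM : OpsIn P M) : OpsIn P (L ++ M) := by
  intro e he
  rcases List.mem_append.1 he with h | h
  · exact hL e h
  · exact hM e h

theorem OpsIn.mono {n : ℕ} {P Q : Finset (Fin n)} {L : List (LazyT n)} (hL : OpsIn P L)
    (h : P ⊆ Q) : OpsIn Q L := fun e he =>
  ⟨(hL e he).1, h (hL e he).2.1, h (hL e he).2.2⟩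

theorem OpsIn.single {n : ℕ} {P : Finset (Fin n)} {a b : Fin n} {p : ℝ} (ha : a ∈ P) (hb : b ∈ P)
    (hab : a ≠ b) (h0 : 0 ≤ p) (h1 : p ≤ 1) : OpsIn P [((a, b, p) : LazyT n)] := by
  intro e he
  rw [List.mem_singleton] at he
  subst he
  exact ⟨⟨hab, h0, h1⟩, ha, hb⟩

/-- Sum of `g` over the `r`-element subsets of `P`. -/
noncomputable def Sm {n : ℕ} (P : Finset (Fin n)) (r : ℕ) (g : Finset (Fin n) → ℝ) : ℝ :=
  ∑ T ∈ P.powersetCard r, g T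

section sets
variable {n : ℕ}

theorem smul_fix (τ : Perm (Fin n)) (B : Finset (Fin n)) (h : ∀ x ∈ B, τ x = x) : τ • B = B := by
  have : τ • B = B.image (fun x => τ x) := rfl
  rw [this, Finset.image_congr (g := id) (fun x hx => h x hx), Finset.image_id]

theorem swap_fix {a b : Fin n} (B : Finset (Fin n)) (ha : a ∉ B) (hb : b ∉ B) :
    swap a b • B = B := by
  apply smul_fix
  intro x hx
  apply swap_apply_of_ne_of_ne <;> rintro rfl <;> contradiction

theorem Sm_congr {P : Finset (Fin n)} {r : ℕ} {g g' : Finset (Fin n) → ℝ}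
    (h : ∀ T, T ⊆ P → T.card = r → g T = g' T) : Sm P r g = Sm P r g' := by
  refine Finset.sum_congr rfl fun T hT => ?_
  rw [Finset.mem_powersetCard] at hT
  exact h T hT.1 hT.2

theorem Sm_smul (τ : Perm (Fin n)) (P : Finset (Fin n)) (r : ℕ) (g : Finset (Fin n) → ℝ) :
    Sm P r (fun T => g (τ • T)) = Sm (τ • P) r g := by
  unfold Sm
  refine Finset.sum_bij' (fun T _ => τ • T) (fun T _ => τ⁻¹ • T) ?_ ?_ ?_ ?_ ?_
  · intro T hT
    rw [Finset.mem_powersetCard] at hT ⊢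
    exact ⟨Finset.smul_finset_subset_smul_finset hT.1, by rw [Finset.card_smul_finset, hT.2]⟩
  · intro T hT
    rw [Finset.mem_powersetCard] at hT ⊢
    refine ⟨?_, by rw [Finset.card_smul_finset, hT.2]⟩
    have := Finset.smul_finset_subset_smul_finset (a := τ⁻¹) hT.1
    rwa [inv_smul_smul] at this
  · intro T _; simp
  · intro T _; simp
  · intro T _; rfl

theorem swap_smul_self {P : Finset (Fin n)} {a b : Fin n} (ha : a ∈ P) (hb : b ∈ P) :
    swap a b • P = P := by
  apply Finset.eq_of_subset_of_card_le
  · intro x hx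
    rw [Finset.mem_smul_finset] at hx
    obtain ⟨y, hy, rfl⟩ := hx
    rw [Perm.smul_def, swap_apply_def]
    split_ifs <;> assumption
  · rw [Finset.card_smul_finset]

theorem Sm_swap {P : Finset (Fin n)} {a b : Fin n} (ha : a ∈ P) (hb : b ∈ P) (r : ℕ)
    (g : Finset (Fin n) → ℝ) : Sm P r (fun T => g (swap a b • T)) = Sm P r g := by
  rw [Sm_smul, swap_smul_self ha hb]

/-- Operations inside `P` preserve the uniform measure on `r`-subsets of `P`. -/
theorem Sm_act {P B : Finset (Fin n)} (hB : Disjoint B P) (r : ℕ) (L : List (LazyT n))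
    (hL : OpsIn P L) (h : Finset (Fin n) → ℝ) :
    Sm P r (fun T => act L h (B ∪ T)) = Sm P r (fun T => h (B ∪ T)) := by
  induction L with
  | nil => rfl
  | cons e L ih =>
    have ih := ih (fun e he => hL e (List.mem_cons_of_mem _ he))
    obtain ⟨-, ha, hb⟩ := hL e List.mem_cons_self
    have key : Sm P r (fun T => act L h (swap e.1 e.2.1 • (B ∪ T))) =
        Sm P r (fun T => act L h (B ∪ T)) := by
      rw [← Sm_swap ha hb r (fun T => act L h (B ∪ T))]
      congr 1
      ext T
      rw [Finset.smul_finset_union, swap_fix B]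
      · exact fun hx => (Finset.disjoint_left.1 hB hx) ha
      · exact fun hx => (Finset.disjoint_left.1 hB hx) hb
    rw [← ih]
    simp only [act]
    have : ∀ f g : Finset (Fin n) → ℝ, Sm P r (fun T => e.2.2 * f T + (1 - e.2.2) * g T) =
        e.2.2 * Sm P r f + (1 - e.2.2) * Sm P r g := by
      intro f g
      simp only [Sm, Finset.sum_add_distrib, Finset.mul_sum]
    rw [this, key]
    ring

theorem Sm_insert {P : Finset (Fin n)} {z : Fin n} (hz : z ∉ P) (r : ℕ)
    (g : Finset (Fin n) → ℝ) :
    Sm (insert z P) (r + 1) g = Sm P (r + 1) g + Sm P r (fun T => g (insert z T)) := by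
  unfold Sm
  rw [Finset.powersetCard_succ_insert hz, Finset.sum_union, Finset.sum_image]
  · intro S hS T hT hST
    have hS' : z ∉ S := fun h => hz ((Finset.mem_powersetCard.1 hS).1 h)
    have hT' : z ∉ T := fun h => hz ((Finset.mem_powersetCard.1 hT).1 h)
    rw [← Finset.erase_insert hS', ← Finset.erase_insert hT', hST]
  · rw [Finset.disjoint_left]
    intro S hS hS'
    rw [Finset.mem_image] at hS'
    obtain ⟨T, -, rfl⟩ := hS'
    exact hz ((Finset.mem_powersetCard.1 hS).1 (Finset.mem_insert_self z T))

theorem Sm_zero (P : Finset (Fin n)) (g : Finset (Fin n) → ℝ) : Sm P 0 g = g ∅ := by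
  simp [Sm]

theorem Sm_gt {P : Finset (Fin n)} {r : ℕ} (h : P.card < r) (g : Finset (Fin n) → ℝ) :
    Sm P r g = 0 := by
  simp [Sm, Finset.powersetCard_eq_empty.2 h]

/-- Sum over the subsets of a disjoint union. -/
theorem Sm_union {A C : Finset (Fin n)} (hAC : Disjoint A C) (r : ℕ)
    (g : Finset (Fin n) → ℝ) :
    Sm (A ∪ C) r g =
      ∑ j ∈ Finset.range (r + 1), Sm A (r - j) (fun T => Sm C j (fun T' => g (T ∪ T'))) := by
  unfold Sm
  have : ∀ j ∈ Finset.range (r + 1),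
      ∑ T ∈ A.powersetCard (r - j), ∑ T' ∈ C.powersetCard j, g (T ∪ T') =
      ∑ S ∈ (A ∪ C).powersetCard r with (S ∩ C).card = j, g S := by
    intro j hj
    rw [Finset.mem_range] at hj
    rw [← Finset.sum_product']
    refine Finset.sum_bij' (fun p _ => p.1 ∪ p.2) (fun S _ => (S ∩ A, S ∩ C)) ?_ ?_ ?_ ?_ ?_
    · rintro ⟨T, T'⟩ hT
      simp only [Finset.mem_product, Finset.mem_powersetCard] at hT
      obtain ⟨⟨h1, h2⟩, h3, h4⟩ := hT
      have hTT : Disjoint T T' := Finset.disjoint_of_subset_left h1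
        (Finset.disjoint_of_subset_right h3 hAC)
      have hTC : T ∩ C = ∅ := Finset.disjoint_iff_inter_eq_empty.1
        (Finset.disjoint_of_subset_left h1 hAC)
      simp only [Finset.mem_filter, Finset.mem_powersetCard]
      refine ⟨⟨Finset.union_subset_union h1 h3, ?_⟩, ?_⟩
      · rw [Finset.card_union_of_disjoint hTT]; omega
      · rw [Finset.union_inter_distrib_right, hTC, Finset.empty_union,
          Finset.inter_eq_left.2 h3, h4]
    · intro S hS
      simp only [Finset.mem_filter, Finset.mem_powersetCard] at hS
      obtain ⟨⟨h1, h2⟩, h3⟩ := hS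
      simp only [Finset.mem_product, Finset.mem_powersetCard]
      refine ⟨⟨Finset.inter_subset_right, ?_⟩, Finset.inter_subset_right, h3⟩
      have h5 : S ∩ A ∪ S ∩ C = S := by
        rw [← Finset.inter_union_distrib_left, Finset.inter_eq_left.2 h1]
      have h6 : Disjoint (S ∩ A) (S ∩ C) := Finset.disjoint_of_subset_left
        Finset.inter_subset_right (Finset.disjoint_of_subset_right Finset.inter_subset_right hAC)
      have h7 := Finset.card_union_of_disjoint h6
      rw [h5] at h7
      omega
    · rintro ⟨T, T'⟩ hT
      simp only [Finset.mem_product, Finset.mem_powersetCard] at hT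
      obtain ⟨⟨h1, h2⟩, h3, h4⟩ := hT
      have hTC : T ∩ C = ∅ := Finset.disjoint_iff_inter_eq_empty.1
        (Finset.disjoint_of_subset_left h1 hAC)
      have hTA : T' ∩ A = ∅ := Finset.disjoint_iff_inter_eq_empty.1
        (Finset.disjoint_of_subset_left h3 hAC.symm)
      simp only [Finset.union_inter_distrib_right, hTC, hTA, Finset.inter_eq_left.2 h1,
        Finset.inter_eq_left.2 h3, Finset.union_empty, Finset.empty_union]
    · intro S hS
      simp only [Finset.mem_filter, Finset.mem_powersetCard] at hS
      simp only
      rw [← Finset.inter_union_distrib_left, Finset.inter_eq_left.2 hS.1.1]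
    · intro p _; rfl
  rw [Finset.sum_congr rfl this]
  symm
  apply Finset.sum_fiberwise_of_maps_to
  intro S hS
  rw [Finset.mem_powersetCard] at hS
  rw [Finset.mem_range]
  have := Finset.card_le_card (Finset.inter_subset_left (s₁ := S) (s₂ := C))
  omega

end sets

section ws
variable {n : ℕ}

/-- Average over `r`-subsets of a function that only depends on whether `t` is in the subset. -/
theorem Sm_avg {K : Finset (Fin n)} {t : Fin n} (ht : t ∈ K) {r : ℕ} (hr : r ≤ K.card)
    (f : Finset (Fin n) → ℝ) (a b : ℝ)
    (ha : ∀ T, T ⊆ K → T.card = r → t ∈ T → f T = a)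
    (hb : ∀ T, T ⊆ K → T.card = r → t ∉ T → f T = b) :
    Sm K r f / (K.card.choose r : ℝ) = (r / K.card : ℝ) * a + (1 - r / K.card : ℝ) * b := by
  obtain ⟨K', htK', rfl⟩ : ∃ K', t ∉ K' ∧ insert t K' = K :=
    ⟨K.erase t, Finset.notMem_erase t K, Finset.insert_erase ht⟩
  rw [Finset.card_insert_of_notMem htK'] at *
  cases r with
  | zero =>
    rw [Sm_zero, hb ∅ (by simp) (by simp) (by simp)]
    simp
  | succ s =>
    rw [Sm_insert htK']
    have h1 : Sm K' (s + 1) f = (K'.card.choose (s + 1) : ℝ) * b := by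
      rw [Sm_congr (g' := fun _ => b)]
      · simp [Sm]
      · intro T hT hc
        exact hb T (hT.trans (Finset.subset_insert _ _)) hc (fun h => htK' (hT h))
    have h2 : Sm K' s (fun T => f (insert t T)) = (K'.card.choose s : ℝ) * a := by
      rw [Sm_congr (g' := fun _ => a)]
      · simp [Sm]
      · intro T hT hc
        refine ha _ (Finset.insert_subset_insert _ hT) ?_ (Finset.mem_insert_self _ _)
        rw [Finset.card_insert_of_notMem (fun h => htK' (hT h)), hc]
    rw [h1, h2]
    have h3 : ((K'.card + 1).choose (s + 1) : ℝ) = K'.card.choose s + K'.card.choose (s + 1) := by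
      exact_mod_cast Nat.choose_succ_succ _ _
    have h4 : ((K'.card : ℝ) + 1) * K'.card.choose s
        = (K'.card + 1).choose (s + 1) * ((s : ℝ) + 1) := by
      exact_mod_cast Nat.add_one_mul_choose_eq _ _
    have h5 : ((K'.card + 1).choose (s + 1) : ℝ) ≠ 0 := by
      exact_mod_cast (Nat.choose_pos hr).ne'
    have h6 : (K'.card : ℝ) + 1 ≠ 0 := by positivity
    have h7 : (K'.card.choose (s + 1) : ℝ) = (K'.card + 1).choose (s + 1) - K'.card.choose s := by
      linarith
    rw [h7]
    push_cast
    rw [div_eq_iff h5]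
    field_simp
    linear_combination (a - b) * h4

theorem oneop {K B : Finset (Fin n)} {t z : Fin n} (ht : t ∈ K) (hz : z ∉ K) (hzB : z ∉ B)
    (hB : Disjoint B K) {r : ℕ} (hr : r ≤ K.card) (p : ℝ) (H : Finset (Fin n) → ℝ) (G0 G1 : ℝ)
    (h0 : ∀ T, T ⊆ K → T.card = r → H (B ∪ T) = G0)
    (h1 : ∀ T, T ⊆ K → T.card + 1 = r → H (insert z B ∪ T) = G1) :
    Sm K r (fun T => act [((t, z, p) : LazyT n)] H (B ∪ T)) / (K.card.choose r : ℝ)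
      = (1 - r / K.card * p) * G0 + r / K.card * p * G1 := by
  have htB : t ∉ B := fun h => Finset.disjoint_left.1 hB h ht
  have htz : t ≠ z := fun h => hz (h ▸ ht)
  rw [Sm_avg ht hr _ (p * G1 + (1 - p) * G0) G0]
  · ring
  · intro T hT hc htT
    have hs : swap t z • (B ∪ T) = insert z B ∪ T.erase t := by
      have hT' : T = insert t (T.erase t) := (Finset.insert_erase htT).symm
      have hzT : z ∉ T := fun h => hz (hT h)
      rw [Finset.smul_finset_union, swap_fix B htB hzB]
      conv_lhs => rw [hT']
      rw [Finset.smul_finset_insert, swap_fix (T.erase t) (by simp) (by simp [hzT]),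
        Perm.smul_def, swap_apply_left, Finset.union_insert, Finset.insert_union]
    simp only [act]
    rw [hs, h0 T hT hc, h1 _ ((Finset.erase_subset _ _).trans hT)]
    rw [Finset.card_erase_add_one htT, hc]
  · intro T hT hc htT
    have hzT : z ∉ T := fun h => hz (hT h)
    simp only [act]
    rw [swap_fix (B ∪ T) (by simp [htB, htT]) (by simp [hzT, hzB]), h0 T hT hc]
    ring

theorem oneop' {K B : Finset (Fin n)} {t z : Fin n} (ht : t ∈ K) (hz : z ∉ K) (hzB : z ∉ B)
    (hB : Disjoint B K) {r : ℕ} (hr : r ≤ K.card) (p : ℝ) (H : Finset (Fin n) → ℝ) (G0 G1 : ℝ)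
    (h1 : ∀ T, T ⊆ K → T.card = r → H (insert z B ∪ T) = G1)
    (h0 : ∀ T, T ⊆ K → T.card = r + 1 → H (B ∪ T) = G0) :
    Sm K r (fun T => act [((t, z, p) : LazyT n)] H (insert z B ∪ T)) / (K.card.choose r : ℝ)
      = (1 - (1 - r / K.card) * p) * G1 + (1 - r / K.card) * p * G0 := by
  have htB : t ∉ B := fun h => Finset.disjoint_left.1 hB h ht
  have htz : t ≠ z := fun h => hz (h ▸ ht)
  rw [Sm_avg ht hr _ G1 (p * G0 + (1 - p) * G1)]
  · ring
  · intro T hT hc htT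
    simp only [act]
    rw [swap_smul_self (P := insert z B ∪ T) (by simp [htT]) (by simp), h1 T hT hc]
    ring
  · intro T hT hc htT
    have hzT : z ∉ T := fun h => hz (hT h)
    have hs : swap t z • (insert z B ∪ T) = B ∪ insert t T := by
      rw [Finset.smul_finset_union, Finset.smul_finset_insert, swap_fix B htB hzB,
        swap_fix T htT hzT, Perm.smul_def, swap_apply_right, Finset.union_insert,
        Finset.insert_union]
    simp only [act]
    rw [hs, h1 T hT hc, h0 _ (Finset.insert_subset ht hT)]
    rw [Finset.card_insert_of_notMem htT, hc]

/-- `L` spreads any pattern on `K` uniformly over `P`. -/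
def WS (K P : Finset (Fin n)) (L : List (LazyT n)) : Prop :=
  K ⊆ P ∧ OpsIn P L ∧ ∀ (h : Finset (Fin n) → ℝ) (B R : Finset (Fin n)), Disjoint B P → R ⊆ K →
    act L h (B ∪ R) = Sm P R.card (fun T => h (B ∪ T)) / (P.card.choose R.card : ℝ)

theorem WS_alg (N s : ℕ) (hs : s ≤ N) (s0 s1 : ℝ) (h0 : s = N → s0 = 0) :
    (1 - ((s : ℝ) + 1) / ((N : ℝ) + 1)) * (s0 / (N.choose (s + 1) : ℝ))
      + ((s : ℝ) + 1) / ((N : ℝ) + 1) * (s1 / (N.choose s : ℝ))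
      = (s0 + s1) / ((N + 1).choose (s + 1) : ℝ) := by
  have h4 : ((N : ℝ) + 1) * N.choose s = (N + 1).choose (s + 1) * ((s : ℝ) + 1) := by
    exact_mod_cast Nat.add_one_mul_choose_eq _ _
  have h6 : (N : ℝ) + 1 ≠ 0 := by positivity
  have h6' : (s : ℝ) + 1 ≠ 0 := by positivity
  have h7 : (N.choose s : ℝ) ≠ 0 := by exact_mod_cast (Nat.choose_pos hs).ne'
  have h8 : ((N + 1).choose (s + 1) : ℝ) = ((N : ℝ) + 1) * N.choose s / ((s : ℝ) + 1) := by
    rw [eq_div_iff h6', h4]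
  rw [h8]
  rcases hs.eq_or_lt with h | h
  · rw [h0 h]
    field_simp
    ring
  · have h9 : (N.choose (s + 1) : ℝ) * ((s : ℝ) + 1) = N.choose s * ((N : ℝ) - s) := by
      have := Nat.choose_succ_right_eq N s
      rw [← Nat.cast_sub hs]
      exact_mod_cast this
    have h10 : (N : ℝ) - s ≠ 0 := by
      have : (s : ℝ) < N := by exact_mod_cast h
      linarith
    have h11 : (N.choose (s + 1) : ℝ) = N.choose s * ((N : ℝ) - s) / ((s : ℝ) + 1) := by
      rw [eq_div_iff h6', h9]
    rw [h11]
    field_simp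
    ring

theorem WS.base (t : Fin n) : WS {t} {t} [] := by
  refine ⟨subset_rfl, fun e he => by simp at he, ?_⟩
  intro h B R _ hR
  rcases Finset.subset_singleton_iff.1 hR with rfl | rfl
  · simp [act, Sm_zero]
  · simp [act, Sm, Finset.powersetCard_one]

theorem WS.insertion {K P : Finset (Fin n)} {L1 L2 : List (LazyT n)} (h1 : WS K K L1)
    (h2 : WS K P L2) {t z : Fin n} (ht : t ∈ K) (hz : z ∉ P) :
    WS K (insert z P)
      (L1 ++ ([((t, z, (K.card : ℝ) / ((P.card : ℝ) + 1)) : LazyT n)] ++ L2)) := by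
  obtain ⟨-, o1, w1⟩ := h1
  obtain ⟨hKP, o2, w2⟩ := h2
  have hsub : P ⊆ insert z P := Finset.subset_insert _ _
  have hcard : K.card ≤ P.card := Finset.card_le_card hKP
  have hcR : (K.card : ℝ) ≤ P.card := by exact_mod_cast hcard
  have hkpos : (0 : ℝ) < K.card := by exact_mod_cast Finset.card_pos.2 ⟨t, ht⟩
  refine ⟨hKP.trans hsub, ?_, ?_⟩
  · refine (o1.mono (hKP.trans hsub)).append (OpsIn.append ?_ (o2.mono hsub))
    refine OpsIn.single (hsub (hKP ht)) (Finset.mem_insert_self _ _) ?_ (by positivity) ?_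
    · rintro rfl
      exact hz (hKP ht)
    · rw [div_le_one (by positivity)]; linarith
  · intro h B R hB hR
    have hBP : Disjoint B P := Finset.disjoint_of_subset_right hsub hB
    have hzB : z ∉ B := fun h => Finset.disjoint_left.1 hB h (Finset.mem_insert_self _ _)
    have hzK : z ∉ K := fun h => hz (hKP h)
    have hBK : Disjoint B K := Finset.disjoint_of_subset_right hKP hBP
    have hzBP : Disjoint (insert z B) P := Finset.disjoint_insert_left.2 ⟨hz, hBP⟩
    rw [act_append, w1 _ B R hBK hR]
    simp only [act_append]
    have hRk : R.card ≤ K.card := Finset.card_le_card hR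
    rw [oneop ht hzK hzB hBK hRk _ _
      (Sm P R.card (fun T => h (B ∪ T)) / (P.card.choose R.card : ℝ))
      (Sm P (R.card - 1) (fun T => h (insert z B ∪ T)) / (P.card.choose (R.card - 1) : ℝ))]
    · rw [Finset.card_insert_of_notMem hz]
      rcases hr : R.card with _ | s
      · simp [Sm_zero]
      · rw [Sm_insert hz, ← WS_alg P.card s (by omega)]
        · have : ((s + 1 : ℕ) : ℝ) / K.card * (K.card / ((P.card : ℝ) + 1))
              = ((s : ℝ) + 1) / ((P.card : ℝ) + 1) := by
            push_cast
            field_simp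
          rw [this]
          simp only [Nat.add_sub_cancel, Finset.union_insert, Finset.insert_union]
        · intro hs; omega
    · intro T hT hc
      rw [w2 h B T hBP hT, hc]
    · intro T hT hc
      rw [w2 h _ T hzBP hT]
      have : R.card - 1 = T.card := by omega
      rw [this]

theorem WS.hub {K : Finset (Fin n)} {L : List (LazyT n)} (h1 : WS K K L)
    {t z : Fin n} (ht : t ∈ K) (hz : z ∉ K) :
    WS (insert z K) (insert z K)
      (L ++ ([((t, z, (K.card : ℝ) / ((K.card : ℝ) + 1)) : LazyT n)] ++ L)) := by
  obtain ⟨-, o, w⟩ := h1.insertion h1 ht hz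
  refine ⟨subset_rfl, o, ?_⟩
  intro h B R hB hR
  by_cases hzR : z ∉ R
  · exact w h B R hB ((Finset.subset_insert_iff_of_notMem hzR).1 hR)
  rw [not_not] at hzR
  obtain ⟨-, o1, w1⟩ := h1
  obtain ⟨R', hzR', rfl⟩ : ∃ R', z ∉ R' ∧ insert z R' = R :=
    ⟨R.erase z, Finset.notMem_erase z R, Finset.insert_erase hzR⟩
  have hR' : R' ⊆ K := (Finset.insert_subset_insert_iff hzR').1 hR
  have hsub : K ⊆ insert z K := Finset.subset_insert _ _
  have hkpos : (0 : ℝ) < K.card := by exact_mod_cast Finset.card_pos.2 ⟨t, ht⟩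
  have hBK : Disjoint B K := Finset.disjoint_of_subset_right hsub hB
  have hzB : z ∉ B := fun h => Finset.disjoint_left.1 hB h (Finset.mem_insert_self _ _)
  have hzBK : Disjoint (insert z B) K := Finset.disjoint_insert_left.2 ⟨hz, hBK⟩
  have hRk : R'.card ≤ K.card := Finset.card_le_card hR'
  have e1 : B ∪ insert z R' = insert z B ∪ R' := by
    rw [Finset.union_insert, Finset.insert_union]
  rw [act_append, e1, w1 _ _ R' hzBK hR']
  simp only [act_append]
  rw [oneop' ht hz hzB hBK hRk _ _
    (Sm K (R'.card + 1) (fun T => h (B ∪ T)) / (K.card.choose (R'.card + 1) : ℝ))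
    (Sm K R'.card (fun T => h (insert z B ∪ T)) / (K.card.choose R'.card : ℝ))]
  · rw [Finset.card_insert_of_notMem hz, Finset.card_insert_of_notMem hzR', Sm_insert hz,
      ← WS_alg K.card R'.card hRk]
    · simp only [Finset.union_insert, Finset.insert_union]
      field_simp
      ring
    · intro hs
      exact Sm_gt (by omega) _
  · intro T hT hc
    rw [w1 h _ T hzBK hT, hc]
  · intro T hT hc
    rw [w1 h _ T hBK hT, hc]

end ws

section doubling
variable {n : ℕ}

theorem act_append' {X : Type*} [MulAction (Perm (Fin n)) X] (L M : List (LazyT n)) (h : X → ℝ) :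
    act (L ++ M) h = act L (act M h) := funext (act_append L M h)

theorem columns (m : ℕ) : ∀ A C : Finset (Fin n), Disjoint A C → A.card = m → C.card = m →
    ∃ (L : List (LazyT n)) (φ : Perm (Fin n)), L.length = m ∧ OpsIn (A ∪ C) L ∧ φ • A = C ∧
      φ • C = A ∧ (∀ x, x ∉ A ∪ C → φ x = x) ∧
      ∀ (h : Finset (Fin n) → ℝ) (x : Finset (Fin n)), act L h (φ • x) = act L h x := by
  induction m with
  | zero =>
    intro A C _ hA hC
    rw [Finset.card_eq_zero] at hA hC
    subst hA hC
    exact ⟨[], 1, rfl, fun e he => by simp at he, by simp, by simp, by simp, by simp⟩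
  | succ m ih =>
    intro A C hAC hA hC
    obtain ⟨a, A', haA, rfl, hA'⟩ := Finset.card_eq_succ.1 hA
    obtain ⟨c, C', hcC, rfl, hC'⟩ := Finset.card_eq_succ.1 hC
    simp only [Finset.disjoint_insert_left, Finset.disjoint_insert_right, Finset.mem_insert,
      not_or] at hAC
    obtain ⟨⟨hca, hcA⟩, haC, hAC'⟩ := hAC
    have hac : a ≠ c := fun h => hca h.symm
    obtain ⟨L, φ, hl, ho, hφA, hφC, hfix, hinv⟩ := ih A' C' hAC' hA' hC'
    have hφa : φ a = a := hfix a (by simp [haA, haC])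
    have hφc : φ c = c := hfix c (by simp [hcA, hcC])
    have hcomm : φ * swap a c = swap a c * φ := by
      rw [Equiv.mul_swap_eq_swap_mul, hφa, hφc]
    refine ⟨((a, c, 1 / 2) : LazyT n) :: L, φ * swap a c, by simp [hl], ?_, ?_, ?_, ?_, ?_⟩
    · have h1 : OpsIn (insert a A' ∪ insert c C') [((a, c, 1 / 2) : LazyT n)] :=
        OpsIn.single (by simp) (by simp) hac (by norm_num) (by norm_num)
      exact h1.append (ho.mono (Finset.union_subset_union (Finset.subset_insert _ _)
        (Finset.subset_insert _ _)))
    · rw [mul_smul, Finset.smul_finset_insert, swap_fix A' haA hcA, Finset.smul_finset_insert,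
        hφA]
      simp [Perm.smul_def, hφc]
    · rw [mul_smul, Finset.smul_finset_insert, swap_fix C' haC hcC, Finset.smul_finset_insert,
        hφC]
      simp [Perm.smul_def, hφa]
    · intro x hx
      simp only [Finset.mem_union, Finset.mem_insert, not_or] at hx
      rw [Perm.mul_apply, swap_apply_of_ne_of_ne hx.1.1 hx.2.1]
      exact hfix x (by simp [hx.1.2, hx.2.2])
    · intro h x
      have e1 : swap a c • (φ * swap a c) • x = φ • x := by
        rw [hcomm, smul_smul, ← mul_assoc, swap_mul_self, one_mul]
      have e2 : (φ * swap a c) • x = φ • (swap a c • x) := by rw [mul_smul]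
      simp only [act]
      rw [e1, e2, hinv, hinv]
      ring

theorem choose_three (m : ℕ) (hm : 2 ≤ m) :
    (m.choose 3 : ℝ) = m * (m - 1) * (m - 2) / 6 := by
  have h1 := Nat.choose_succ_right_eq m 2
  have h2 : (m.choose 3 : ℝ) * 3 = m.choose 2 * ((m : ℝ) - 2) := by
    have h3 : ((m - 2 : ℕ) : ℝ) = (m : ℝ) - 2 := by push_cast [Nat.cast_sub hm]; ring
    rw [← h3]
    exact_mod_cast h1
  rw [Nat.cast_choose_two] at h2
  linarith

theorem WS.doubling {K A C : Finset (Fin n)} {m : ℕ} (hK : K.card = 3) (hA : A.card = m)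
    (hC : C.card = m) (hm : 3 ≤ m) (hAC : Disjoint A C) {t c : Fin n} (ht : t ∈ K) (hc : c ∈ C)
    {L0 LA LC : List (LazyT n)} (w0 : WS K K L0) (wA : WS K A LA) (wC : WS {c} C LC) :
    ∃ L : List (LazyT n), WS K (A ∪ C) L ∧
      L.length = L0.length + 1 + LA.length + LC.length + m := by
  obtain ⟨Lc, φ, hlen, oc, hφA, hφC, hfix, hinv⟩ := columns m A C hAC hA hC
  obtain ⟨-, o0, w0⟩ := w0
  obtain ⟨hKA, oA, wA⟩ := wA
  obtain ⟨-, oC, wC⟩ := wC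
  have hmR : (3 : ℝ) ≤ m := by exact_mod_cast hm
  have hcA : c ∉ A := fun h => Finset.disjoint_left.1 hAC h hc
  have hA1 : A ⊆ A ∪ C := Finset.subset_union_left
  have hC1 : C ⊆ A ∪ C := Finset.subset_union_right
  set x : ℝ := 3 * m / (2 * (2 * m - 1)) with hx
  have hx1 : x ≤ 1 := by
    rw [hx, div_le_one (by linarith)]; linarith
  have hx0 : 0 ≤ x := by
    rw [hx]; apply div_nonneg <;> linarith
  refine ⟨L0 ++ ([((t, c, x) : LazyT n)] ++ (LA ++ (LC ++ Lc))), ⟨hKA.trans hA1, ?_, ?_⟩, ?_⟩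
  · refine (o0.mono (hKA.trans hA1)).append (OpsIn.append ?_ ((oA.mono hA1).append
      ((oC.mono hC1).append oc)))
    refine OpsIn.single (hA1 (hKA ht)) (hC1 hc) ?_ hx0 hx1
    rintro rfl
    exact hcA (hKA ht)
  · intro h B R hB hR
    have hBA : Disjoint B A := Finset.disjoint_of_subset_right hA1 hB
    have hBC : Disjoint B C := Finset.disjoint_of_subset_right hC1 hB
    have hBK : Disjoint B K := Finset.disjoint_of_subset_right hKA hBA
    have hcB : c ∉ B := fun h => Finset.disjoint_left.1 hBC h hc
    have hcK : c ∉ K := fun h => hcA (hKA h)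
    have hcBA : Disjoint (insert c B) A := Finset.disjoint_insert_left.2 ⟨hcA, hBA⟩
    have hRk : R.card ≤ K.card := Finset.card_le_card hR
    set h' : Finset (Fin n) → ℝ := act Lc h with hh'
    have hSm : Sm (A ∪ C) R.card (fun T => h (B ∪ T)) = Sm (A ∪ C) R.card (fun T => h' (B ∪ T)) :=
      (Sm_act hB R.card Lc oc h).symm
    set Z : ℕ → ℕ → ℝ := fun i j => Sm A i (fun S => Sm C j (fun T => h' (B ∪ (S ∪ T)))) with hZ
    have hφB : φ • B = B := smul_fix φ B fun y hy => hfix y (Finset.disjoint_left.1 hB hy)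
    have hsymm : ∀ i j, Z i j = Z j i := by
      intro i j
      have e1 : Z i j = Sm A i (fun S => Sm C j (fun T => h' (B ∪ (φ • S ∪ φ • T)))) := by
        rw [hZ]
        simp only
        congr 1; ext S; congr 1; ext T
        rw [hh', ← hinv h (B ∪ (S ∪ T)), Finset.smul_finset_union, Finset.smul_finset_union, hφB]
      have e2 : ∀ S, Sm C j (fun T => h' (B ∪ (φ • S ∪ φ • T))) =
          Sm A j (fun T => h' (B ∪ (φ • S ∪ T))) := by
        intro S
        rw [Sm_smul φ C j (fun T => h' (B ∪ (φ • S ∪ T))), hφC]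
      rw [e1]
      simp only [e2]
      rw [Sm_smul φ A i (fun S => Sm A j (fun T => h' (B ∪ (S ∪ T)))), hφA]
      simp only [hZ, Sm]
      rw [Finset.sum_comm]
      refine Finset.sum_congr rfl fun S _ => Finset.sum_congr rfl fun T _ => ?_
      rw [Finset.union_comm S T]
    have hZ0 : ∀ i, Sm A i (fun S => h' (B ∪ S)) = Z i 0 := by
      intro i
      simp only [hZ, Sm_zero, Finset.union_empty]
    have hG0 : ∀ S, S ⊆ A → act LC h' (B ∪ S) = h' (B ∪ S) := by
      intro S hS
      have hd : Disjoint (B ∪ S) C := Finset.disjoint_union_left.2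
        ⟨hBC, Finset.disjoint_of_subset_left hS hAC⟩
      have := wC h' (B ∪ S) ∅ hd (by simp)
      simpa [Sm_zero] using this
    have hG1 : ∀ S, S ⊆ A → act LC h' (insert c B ∪ S) =
        Sm C 1 (fun T => h' (B ∪ (S ∪ T))) / m := by
      intro S hS
      have hd : Disjoint (B ∪ S) C := Finset.disjoint_union_left.2
        ⟨hBC, Finset.disjoint_of_subset_left hS hAC⟩
      have := wC h' (B ∪ S) {c} hd (by simp)
      rw [Finset.card_singleton, Nat.choose_one_right, hC] at this
      simp only [Finset.union_assoc] at this
      rw [← this]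
      congr 1
      ext y
      simp only [Finset.mem_union, Finset.mem_insert, Finset.mem_singleton]
      tauto
    rw [act_append, w0 _ B R hBK hR]
    simp only [act_append', ← hh']
    rw [oneop ht hcK hcB hBK hRk _ _
      (Z R.card 0 / (m.choose R.card : ℝ))
      (Z (R.card - 1) 1 / m / (m.choose (R.card - 1) : ℝ))]
    · rw [hSm, Sm_union hAC, Finset.card_union_of_disjoint hAC, hA, hC, hK]
      rw [hK] at hRk
      have hgoal : ∀ r : ℕ, r ≤ 3 → (1 - (r : ℝ) / (3 : ℕ) * x) * (Z r 0 / (m.choose r : ℝ)) +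
          (r : ℝ) / (3 : ℕ) * x * (Z (r - 1) 1 / m / (m.choose (r - 1) : ℝ)) =
          (∑ j ∈ Finset.range (r + 1), Z (r - j) j) / ((m + m).choose r : ℝ) := by
        intro r hr
        have d1 : (m : ℝ) ≠ 0 := by linarith
        have d2 : (m : ℝ) - 1 ≠ 0 := by linarith
        have d3 : (m : ℝ) - 2 ≠ 0 := by linarith
        have d4 : 2 * (m : ℝ) - 1 ≠ 0 := by linarith
        have d5 : (m : ℝ) * 2 - 1 ≠ 0 := by linarith
        have c3 : ((m + m).choose 3 : ℝ) = 2 * m * (2 * m - 1) * (2 * (m - 1)) / 6 := by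
          rw [choose_three _ (by omega)]; push_cast; ring
        have c2 : ((m + m).choose 2 : ℝ) = m * (2 * m - 1) := by
          rw [Nat.cast_choose_two]; push_cast; ring
        have c3' := choose_three m (by omega)
        have c2' := Nat.cast_choose_two ℝ m
        interval_cases r
        · simp
        · simp [Finset.sum_range_succ, hsymm 0 1, hx]
          field_simp
          ring
        · simp only [Finset.sum_range_succ, Finset.sum_range_zero, hsymm 0 2, c2, c2', hx]
          norm_num
          field_simp
          ring
        · simp only [Finset.sum_range_succ, Finset.sum_range_zero, c2', c3, c3', hx]
          norm_num
          rw [hsymm 0 3, hsymm 1 2]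
          field_simp
          ring
      exact hgoal R.card hRk
    · intro T hT hcT
      rw [wA _ B T hBA (hT), hcT, hA, ← hZ0]
      congr 1
      exact Sm_congr fun S hS _ => hG0 S hS
    · intro T hT hcT
      rw [wA _ _ T hcBA (hT), hA]
      have : R.card - 1 = T.card := by omega
      rw [this]
      congr 1
      rw [Sm_congr (fun S hS _ => hG1 S hS)]
      simp only [hZ, Sm, Finset.sum_div]
  · simp [hlen]; ring

end doubling

section lengths
variable {n : ℕ}

theorem exists_WS_one (t : Fin n) (Q : Finset (Fin n)) : t ∉ Q →
    ∃ L : List (LazyT n), WS {t} (insert t Q) L ∧ L.length = Q.card := by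
  induction Q using Finset.induction_on with
  | empty => exact fun _ => ⟨[], WS.base t, rfl⟩
  | insert z Q hz ih =>
    intro ht
    rw [Finset.mem_insert, not_or] at ht
    obtain ⟨L, hL, hl⟩ := ih ht.2
    have hz' : z ∉ insert t Q := by
      rw [Finset.mem_insert, not_or]
      exact ⟨fun h => ht.1 h.symm, hz⟩
    have := (WS.base t).insertion hL (Finset.mem_singleton_self t) hz'
    rw [Finset.insert_comm] at this
    exact ⟨_, this, by simp [hl, Finset.card_insert_of_notMem hz]⟩

theorem exists_WS_three (K : Finset (Fin n)) (hK : K.card = 3) :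
    ∃ L : List (LazyT n), WS K K L ∧ L.length = 3 := by
  obtain ⟨x, y, z, hxy, hxz, hyz, rfl⟩ := Finset.card_eq_three.1 hK
  have h1 := (WS.base z).hub (Finset.mem_singleton_self z) (z := y) (by simpa using hyz)
  have h2 := h1.hub (t := z) (by simp) (z := x) (by simp [hxy, hxz])
  exact ⟨_, h2, by simp⟩

theorem exists_WS (K : Finset (Fin n)) (hK : K.card = 3) (N : ℕ) :
    ∀ P : Finset (Fin n), P.card = N → K ⊆ P → ∃ L : List (LazyT n), WS K P L ∧
      L.length ≤ 2 * N + 7 * Nat.log 2 N ∧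
      (N % 2 = 0 → L.length + 4 ≤ 2 * N + 7 * Nat.log 2 N) := by
  obtain ⟨L0, w0, hl0⟩ := exists_WS_three K hK
  obtain ⟨t, ht⟩ : K.Nonempty := Finset.card_pos.1 (by omega)
  induction N using Nat.strong_induction_on with
  | _ N ih =>
    intro P hP hKP
    have hN3 : 3 ≤ N := by
      have := Finset.card_le_card hKP
      omega
    rcases hN3.eq_or_lt with h3 | h3
    · have : K = P := Finset.eq_of_subset_of_card_le hKP (by omega)
      subst this
      exact ⟨L0, w0, by omega, by omega⟩
    by_cases hins : N % 2 = 1 ∨ N = 4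
    · obtain ⟨z, hzP, hzK⟩ : ∃ z ∈ P, z ∉ K := by
        by_contra! hcon
        have := Finset.card_le_card (show P ⊆ K from hcon)
        omega
      have hcard : (P.erase z).card = N - 1 := by rw [Finset.card_erase_of_mem hzP, hP]
      obtain ⟨L, w, hl, hl'⟩ := ih (N - 1) (by omega) (P.erase z) hcard
        (Finset.subset_erase.2 ⟨hKP, hzK⟩)
      have w' := w0.insertion w ht (Finset.notMem_erase z P)
      rw [Finset.insert_erase hzP] at w'
      have hlog : Nat.log 2 (N - 1) ≤ Nat.log 2 N := Nat.log_mono_right (by omega)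
      refine ⟨_, w', ?_, ?_⟩
      · simp only [List.length_append, List.length_cons, List.length_nil, hl0]
        rcases hins with h | h
        · have := hl' (by omega)
          omega
        · subst h
          have e1 : Nat.log 2 4 = 2 := by norm_num
          have e2 : Nat.log 2 (4 - 1) = 1 := by norm_num
          rw [e2] at hl
          omega
      · intro h0
        simp only [List.length_append, List.length_cons, List.length_nil, hl0]
        have h : N = 4 := by omega
        subst h
        have e1 : Nat.log 2 4 = 2 := by norm_num
        have e2 : Nat.log 2 (4 - 1) = 1 := by norm_num
        rw [e2] at hl
        rw [e1]
        omega
    · rw [not_or] at hins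
      obtain ⟨m, hm⟩ : ∃ m, N = 2 * m := ⟨N / 2, by omega⟩
      obtain ⟨A, hKA, hAP, hA⟩ := Finset.exists_subsuperset_card_eq hKP (n := m) (by omega)
        (by omega)
      have hC : (P \ A).card = m := by rw [Finset.card_sdiff_of_subset hAP]; omega
      obtain ⟨c, hc⟩ : (P \ A).Nonempty := Finset.card_pos.1 (by omega)
      obtain ⟨LC, wC, hlC⟩ := exists_WS_one c ((P \ A).erase c) (Finset.notMem_erase _ _)
      rw [Finset.insert_erase hc] at wC
      rw [Finset.card_erase_of_mem hc, hC] at hlC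
      obtain ⟨LA, wA, hlA, -⟩ := ih m (by omega) A hA hKA
      obtain ⟨L, w, hl⟩ := WS.doubling hK hA hC (by omega) Finset.disjoint_sdiff ht hc w0 wA wC
      rw [Finset.union_sdiff_of_subset hAP] at w
      have hlog : Nat.log 2 N = Nat.log 2 m + 1 := by
        rw [hm, mul_comm, Nat.log_mul_base (by norm_num) (by omega)]
      refine ⟨L, w, ?_, ?_⟩ <;> omega

end lengths

section full
variable {n : ℕ}

/-- `L` fully shuffles the positions in `P`. -/
def FS (P : Finset (Fin n)) (L : List (LazyT n)) : Prop :=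
  OpsIn P L ∧ ∀ a ∈ P, ∀ b ∈ P, ∀ (h : Perm (Fin n) → ℝ) (x : Perm (Fin n)),
    act L (fun y => h (swap a b * y)) x = act L h x

theorem inv_of_swaps (K P : Finset (Fin n)) (g : Perm (Fin n) → ℝ)
    (hg : ∀ a ∈ P, ∀ b ∈ P, (a ∈ K ↔ b ∈ K) → ∀ φ, g (φ * swap a b) = g φ) (N : ℕ) :
    ∀ κ : Perm (Fin n), κ.support.card = N → (∀ x, x ∉ P → κ x = x) →
      (∀ x, κ x ∈ K ↔ x ∈ K) → ∀ φ, g (φ * κ) = g φ := by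
  induction N using Nat.strong_induction_on with
  | _ N ih =>
    intro κ hN hfix hK φ
    by_cases h1 : κ = 1
    · rw [h1, mul_one]
    obtain ⟨x, hx⟩ : ∃ x, κ x ≠ x := by
      by_contra! hcon
      exact h1 (Equiv.ext hcon)
    have hxP : x ∈ P := by
      by_contra h
      exact hx (hfix x h)
    have hxP' : κ x ∈ P := by
      by_contra h
      exact hx (κ.injective (hfix _ h))
    have hlt := Equiv.Perm.card_support_swap_mul hx
    have e : κ = swap x (κ x) * (swap x (κ x) * κ) := by
      rw [← mul_assoc, swap_mul_self, one_mul]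
    have key := ih _ (hN ▸ hlt) (swap x (κ x) * κ) rfl ?_ ?_ (φ * swap x (κ x))
    · rw [mul_assoc, ← e] at key
      rw [key]
      exact hg x hxP _ hxP' (hK x).symm φ
    · intro y hy
      rw [Perm.mul_apply, hfix y hy]
      apply swap_apply_of_ne_of_ne <;> rintro rfl <;> contradiction
    · intro y
      rw [Perm.mul_apply, ← hK y, swap_apply_def]
      split_ifs with h2 h3
      · rw [h2, hK x]
      · rw [h3, hK x]
      · rfl

theorem act_two (L M : List (LazyT n)) (h : Perm (Fin n) → ℝ) (x : Perm (Fin n)) :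
    act (L ++ M) h x = act M (fun φ => act L (fun y => h (φ * y)) x) 1 := by
  have e : act M h = fun y => ∑ φ, permDist M φ * h (φ * y) := by
    ext y
    rw [act_eq_sum]
    rfl
  rw [act_append, e, act_sum univ L (permDist M) (fun φ y => h (φ * y)), act_eq_sum M]
  simp

theorem FS.combine {K P : Finset (Fin n)} {L1 L2 L3 : List (LazyT n)} (h1 : FS K L1)
    (h2 : FS (P \ K) L2) (h3 : WS K P L3) : FS P ((L1 ++ L2) ++ L3) := by
  obtain ⟨o1, f1⟩ := h1
  obtain ⟨o2, f2⟩ := h2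
  obtain ⟨hKP, o3, w3⟩ := h3
  refine ⟨((o1.mono hKP).append (o2.mono Finset.sdiff_subset)).append o3, ?_⟩
  intro a ha b hb h x
  rw [act_two, act_two]
  set g : Perm (Fin n) → ℝ := fun φ => act (L1 ++ L2) (fun y => h (φ * y)) x with hg
  have eg : (fun φ => act (L1 ++ L2) (fun y => h (swap a b * (φ * y))) x)
      = fun φ => g (swap a b * φ) := by
    ext φ
    simp only [hg, mul_assoc]
  rw [eg]
  -- invariance under swaps
  have hswap : ∀ c ∈ P, ∀ d ∈ P, (c ∈ K ↔ d ∈ K) → ∀ φ, g (φ * swap c d) = g φ := by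
    intro c hc d hd hcd φ
    simp only [hg, act_append', mul_assoc]
    by_cases hcK : c ∈ K
    · have hdK := hcd.1 hcK
      have e1 : act L2 (fun y : Perm (Fin n) => h (φ * (swap c d * y))) =
          fun y => act L2 (fun y => h (φ * y)) (swap c d * y) := by
        ext y
        refine act_comm L2 (swap c d) ?_ (fun y => h (φ * y)) y
        intro e he
        obtain ⟨-, he1, he2⟩ := o2 e he
        rw [Finset.mem_sdiff] at he1 he2
        rw [Equiv.mul_swap_eq_swap_mul]
        congr 2
        · apply swap_apply_of_ne_of_ne
          · intro h; exact he1.2 (h ▸ hcK)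
          · intro h; exact he1.2 (h ▸ hdK)
        · apply swap_apply_of_ne_of_ne
          · intro h; exact he2.2 (h ▸ hcK)
          · intro h; exact he2.2 (h ▸ hdK)
      rw [e1]
      exact f1 c hcK d hdK (act L2 (fun y => h (φ * y))) x
    · have hdK : d ∉ K := fun h => hcK (hcd.2 h)
      have e1 : act L2 (fun y : Perm (Fin n) => h (φ * (swap c d * y))) =
          act L2 (fun y => h (φ * y)) := by
        ext y
        exact f2 c (Finset.mem_sdiff.2 ⟨hc, hcK⟩) d (Finset.mem_sdiff.2 ⟨hd, hdK⟩)
          (fun y => h (φ * y)) y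
      rw [e1]
  -- dependence on the image of `K` only
  let Q : Perm (Fin n) → Prop := fun φ => ∀ x, x ∉ P → φ x = x
  have hdep : ∀ φ ψ, Q φ → Q ψ → φ • K = ψ • K → g φ = g ψ := by
    intro φ ψ hφ hψ hK
    have := inv_of_swaps K P g hswap _ (ψ⁻¹ * φ) rfl ?_ ?_ ψ
    · rw [← this, ← mul_assoc, mul_inv_cancel, one_mul]
    · intro y hy
      rw [Perm.mul_apply, hφ y hy, Perm.inv_eq_iff_eq]
      exact (hψ y hy).symm
    · intro y
      have hKK : (ψ⁻¹ * φ) • K = K := by rw [mul_smul, hK, inv_smul_smul]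
      conv_lhs => rw [← hKK]
      exact Finset.smul_mem_smul_finset_iff (ψ⁻¹ * φ)
  classical
  let ht : Finset (Fin n) → ℝ := fun S =>
    if hS : ∃ φ, Q φ ∧ φ • K = S then g hS.choose else 0
  have hht : ∀ φ, Q φ → g φ = ht (φ • K) := by
    intro φ hφ
    have hex : ∃ ψ, Q ψ ∧ ψ • K = φ • K := ⟨φ, hφ, rfl⟩
    simp only [ht, dif_pos hex]
    exact hdep _ _ hφ hex.choose_spec.1 hex.choose_spec.2.symm
  have hQs : ∀ c ∈ P, ∀ d ∈ P, ∀ φ, Q φ → Q (swap c d * φ) := by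
    intro c hc d hd φ hφ y hy
    rw [Perm.mul_apply, hφ y hy]
    apply swap_apply_of_ne_of_ne <;> rintro rfl <;> contradiction
  have hQ3 : ∀ e ∈ L3, ∀ φ : Perm (Fin n), Q φ → Q (swap e.1 e.2.1 • φ) :=
    fun e he φ hφ => hQs _ (o3 e he).2.1 _ (o3 e he).2.2 φ hφ
  have hQ1 : Q 1 := fun _ _ => rfl
  have c1 := act_congr L3 Q hQ3 g (fun φ => ht (φ • K)) hht 1 hQ1
  have c2 := act_congr L3 Q hQ3 (fun φ => g (swap a b * φ))
    (fun φ => (fun S => ht (swap a b • S)) (φ • K))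
    (fun φ hφ => by rw [hht _ (hQs a ha b hb φ hφ), mul_smul]) 1 hQ1
  rw [c1, c2, act_orbit L3 ht K 1, act_orbit L3 (fun S => ht (swap a b • S)) K 1, one_smul]
  have z1 := w3 ht ∅ K (by simp) subset_rfl
  have z2 := w3 (fun S => ht (swap a b • S)) ∅ K (by simp) subset_rfl
  simp only [Finset.empty_union] at z1 z2
  rw [z1, z2, Sm_swap ha hb]

theorem FS.small (P : Finset (Fin n)) (hP : P.card ≤ 1) : FS P [] := by
  refine ⟨fun e he => by simp at he, ?_⟩
  intro a ha b hb h x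
  have : a = b := Finset.card_le_one.1 hP a ha b hb
  subst this
  simp only [act, Equiv.swap_self]
  rfl

theorem FS.crude (P : Finset (Fin n)) :
    ∃ L : List (LazyT n), FS P L ∧ L.length = P.card.choose 2 := by
  induction P using Finset.induction_on with
  | empty => exact ⟨[], FS.small _ (by simp), rfl⟩
  | insert t Q ht ih =>
    obtain ⟨L2, f2, hl2⟩ := ih
    obtain ⟨L3, w3, hl3⟩ := exists_WS_one t Q ht
    have hs : insert t Q \ {t} = Q := by
      ext y
      simp only [Finset.mem_sdiff, Finset.mem_insert, Finset.mem_singleton]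
      constructor
      · rintro ⟨h | h, h'⟩
        · exact absurd h h'
        · exact h
      · intro h
        exact ⟨Or.inr h, fun h' => ht (h' ▸ h)⟩
    have f := FS.combine (FS.small {t} (by simp)) (hs.symm ▸ f2) w3
    refine ⟨_, f, ?_⟩
    simp only [List.nil_append, List.length_append, hl2, hl3, Finset.card_insert_of_notMem ht]
    rw [Nat.choose_succ_succ' Q.card 1, Nat.choose_one_right]
    exact Nat.add_comm _ _

theorem FS.main (N : ℕ) : ∀ P : Finset (Fin n), P.card = N →
    ∃ L : List (LazyT n), FS P L ∧ 3 * L.length ≤ N ^ 2 + 7 * N * (Nat.log 2 N + 1) := by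
  induction N using Nat.strong_induction_on with
  | _ N ih =>
    intro P hP
    by_cases hN : N < 3
    · obtain ⟨L, f, hl⟩ := FS.crude P
      refine ⟨L, f, ?_⟩
      rw [hl, hP]
      interval_cases N
      · simp
      · simp
      · simp; omega
    · obtain ⟨K, hKP, hK⟩ := Finset.exists_subset_card_eq (s := P) (n := 3) (by omega)
      obtain ⟨L1, f1, hl1⟩ := FS.crude K
      have hc : (P \ K).card = N - 3 := by rw [Finset.card_sdiff_of_subset hKP]; omega
      obtain ⟨L2, f2, hl2⟩ := ih (N - 3) (by omega) (P \ K) hc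
      obtain ⟨L3, w3, hl3, -⟩ := exists_WS K hK N P hP hKP
      refine ⟨_, FS.combine f1 f2 w3, ?_⟩
      have e3 : Nat.choose 3 2 = 3 := rfl
      rw [hK, e3] at hl1
      simp only [List.length_append, hl1]
      have hlog : Nat.log 2 (N - 3) ≤ Nat.log 2 N := Nat.log_mono_right (by omega)
      obtain ⟨M, rfl⟩ : ∃ M, N = M + 3 := ⟨N - 3, by omega⟩
      rw [Nat.add_sub_cancel] at hl2 hlog
      have : 7 * M * (Nat.log 2 M + 1) ≤ 7 * M * (Nat.log 2 (M + 3) + 1) := by gcongr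
      nlinarith

theorem act_one (L : List (LazyT n)) (x : Perm (Fin n)) :
    act L (fun _ : Perm (Fin n) => (1 : ℝ)) x = 1 := by
  induction L generalizing x with
  | nil => rfl
  | cons e L ih => simp only [act, ih]; ring

theorem FS.shuffle {L : List (LazyT n)} (f : FS univ L) : IsShuffle L := by
  obtain ⟨o, f⟩ := f
  refine ⟨fun e he => (o e he).1, ?_⟩
  have hd : ∀ τ, act L (fun y : Perm (Fin n) => if y = τ then (1 : ℝ) else 0) 1 = permDist L τ := by
    intro τ
    rw [act_eq_sum]
    simp
  have hs : ∀ a b τ, permDist L (swap a b * τ) = permDist L τ := by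
    intro a b τ
    rw [← hd, ← hd, ← f a (mem_univ a) b (mem_univ b)]
    congr 1
    ext y
    simp
  have hc : ∀ σ, permDist L σ = permDist L 1 := by
    intro σ
    induction σ using Equiv.Perm.swap_induction_on with
    | one => rfl
    | swap_mul τ a b hab ih => rw [hs, ih]
  have hsum := act_one L 1
  rw [act_eq_sum] at hsum
  simp only [hc, mul_one, Finset.sum_const, Finset.card_univ, Fintype.card_perm, Fintype.card_fin,
    nsmul_eq_mul] at hsum
  intro σ
  rw [hc, eq_div_iff (by positivity), mul_comm]
  exact hsum

theorem U_bound (n : ℕ) : 3 * U n ≤ n ^ 2 + 7 * n * (Nat.log 2 n + 1) := by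
  obtain ⟨L, f, hl⟩ := FS.main n (univ : Finset (Fin n)) (by simp)
  have : U n ≤ L.length := Nat.sInf_le ⟨L, rfl, f.shuffle⟩
  omega

end full

end helpers

theorem U_upper_two_thirds :
    ∃ C : ℝ, 0 < C ∧ ∀ n : ℕ, 2 ≤ n →
      (U n : ℝ) ≤ (2 / 3) * (n.choose 2 : ℝ) + C * n * Real.log n := by
  refine ⟨10, by norm_num, ?_⟩
  intro n hn
  have h1 : 3 * (U n : ℝ) ≤ (n : ℝ) ^ 2 + 7 * n * (Nat.log 2 n + 1) := by
    exact_mod_cast U_bound n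
  have hn2 : (2 : ℝ) ≤ n := by exact_mod_cast hn
  have hl2 : (1 : ℝ) / 2 < Real.log 2 := by
    have := Real.log_two_gt_d9
    linarith
  have hln : Real.log 2 ≤ Real.log n := Real.log_le_log (by norm_num) hn2
  have hlog : (Nat.log 2 n : ℝ) * Real.log 2 ≤ Real.log n := by
    rw [← Real.log_pow]
    apply Real.log_le_log (by positivity)
    exact_mod_cast Nat.pow_log_le_self 2 (by omega)
  have hl3 : (Nat.log 2 n : ℝ) ≤ 2 * Real.log n := by
    have : (0 : ℝ) ≤ Nat.log 2 n := Nat.cast_nonneg _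
    nlinarith
  rw [Nat.cast_choose_two]
  have h4 : (n : ℝ) * (7 * (Nat.log 2 n + 1) + 1) ≤ n * (30 * Real.log n) := by
    apply mul_le_mul_of_nonneg_left _ (by linarith)
    linarith
  nlinarith
end

section
/- There exists a real number ε > 0 such that for all integers t and n with 3 ≤ t ≤ n and n ≥ 6, U_t(n) ≤ (1 − ε)·(t·n − ((t+1) choose 2)). -/
open scoped BigOperators

open Equiv

noncomputable def Ex {n : ℕ} (L : List (LazyT n)) (φ : Perm (Fin n) → ℝ) : ℝ :=
  ∑ σ, permDist L σ * φ σ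

lemma Ex_nil {n : ℕ} (φ : Perm (Fin n) → ℝ) : Ex [] φ = φ 1 := by
  simp [Ex, permDist]

lemma Ex_cons {n : ℕ} (e : LazyT n) (L : List (LazyT n)) (φ : Perm (Fin n) → ℝ) :
    Ex (e :: L) φ = e.2.2 * Ex L (fun σ => φ (σ * swap e.1 e.2.1)) + (1 - e.2.2) * Ex L φ := by
  unfold Ex
  have h : ∑ σ, permDist L σ * φ (σ * swap e.1 e.2.1)
      = ∑ σ, permDist L (σ * swap e.1 e.2.1) * φ σ := by
    refine Fintype.sum_equiv (Equiv.mulRight (swap e.1 e.2.1)) _ _ (fun σ => ?_)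
    simp [mul_assoc]
  rw [h, Finset.mul_sum, Finset.mul_sum, ← Finset.sum_add_distrib]
  refine Finset.sum_congr rfl (fun σ _ => ?_)
  simp only [permDist]
  ring

lemma Ex_append {n : ℕ} (L₁ L₂ : List (LazyT n)) (φ : Perm (Fin n) → ℝ) :
    Ex (L₁ ++ L₂) φ = Ex L₁ (fun σ₁ => Ex L₂ (fun σ₂ => φ (σ₂ * σ₁))) := by
  induction L₁ generalizing φ with
  | nil => simp [Ex_nil]
  | cons e L ih =>
    rw [List.cons_append, Ex_cons, Ex_cons, ih, ih]
    simp only [mul_assoc]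

lemma Ex_comm {n m : ℕ} (L₁ : List (LazyT n)) (L₂ : List (LazyT m))
    (F : Perm (Fin n) → Perm (Fin m) → ℝ) :
    Ex L₁ (fun σ₁ => Ex L₂ (fun σ₂ => F σ₁ σ₂)) = Ex L₂ (fun σ₂ => Ex L₁ (fun σ₁ => F σ₁ σ₂)) := by
  unfold Ex
  simp only [Finset.mul_sum]
  rw [Finset.sum_comm]
  refine Finset.sum_congr rfl (fun _ _ => Finset.sum_congr rfl (fun _ _ => ?_))
  ring

lemma Ex_const {n : ℕ} (L : List (LazyT n)) (c : ℝ) : Ex L (fun _ => c) = c := by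
  induction L with
  | nil => simp [Ex_nil]
  | cons e L ih => rw [Ex_cons, ih]; ring

lemma Ex_sum {n : ℕ} {ι : Type*} (s : Finset ι) (L : List (LazyT n))
    (F : ι → Perm (Fin n) → ℝ) :
    Ex L (fun σ => ∑ i ∈ s, F i σ) = ∑ i ∈ s, Ex L (F i) := by
  unfold Ex
  simp only [Finset.mul_sum]
  rw [Finset.sum_comm]

lemma Ex_mul_const {n : ℕ} (L : List (LazyT n)) (F : Perm (Fin n) → ℝ) (c : ℝ) :
    Ex L (fun σ => F σ * c) = Ex L F * c := by
  unfold Ex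
  rw [Finset.sum_mul]
  refine Finset.sum_congr rfl (fun _ _ => ?_)
  ring

/-- Average over the uniform permutation. -/
noncomputable def avg {n : ℕ} (φ : Perm (Fin n) → ℝ) : ℝ := (∑ σ, φ σ) / (n.factorial : ℝ)

lemma avg_left {n : ℕ} (φ : Perm (Fin n) → ℝ) (τ : Perm (Fin n)) :
    avg (fun σ => φ (τ * σ)) = avg φ := by
  unfold avg
  congr 1
  exact Fintype.sum_equiv (Equiv.mulLeft τ) _ _ (fun σ => rfl)

lemma avg_right {n : ℕ} (φ : Perm (Fin n) → ℝ) (τ : Perm (Fin n)) :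
    avg (fun σ => φ (σ * τ)) = avg φ := by
  unfold avg
  congr 1
  exact Fintype.sum_equiv (Equiv.mulRight τ) _ _ (fun σ => rfl)

lemma avg_const {n : ℕ} (c : ℝ) : avg (fun _ : Perm (Fin n) => c) = c := by
  unfold avg
  have : (n.factorial : ℝ) ≠ 0 := by exact_mod_cast n.factorial_ne_zero
  simp [Fintype.card_perm]
  field_simp

lemma avg_sum {n : ℕ} {ι : Type*} (s : Finset ι) (F : ι → Perm (Fin n) → ℝ) :
    avg (fun σ => ∑ i ∈ s, F i σ) = ∑ i ∈ s, avg (F i) := by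
  unfold avg
  rw [Finset.sum_comm, Finset.sum_div]

lemma avg_add {n : ℕ} (F G : Perm (Fin n) → ℝ) :
    avg (fun σ => F σ + G σ) = avg F + avg G := by
  unfold avg
  rw [Finset.sum_add_distrib, add_div]

lemma avg_mul_const {n : ℕ} (F : Perm (Fin n) → ℝ) (c : ℝ) :
    avg (fun σ => F σ * c) = avg F * c := by
  unfold avg
  rw [← Finset.sum_mul]
  ring

lemma avg_comm {n m : ℕ} (F : Perm (Fin n) → Perm (Fin m) → ℝ) :
    avg (fun σ₁ => avg (fun σ₂ => F σ₁ σ₂)) = avg (fun σ₂ => avg (fun σ₁ => F σ₁ σ₂)) := by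
  unfold avg
  simp only [← Finset.sum_div]
  rw [Finset.sum_comm, div_right_comm]

lemma avg_avg_right {n m : ℕ} (ψ : Perm (Fin n) → ℝ) (ρ : Perm (Fin m) → Perm (Fin n)) :
    avg (fun σ => avg (fun π => ψ (σ * ρ π))) = avg ψ := by
  rw [avg_comm]
  simp only [avg_right, avg_const]

lemma avg_avg_left {n m : ℕ} (ψ : Perm (Fin n) → ℝ) (ρ : Perm (Fin m) → Perm (Fin n)) :
    avg (fun σ => avg (fun π => ψ (ρ π * σ))) = avg ψ := by
  rw [avg_comm]
  simp only [avg_left, avg_const]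

lemma Ex_avg {n m : ℕ} (L : List (LazyT n)) (F : Perm (Fin n) → Perm (Fin m) → ℝ) :
    Ex L (fun σ => avg (fun π => F σ π)) = avg (fun π => Ex L (fun σ => F σ π)) := by
  unfold avg Ex
  simp only [mul_div_assoc', ← Finset.sum_div, Finset.mul_sum]
  rw [Finset.sum_comm]

/-- `ψ` depends only on the images of the first `t` positions. -/
def Dep {n : ℕ} (t : ℕ) (ψ : Perm (Fin n) → ℝ) : Prop :=
  ∀ σ σ' : Perm (Fin n), (∀ i : Fin n, i.val < t → σ i = σ' i) → ψ σ = ψ σ'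

def Good {n : ℕ} (t : ℕ) (L : List (LazyT n)) : Prop :=
  (∀ e ∈ L, e.Valid) ∧ ∀ ψ : Perm (Fin n) → ℝ, Dep t ψ → Ex L ψ = avg ψ

lemma avg_of_inv {n : ℕ} (L : List (LazyT n)) (ψ : Perm (Fin n) → ℝ)
    (h : ∀ τ, Ex L (fun σ => ψ (τ * σ)) = Ex L ψ) : Ex L ψ = avg ψ := by
  have h1 : avg (fun τ => Ex L (fun σ => ψ (τ * σ))) = Ex L ψ := by
    simp only [h, avg_const]
  rw [← h1, ← Ex_avg]
  have : ∀ σ, avg (fun τ => ψ (τ * σ)) = avg ψ := fun σ => avg_right ψ σ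
  simp only [this, Ex_const]

def mapL {m n : ℕ} (e : Fin m ↪ Fin n) (L : List (LazyT m)) : List (LazyT n) :=
  L.map (fun x => (e x.1, e x.2.1, x.2.2))

lemma mapL_length {m n : ℕ} (e : Fin m ↪ Fin n) (L : List (LazyT m)) :
    (mapL e L).length = L.length := by simp [mapL]

lemma mapL_valid {m n : ℕ} (e : Fin m ↪ Fin n) (L : List (LazyT m))
    (h : ∀ x ∈ L, x.Valid) : ∀ x ∈ mapL e L, x.Valid := by
  intro x hx
  simp only [mapL, List.mem_map] at hx
  obtain ⟨y, hy, rfl⟩ := hx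
  obtain ⟨h1, h2, h3⟩ := h y hy
  exact ⟨fun h => h1 (e.injective h), h2, h3⟩

noncomputable def pext {m n : ℕ} (e : Fin m ↪ Fin n) (π : Perm (Fin m)) : Perm (Fin n) :=
  π.viaEmbedding e

lemma pext_apply {m n : ℕ} (e : Fin m ↪ Fin n) (π : Perm (Fin m)) (i : Fin m) :
    pext e π (e i) = e (π i) := Equiv.Perm.viaEmbedding_apply π e i

lemma pext_apply_of {m n : ℕ} (e : Fin m ↪ Fin n) (π : Perm (Fin m)) (x : Fin n)
    (h : ∀ i, e i ≠ x) : pext e π x = x :=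
  Equiv.Perm.viaEmbedding_apply_of_notMem π e x (by rintro ⟨i, hi⟩; exact h i hi)

lemma pext_mul {m n : ℕ} (e : Fin m ↪ Fin n) (π ρ : Perm (Fin m)) :
    pext e (π * ρ) = pext e π * pext e ρ :=
  map_mul (Equiv.Perm.viaEmbeddingHom e) π ρ

lemma pext_one {m n : ℕ} (e : Fin m ↪ Fin n) : pext e 1 = 1 :=
  map_one (Equiv.Perm.viaEmbeddingHom e)

lemma pext_swap {m n : ℕ} (e : Fin m ↪ Fin n) (a b : Fin m) :
    pext e (swap a b) = swap (e a) (e b) := by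
  ext1 x
  by_cases h : ∃ i, e i = x
  · obtain ⟨i, rfl⟩ := h
    rw [pext_apply]
    simp only [swap_apply_def, e.injective.eq_iff]
    split_ifs <;> rfl
  · push Not at h
    rw [pext_apply_of e _ x h, swap_apply_of_ne_of_ne (h a).symm (h b).symm]

lemma Ex_map {m n : ℕ} (e : Fin m ↪ Fin n) (L : List (LazyT m)) (ψ : Perm (Fin n) → ℝ) :
    Ex (mapL e L) ψ = Ex L (fun π => ψ (pext e π)) := by
  induction L generalizing ψ with
  | nil => simp [mapL, Ex_nil, pext_one]
  | cons x L ih =>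
    have : mapL e (x :: L) = (e x.1, e x.2.1, x.2.2) :: mapL e L := rfl
    rw [this, Ex_cons, Ex_cons, ih, ih]
    simp only [pext_mul, pext_swap]

lemma pext_extend {m n : ℕ} (e : Fin m ↪ Fin n) (κ : Perm (Fin n))
    (h : ∀ i, ∃ j, κ (e i) = e j) : ∃ κ' : Perm (Fin m), ∀ i, κ (e i) = e (κ' i) := by
  choose f hf using h
  have hinj : Function.Injective f := by
    intro i j hij
    have := hf i
    rw [hij, ← hf j] at this
    exact e.injective (κ.injective this)
  refine ⟨Equiv.ofBijective f (Finite.injective_iff_bijective.mp hinj), fun i => ?_⟩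
  simpa using hf i

lemma good_compose {s t n : ℕ} (L₂ : List (LazyT (s + n))) (L₁ : List (LazyT n))
    (h₂ : Good s L₂) (h₁ : Good t L₁) :
    Good (s + t) (mapL (Fin.natAddEmb s) L₁ ++ L₂) := by
  refine ⟨?_, fun ψ hψ => ?_⟩
  · intro e he
    rcases List.mem_append.mp he with he | he
    · exact mapL_valid _ _ h₁.1 e he
    · exact h₂.1 e he
  set e : Fin n ↪ Fin (s + n) := Fin.natAddEmb s with he
  have hdep : ∀ σ, Dep t (fun π => ψ (σ * pext e π)) := by
    intro σ π π' hπ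
    apply hψ
    intro i hi
    simp only [Perm.mul_apply]
    congr 1
    induction i using Fin.addCases with
    | left i =>
      have : ∀ j, e j ≠ Fin.castAdd n i := by
        intro j hj
        have := congrArg Fin.val hj
        simp [he] at this
        omega
      rw [pext_apply_of e _ _ this, pext_apply_of e _ _ this]
    | right i =>
      have h' : Fin.natAdd s i = e i := rfl
      rw [h', pext_apply, pext_apply, hπ i (by simp at hi; omega)]
  rw [Ex_append, Ex_comm, ← avg_avg_right ψ (pext e), ← h₂.2]
  · congr 1
    funext σ
    rw [Ex_map]
    exact h₁.2 _ (hdep σ)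
  · intro σ σ' hσ
    have hk : ∀ i : Fin (s + n), i.val < s → (σ⁻¹ * σ') i = i := by
      intro i hi
      simp [← hσ i hi]
    obtain ⟨κ', hκ'⟩ := pext_extend e (σ⁻¹ * σ') (by
      intro i
      by_cases hlt : ((σ⁻¹ * σ') (e i)).val < s
      · have := hk _ hlt
        have h3 := (σ⁻¹ * σ').injective this
        rw [h3] at hlt
        simp [he] at hlt
      · refine ⟨⟨((σ⁻¹ * σ') (e i)).val - s, by omega⟩, ?_⟩
        apply Fin.ext
        simp only [he, Fin.natAddEmb_apply, Fin.val_natAdd] at hlt ⊢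
        omega)
    have hk2 : σ⁻¹ * σ' = pext e κ' := by
      ext1 x
      induction x using Fin.addCases with
      | left i =>
        rw [hk _ (by simp), pext_apply_of]
        intro j hj
        have := congrArg Fin.val hj
        simp [he] at this
        omega
      | right i =>
        have h' : Fin.natAdd s i = e i := rfl
        rw [h', hκ', pext_apply]
    have hs : σ' = σ * pext e κ' := by rw [← hk2]; simp
    simp only [hs, mul_assoc, ← pext_mul]
    exact (avg_left (fun π => ψ (σ * pext e π)) κ').symm

lemma avg_apply_one {n : ℕ} (χ : Fin (n+1) → ℝ) :
    avg (fun σ : Perm (Fin (n+1)) => χ (σ 0)) = (∑ i, χ i) / (n + 1) := by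
  have h1 : ∀ i, avg (fun σ : Perm (Fin (n+1)) => χ (σ i)) = avg (fun σ : Perm (Fin (n+1)) => χ (σ 0)) := by
    intro i
    rw [← avg_right (fun σ : Perm (Fin (n+1)) => χ (σ 0)) (swap 0 i)]
    simp
  have h2 : avg (fun σ : Perm (Fin (n+1)) => ∑ i, χ (σ i)) = ∑ i, χ i := by
    have : ∀ σ : Perm (Fin (n+1)), ∑ i, χ (σ i) = ∑ i, χ i := fun σ => Equiv.sum_comp σ χ
    simp only [this, avg_const]
  rw [avg_sum] at h2
  simp only [h1] at h2
  rw [← h2]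
  simp
  field_simp

lemma good_one (n : ℕ) : ∃ L : List (LazyT (n+1)), Good 1 L ∧ L.length = n := by
  have key : ∃ L : List (LazyT (n+1)), (∀ e ∈ L, e.Valid) ∧ L.length = n ∧
      ∀ χ : Fin (n+1) → ℝ, Ex L (fun σ => χ (σ 0)) = (∑ i, χ i) / (n + 1) := by
    induction n with
    | zero => exact ⟨[], by simp, rfl, fun χ => by simp [Ex_nil]⟩
    | succ n ih =>
      obtain ⟨L, hv, hl, hL⟩ := ih
      refine ⟨(0, Fin.last (n+1), 1 / (n + 2)) :: mapL Fin.castSuccEmb L, ?_, ?_, ?_⟩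
      · intro e he
        rcases List.mem_cons.mp he with rfl | he
        · refine ⟨?_, ?_, ?_⟩
          · intro h
            have := congrArg Fin.val h
            simp at this
          · positivity
          · simp only
            rw [div_le_one (by positivity)]
            have : (0:ℝ) ≤ n := by positivity
            linarith
        · exact mapL_valid _ _ hv e he
      · simp [mapL_length, hl]
      · intro χ
        rw [Ex_cons, Ex_map, Ex_map]
        have h0 : ∀ π : Perm (Fin (n+1)), pext Fin.castSuccEmb π 0 = (π 0).castSucc := by
          intro π
          exact pext_apply Fin.castSuccEmb π 0
        have h1 : ∀ π : Perm (Fin (n+1)), pext Fin.castSuccEmb π (Fin.last (n+1)) = Fin.last (n+1) := by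
          intro π
          apply pext_apply_of
          intro i hi
          exact (Fin.castSucc_lt_last i).ne hi
        simp only [Perm.mul_apply, swap_apply_left, h0, h1, Ex_const]
        rw [hL (fun i => χ i.castSucc), Fin.sum_univ_castSucc χ]
        push_cast
        have : (0:ℝ) ≤ n := by positivity
        field_simp
        ring
  obtain ⟨L, hv, hl, hL⟩ := key
  refine ⟨L, ⟨hv, fun ψ hψ => ?_⟩, hl⟩
  have : Function.FactorsThrough ψ (fun σ : Perm (Fin (n+1)) => σ 0) := by
    intro σ σ' h
    apply hψ
    intro i hi
    have : i = 0 := Fin.ext (by simpa using hi)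
    rw [this]; exact h
  obtain ⟨χ, rfl⟩ := (Function.factorsThrough_iff ψ).mp this
  exact (hL χ).trans (avg_apply_one χ).symm

lemma good_trivial (t n : ℕ) (h : t ≤ n) :
    ∃ L : List (LazyT n), Good t L ∧ (2 * L.length : ℤ) = t * (2 * n - t - 1) := by
  induction t generalizing n with
  | zero =>
    refine ⟨[], ⟨by simp, fun ψ hψ => ?_⟩, by simp⟩
    rw [Ex_nil, ← avg_const (n := n) (ψ 1)]
    congr 1
    funext σ
    exact hψ _ _ (by simp)
  | succ t ih =>
    obtain ⟨k, rfl⟩ : ∃ k, n = 1 + k := ⟨n - 1, by omega⟩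
    obtain ⟨L, hL, hl⟩ := ih k (by omega)
    have h1 := good_one k
    rw [Nat.add_comm k 1] at h1
    obtain ⟨L', hL', hl'⟩ := h1
    refine ⟨mapL (Fin.natAddEmb 1) L ++ L', ?_, ?_⟩
    · rw [Nat.add_comm t 1]
      exact good_compose L' L hL' hL
    · rw [List.length_append, mapL_length, hl']
      push_cast
      linear_combination hl

lemma exists_perm_extend {ι α : Type*} [Finite α] (f f' : ι → α) (hf : Function.Injective f)
    (hf' : Function.Injective f') : ∃ κ : Perm α, ∀ i, κ (f i) = f' i := by
  classical
  have := Fintype.ofFinite α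
  let e : {x // x ∈ Set.range f} ≃ {x // x ∈ Set.range f'} :=
    (Equiv.ofInjective f hf).symm.trans (Equiv.ofInjective f' hf')
  refine ⟨e.extendSubtype, fun i => ?_⟩
  rw [Equiv.extendSubtype_apply_of_mem e (f i) ⟨i, rfl⟩]
  have : (⟨f i, ⟨i, rfl⟩⟩ : {x // x ∈ Set.range f}) = Equiv.ofInjective f hf i := rfl
  simp only [e, Equiv.trans_apply, this, Equiv.symm_apply_apply]
  rfl

lemma good_isTShuffle {t n : ℕ} (ht : t ≤ n) (L : List (LazyT n)) (h : Good t L) :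
    IsTShuffle ht L := by
  classical
  refine ⟨h.1, fun f hf => ?_⟩
  let I : (Fin t → Fin n) → Perm (Fin n) → ℝ :=
    fun f σ => if ∀ i : Fin t, σ (Fin.castLE ht i) = f i then 1 else 0
  have h1 : placeProb ht L f = Ex L (I f) := by
    unfold placeProb Ex
    refine Finset.sum_congr rfl (fun σ _ => ?_)
    simp [I]
  have h2 : Ex L (I f) = avg (I f) := by
    apply h.2
    intro σ σ' hσ
    have : ∀ i : Fin t, σ (Fin.castLE ht i) = σ' (Fin.castLE ht i) := fun i => hσ _ (by simp)
    simp only [I, this]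
  have h3 : ∀ g : Fin t ↪ Fin n, avg (I g) = avg (I f) := by
    intro g
    obtain ⟨κ, hκ⟩ := exists_perm_extend f g hf g.injective
    rw [← avg_left (I g) κ]
    congr 1
    funext σ
    simp only [I, Perm.mul_apply, ← hκ, κ.injective.eq_iff]
  have h4 : avg (fun σ => ∑ g : Fin t ↪ Fin n, I g σ) = 1 := by
    rw [← avg_const (n := n) 1]
    congr 1
    funext σ
    let g₀ : Fin t ↪ Fin n := ⟨fun i => σ (Fin.castLE ht i), fun i j hij =>
      Fin.castLE_injective ht (σ.injective hij)⟩
    rw [Finset.sum_eq_single g₀]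
    · simp only [I]
      exact if_pos (fun i => rfl)
    · intro g _ hg
      simp only [I, ite_eq_right_iff, one_ne_zero, imp_false]
      intro hh
      apply hg
      ext1 i
      exact (hh i).symm
    · simp
  rw [avg_sum] at h4
  simp only [h3] at h4
  rw [Finset.sum_const, Finset.card_univ, Fintype.card_embedding_eq, nsmul_eq_mul] at h4
  simp only [Fintype.card_fin] at h4
  rw [h1, h2]
  have h5 := Nat.factorial_mul_descFactorial ht
  have h6 : ((n - t).factorial : ℝ) * (n.descFactorial t : ℝ) = n.factorial := by exact_mod_cast h5
  have h7 : (n.factorial : ℝ) ≠ 0 := by exact_mod_cast n.factorial_ne_zero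
  rw [eq_div_iff h7, ← h6]
  linear_combination ((n - t).factorial : ℝ) * h4

lemma Ut_le {t n : ℕ} (ht : t ≤ n) (L : List (LazyT n)) (h : Good t L) : Ut t n ≤ L.length :=
  Nat.sInf_le ⟨ht, L, rfl, good_isTShuffle ht L h⟩

/-! ### The base case `(3,6)` -/

def exN : List (Fin 6 × Fin 6 × ℕ × ℕ) → (Fin 6 → Bool) → (Fin 6 → Bool) → ℕ
  | [], s, S => if s = S then 1 else 0
  | x :: L, s, S => x.2.2.1 * exN L (fun i => s (swap x.1 x.2.1 i)) S + x.2.2.2 * exN L s S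

noncomputable def toLazy (x : Fin 6 × Fin 6 × ℕ × ℕ) : LazyT 6 :=
  (x.1, x.2.1, (x.2.2.1 : ℝ) / (x.2.2.1 + x.2.2.2))

def den : List (Fin 6 × Fin 6 × ℕ × ℕ) → ℕ
  | [] => 1
  | x :: L => (x.2.2.1 + x.2.2.2) * den L

def list8 : List (Fin 6 × Fin 6 × ℕ × ℕ) :=
  [(0,3,3,2),(0,1,2,1),(0,4,1,1),(2,4,1,1),(3,5,1,1),(0,1,1,1),(2,3,1,1),(4,5,1,1)]

def start6 : Fin 6 → Bool := fun i => decide (i.val < 3)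

lemma exN_list8 : ∀ S : Fin 6 → Bool, exN list8 start6 S =
    if (Finset.univ.filter (fun i => S i = true)).card = 3 then 48 else 0 := by
  decide +kernel

lemma Ex_exN (L : List (Fin 6 × Fin 6 × ℕ × ℕ)) (hL : ∀ x ∈ L, x.2.2.1 + x.2.2.2 ≠ 0)
    (s S : Fin 6 → Bool) :
    Ex (L.map toLazy) (fun σ => if (fun i => s (σ⁻¹ i)) = S then 1 else 0) * den L = exN L s S := by
  induction L generalizing s with
  | nil =>
    have : (fun i => s ((1 : Perm (Fin 6))⁻¹ i)) = s := rfl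
    simp only [List.map_nil, Ex_nil, this, den, exN]
    split_ifs <;> simp
  | cons x L ih =>
    have ih1 := ih (fun y hy => hL y (List.mem_cons_of_mem _ hy))
    have e1 := ih1 (fun i => s (swap x.1 x.2.1 i))
    have e2 := ih1 s
    have hx : ((x.2.2.1 : ℝ) + x.2.2.2) ≠ 0 := by exact_mod_cast hL x (by simp)
    rw [List.map_cons, Ex_cons]
    simp only [mul_inv_rev, swap_inv, Perm.mul_apply, den, exN, toLazy]
    push_cast
    rw [← e1, ← e2]
    field_simp
    ring

lemma good_base : ∃ L : List (LazyT 6), Good 3 L ∧ L.length = 11 := by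
  classical
  obtain ⟨L1, hL1, hl1⟩ := good_trivial 3 3 le_rfl
  have hl1 : L1.length = 3 := by norm_num at hl1; omega
  set e : Fin 3 ↪ Fin 6 := Fin.castLEEmb (by norm_num) with he
  have hval : ∀ j, (e j).val = j.val := fun j => rfl
  refine ⟨mapL e L1 ++ list8.map toLazy, ⟨?_, fun ψ hψ => ?_⟩, by simp [mapL_length, hl1, list8]⟩
  · intro x hx
    rcases List.mem_append.mp hx with hx | hx
    · exact mapL_valid _ _ hL1.1 x hx
    · obtain ⟨y, hy, rfl⟩ := List.mem_map.mp hx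
      refine ⟨?_, ?_, ?_⟩
      · simp only [toLazy]
        have hd : ∀ y ∈ list8, y.1 ≠ y.2.1 := by decide
        exact hd y hy
      · simp only [toLazy]; positivity
      · simp only [toLazy]
        apply div_le_one_of_le₀ <;> [skip; positivity]
        have : (0:ℝ) ≤ y.2.2.2 := by positivity
        linarith
  rw [Ex_append, Ex_comm, ← avg_avg_right ψ (pext e)]
  have hval2 : ∀ x : Fin 6, x.val < 3 → ∃ j, x = e j := fun x hx => ⟨⟨x.val, hx⟩, rfl⟩
  have h1 : ∀ σ, Ex (mapL e L1) (fun σ₁ => ψ (σ * σ₁)) = avg (fun π => ψ (σ * pext e π)) := by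
    intro σ
    rw [Ex_map]
    apply hL1.2
    intro π π' hπ
    apply hψ
    intro i hi
    obtain ⟨j, rfl⟩ := hval2 i hi
    simp only [Perm.mul_apply, pext_apply, hπ j j.2]
  simp only [h1]
  have hfac : Function.FactorsThrough (fun σ => avg (fun π => ψ (σ * pext e π)))
      (fun (σ : Perm (Fin 6)) (i : Fin 6) => start6 (σ⁻¹ i)) := by
    intro σ σ' h
    obtain ⟨κ', hκ'⟩ := pext_extend e (σ⁻¹ * σ') (by
      intro i
      have := congrFun h (σ' (e i))
      have hh : σ'⁻¹ (σ' (e i)) = e i := by simp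
      simp only [start6, hh] at this
      have h3 : (σ⁻¹ (σ' (e i))).val < 3 := by
        have h4 : (e i).val < 3 := i.2
        simpa [h4] using this
      exact hval2 _ h3)
    simp only
    rw [← avg_left (fun π => ψ (σ * pext e π)) κ']
    congr 1
    funext π
    apply hψ
    intro i hi
    obtain ⟨j, rfl⟩ := hval2 i hi
    simp only [Perm.mul_apply, pext_apply, ← hκ']
    simp
  obtain ⟨χ, hχ⟩ := (Function.factorsThrough_iff _).mp hfac
  rw [hχ]
  let D : (Fin 6 → Bool) → ℝ := fun S => if (Finset.univ.filter (fun i => S i = true)).card = 3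
    then 1 / 20 else 0
  have key : ∀ χ : (Fin 6 → Bool) → ℝ, Ex (list8.map toLazy) (fun σ => χ (fun i => start6 (σ⁻¹ i)))
      = ∑ S, D S * χ S := by
    intro χ
    have : (fun σ : Perm (Fin 6) => χ (fun i => start6 (σ⁻¹ i)))
        = fun σ => ∑ S, (if (fun i => start6 (σ⁻¹ i)) = S then (1:ℝ) else 0) * χ S := by
      funext σ
      simp
    rw [this, Ex_sum]
    refine Finset.sum_congr rfl (fun S _ => ?_)
    rw [Ex_mul_const]
    congr 1
    have h := Ex_exN list8 (by decide) start6 S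
    rw [exN_list8] at h
    have hd : den list8 = 960 := by decide
    rw [hd] at h
    simp only [D]
    split_ifs with hc
    · rw [if_pos hc] at h
      push_cast at h
      linarith
    · rw [if_neg hc] at h
      push_cast at h
      linarith
  apply avg_of_inv
  intro τ
  simp only [Function.comp_def]
  rw [key χ]
  simp only [mul_inv_rev, Perm.mul_apply]
  rw [key (fun S => χ (fun i => S (τ⁻¹ i)))]
  refine Fintype.sum_equiv (Equiv.arrowCongr τ (Equiv.refl Bool)) _ _ (fun S => ?_)
  have hD : D ((Equiv.arrowCongr τ (Equiv.refl Bool)) S) = D S := by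
    simp only [D]
    congr 2
    refine Finset.card_bij (fun i _ => τ⁻¹ i) ?_ ?_ ?_
    · intro i hi
      simpa using hi
    · intro i _ j _ hij
      exact τ⁻¹.injective hij
    · intro j hj
      exact ⟨τ j, by simpa using hj, by simp⟩
  rw [hD]
  rfl

/-! ### Splitting the positions into two blocks -/

/-- Which of the first three counters lie in the second block. -/
def pat {n m : ℕ} (c : Fin 3 → Fin (n + m)) (σ : Perm (Fin (n + m))) : Fin 3 → Bool :=
  fun i => decide (n ≤ (σ (c i)).val)

lemma good_split {n m : ℕ} (c : Fin 3 → Fin (n + m)) (hc : ∀ i, (c i).val = i.val)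
    (L₀ : List (LazyT (n + m))) (LA : List (LazyT n)) (LB : List (LazyT m))
    (h₀ : ∀ e ∈ L₀, e.Valid) (hA : Good 3 LA) (hB : Good 3 LB)
    (hsupp : ∀ Ψ Ψ' : Perm (Fin (n + m)) → ℝ,
      (∀ σ, (∀ i, (σ (c i)).val < 3 ∨ (n ≤ (σ (c i)).val ∧ (σ (c i)).val < n + 3)) →
        Ψ σ = Ψ' σ) → Ex L₀ Ψ = Ex L₀ Ψ')
    (hpat : ∀ h : (Fin 3 → Bool) → ℝ,
      Ex L₀ (fun σ => h (pat c σ)) = avg (fun σ => h (pat c σ))) :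
    Good 3 (L₀ ++ (mapL (Fin.castAddEmb m) LA ++ mapL (Fin.natAddEmb n) LB)) := by
  refine ⟨?_, fun ψ hψ => ?_⟩
  · intro x hx
    rcases List.mem_append.mp hx with hx | hx
    · exact h₀ x hx
    rcases List.mem_append.mp hx with hx | hx
    · exact mapL_valid _ _ hA.1 x hx
    · exact mapL_valid _ _ hB.1 x hx
  set a : Fin n ↪ Fin (n + m) := Fin.castAddEmb m with ha
  set b : Fin m ↪ Fin (n + m) := Fin.natAddEmb n with hb
  have hav : ∀ i, (a i).val = i.val := fun i => rfl
  have hbv : ∀ i, (b i).val = n + i.val := fun i => rfl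
  have hcase : ∀ x : Fin (n + m), (x.val < n ∧ ∃ i, x = a i) ∨ (n ≤ x.val ∧ ∃ i, x = b i) := by
    intro x
    by_cases hx : x.val < n
    · exact Or.inl ⟨hx, ⟨x.val, hx⟩, rfl⟩
    · refine Or.inr ⟨by omega, ⟨x.val - n, by omega⟩, Fin.ext ?_⟩
      rw [hbv]
      simp only
      omega
  have hab : ∀ i j, a i ≠ b j := by
    intro i j h
    have := congrArg Fin.val h
    rw [hav, hbv] at this
    have := i.2
    omega
  have evA : ∀ (πA : Perm (Fin n)) (πB : Perm (Fin m)) (i : Fin n),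
      pext b πB (pext a πA (a i)) = a (πA i) := by
    intro πA πB i
    rw [pext_apply, pext_apply_of b _ _ (fun j => (hab _ _).symm)]
  have evB : ∀ (πA : Perm (Fin n)) (πB : Perm (Fin m)) (i : Fin m),
      pext b πB (pext a πA (b i)) = b (πB i) := by
    intro πA πB i
    rw [pext_apply_of a _ _ (fun j => hab _ _), pext_apply]
  -- equality of `ψ` values only needs the three counters
  have hψ' : ∀ σ σ' : Perm (Fin (n + m)), (∀ i, σ (c i) = σ' (c i)) → ψ σ = ψ σ' := by
    intro σ σ' h
    apply hψ
    intro i hi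
    have : i = c ⟨i.val, hi⟩ := Fin.ext (by rw [hc])
    rw [this]
    exact h _
  let Ψ : Perm (Fin (n + m)) → ℝ := fun σ =>
    avg (fun πA => avg (fun πB => ψ (pext b πB * (pext a πA * σ))))
  have step1 : Ex (L₀ ++ (mapL a LA ++ mapL b LB)) ψ = Ex L₀ Ψ := by
    rw [Ex_append]
    apply hsupp
    intro σ hσ
    rw [Ex_append, Ex_map]
    simp only [Ex_map]
    have hin : ∀ πA : Perm (Fin n),
        Ex LB (fun πB => ψ (pext b πB * pext a πA * σ))
          = avg (fun πB => ψ (pext b πB * (pext a πA * σ))) := by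
      intro πA
      simp only [mul_assoc]
      apply hB.2
      intro π π' hπ
      apply hψ'
      intro i
      simp only [Perm.mul_apply]
      rcases hcase (σ (c i)) with ⟨hx, j, hj⟩ | ⟨hx, j, hj⟩
      · rw [hj, evA, evA]
      · rw [hj, evB, evB, hπ j]
        rcases hσ i with h | h
        · have := congrArg Fin.val hj
          rw [hbv] at this
          omega
        · have := congrArg Fin.val hj
          rw [hbv] at this
          omega
    simp only [hin]
    apply hA.2
    intro π π' hπ
    simp only
    congr 1
    funext πB
    apply hψ'
    intro i
    simp only [Perm.mul_apply]
    rcases hcase (σ (c i)) with ⟨hx, j, hj⟩ | ⟨hx, j, hj⟩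
    · rw [hj, evA, evA, hπ j]
      rcases hσ i with h | h
      · have := congrArg Fin.val hj
        rw [hav] at this
        omega
      · omega
    · rw [hj, evB, evB]
  have hfac : Function.FactorsThrough Ψ (pat c) := by
    intro σ σ' hp
    have hiff : ∀ i, n ≤ (σ (c i)).val ↔ n ≤ (σ' (c i)).val := by
      intro i
      have := congrFun hp i
      simpa [pat] using this
    have hcinj : Function.Injective c := by
      intro i j hij
      have := congrArg Fin.val hij
      rw [hc, hc] at this
      exact Fin.ext this
    obtain ⟨κA, hκA⟩ := exists_perm_extend
      (fun i : {i : Fin 3 // (σ (c i)).val < n} => (⟨(σ (c i)).val, i.2⟩ : Fin n))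
      (fun i => (⟨(σ' (c i)).val, by have := hiff i; have := i.2; omega⟩ : Fin n))
      (by
        intro i j hij
        have := congrArg Fin.val hij
        exact Subtype.ext (hcinj (σ.injective (Fin.ext this))))
      (by
        intro i j hij
        have := congrArg Fin.val hij
        exact Subtype.ext (hcinj (σ'.injective (Fin.ext this))))
    obtain ⟨κB, hκB⟩ := exists_perm_extend
      (fun i : {i : Fin 3 // n ≤ (σ (c i)).val} => (⟨(σ (c i)).val - n, by
        have := (σ (c i)).2; have := i.2; omega⟩ : Fin m))
      (fun i => (⟨(σ' (c i)).val - n, by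
        have := (σ' (c i)).2; have := (hiff i).mp i.2; omega⟩ : Fin m))
      (by
        intro i j hij
        have := congrArg Fin.val hij
        simp only at this
        have := i.2
        have := j.2
        exact Subtype.ext (hcinj (σ.injective (Fin.ext (by omega)))))
      (by
        intro i j hij
        have := congrArg Fin.val hij
        simp only at this
        have := (hiff i).mp i.2
        have := (hiff j).mp j.2
        exact Subtype.ext (hcinj (σ'.injective (Fin.ext (by omega)))))
    have hE : ∀ πA πB, ψ (pext b πB * (pext a πA * σ'))
        = ψ (pext b (πB * κB) * (pext a (πA * κA) * σ)) := by
      intro πA πB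
      apply hψ'
      intro i
      simp only [Perm.mul_apply]
      rcases hcase (σ (c i)) with ⟨hx, -⟩ | ⟨hx, -⟩
      · have h1 := hκA ⟨i, hx⟩
        simp only at h1
        have hx' : (σ' (c i)).val < n := by have := hiff i; omega
        have e1 : σ (c i) = a ⟨(σ (c i)).val, hx⟩ := rfl
        have e2 : σ' (c i) = a ⟨(σ' (c i)).val, hx'⟩ := rfl
        rw [e1, e2, evA, evA, Perm.mul_apply, h1]
      · have h1 := hκB ⟨i, hx⟩
        simp only at h1
        have hx' : n ≤ (σ' (c i)).val := (hiff i).mp hx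
        have e1 : σ (c i) = b ⟨(σ (c i)).val - n, by have := (σ (c i)).2; omega⟩ :=
          Fin.ext (by rw [hbv]; simp only; omega)
        have e2 : σ' (c i) = b ⟨(σ' (c i)).val - n, by have := (σ' (c i)).2; omega⟩ :=
          Fin.ext (by rw [hbv]; simp only; omega)
        rw [e1, e2, evB, evB, Perm.mul_apply, h1]
    symm
    simp only [Ψ, hE]
    rw [avg_right (fun πA => avg (fun πB => ψ (pext b (πB * κB) * (pext a πA * σ)))) κA]
    congr 1
    funext πA
    exact avg_right (fun πB => ψ (pext b πB * (pext a πA * σ))) κB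
  obtain ⟨h, hh⟩ := (Function.factorsThrough_iff Ψ).mp hfac
  have step2 : Ex L₀ Ψ = avg Ψ := by rw [hh]; exact hpat h
  rw [step1, step2]
  simp only [Ψ]
  rw [avg_comm]
  simp only [avg_comm (n := n + m)]
  rw [avg_comm]
  have : ∀ (πA : Perm (Fin n)) (πB : Perm (Fin m)),
      avg (fun σ => ψ (pext b πB * (pext a πA * σ))) = avg ψ := by
    intro πA πB
    rw [avg_left (fun σ => ψ (pext b πB * σ)), avg_left]
  simp only [this, avg_const]

/-! ### Pattern distribution of a uniform permutation -/

lemma moment_step {N : ℕ} (m : ℝ) (x : Fin N → ℝ) (hx : ∀ i, x i = 0 ∨ x i = 1)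
    (hsum : ∑ i, x i = m) (T : Finset (Fin N)) (j : Fin N) (hj : j ∉ T) :
    avg (fun σ : Perm (Fin N) => (∏ i ∈ T, x (σ i)) * x (σ j)) * (N - T.card)
      = avg (fun σ : Perm (Fin N) => ∏ i ∈ T, x (σ i)) * (m - T.card) := by
  classical
  have h1 : ∀ k ∈ Tᶜ, avg (fun σ : Perm (Fin N) => (∏ i ∈ T, x (σ i)) * x (σ k))
      = avg (fun σ : Perm (Fin N) => (∏ i ∈ T, x (σ i)) * x (σ j)) := by
    intro k hk
    rw [← avg_right (fun σ : Perm (Fin N) => (∏ i ∈ T, x (σ i)) * x (σ j)) (swap j k)]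
    congr 1
    funext σ
    simp only [Perm.mul_apply, swap_apply_left]
    congr 1
    refine Finset.prod_congr rfl (fun i hi => ?_)
    rw [swap_apply_of_ne_of_ne]
    · rintro rfl; exact hj hi
    · rintro rfl; exact (Finset.mem_compl.mp hk) hi
  have h2 : ∑ k ∈ Tᶜ, avg (fun σ : Perm (Fin N) => (∏ i ∈ T, x (σ i)) * x (σ k))
      = avg (fun σ : Perm (Fin N) => ∏ i ∈ T, x (σ i)) * (m - T.card) := by
    rw [← avg_sum, ← avg_mul_const]
    congr 1
    funext σ
    rw [← Finset.mul_sum]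
    have hs : ∑ k ∈ T, x (σ k) + ∑ k ∈ Tᶜ, x (σ k) = m := by
      rw [Finset.sum_add_sum_compl, ← hsum]
      exact Equiv.sum_comp σ x
    by_cases h0 : ∃ i ∈ T, x (σ i) = 0
    · obtain ⟨i, hi, h0⟩ := h0
      rw [Finset.prod_eq_zero hi h0]; ring
    · push Not at h0
      have : ∑ k ∈ T, x (σ k) = T.card := by
        rw [Finset.sum_congr rfl (fun k hk => (hx (σ k)).resolve_left (h0 k hk))]
        simp
      congr 1
      linarith
  rw [Finset.sum_congr rfl h1, Finset.sum_const, nsmul_eq_mul, Finset.card_compl,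
    Fintype.card_fin, Nat.cast_sub (by simpa using Finset.card_le_univ T)] at h2
  linarith

lemma avg_pat {n m : ℕ} (hn : 3 ≤ n) (c : Fin 3 → Fin (n + m)) (hc : ∀ i, (c i).val = i.val)
    (h : (Fin 3 → Bool) → ℝ) :
    avg (fun σ => h (pat c σ)) * (((n:ℝ) + m) * (n + m - 1) * (n + m - 2)) =
      h ![false, false, false] * (n * (n - 1) * (n - 2))
      + (h ![true, false, false] + h ![false, true, false] + h ![false, false, true])
        * (m * n * (n - 1))
      + (h ![true, true, false] + h ![true, false, true] + h ![false, true, true])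
        * (m * (m - 1) * n)
      + h ![true, true, true] * (m * (m - 1) * (m - 2)) := by
  classical
  let x : Fin (n + m) → ℝ := fun i => if n ≤ i.val then 1 else 0
  have hx : ∀ i, x i = 0 ∨ x i = 1 := by intro i; simp only [x]; split_ifs <;> simp
  have hsum : ∑ i, x i = (m : ℝ) := by
    rw [Fin.sum_univ_add]
    simp [x]
  have hcne : ∀ i j, i ≠ j → c i ≠ c j := by
    intro i j hij h
    apply hij
    have := congrArg Fin.val h
    rw [hc, hc] at this
    exact Fin.ext this
  have hN : ((n + m : ℕ) : ℝ) = n + m := by push_cast; ring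
  have hn' : (3:ℝ) ≤ n := by exact_mod_cast hn
  have hm' : (0:ℝ) ≤ m := by positivity
  have E1 : ∀ i, avg (fun σ : Perm (Fin (n+m)) => x (σ i)) * (n + m) = m := by
    intro i
    have := moment_step m x hx hsum ∅ i (by simp)
    simpa [avg_const, hN] using this
  have E2 : ∀ i j, i ≠ j → avg (fun σ : Perm (Fin (n+m)) => x (σ i) * x (σ j)) * (n + m - 1)
      = avg (fun σ : Perm (Fin (n+m)) => x (σ i)) * (m - 1) := by
    intro i j hij
    have := moment_step m x hx hsum {i} j (by simpa using hij.symm)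
    simpa [hN] using this
  have E3 : ∀ i j k, i ≠ j → i ≠ k → j ≠ k →
      avg (fun σ : Perm (Fin (n+m)) => x (σ i) * x (σ j) * x (σ k)) * (n + m - 2)
      = avg (fun σ : Perm (Fin (n+m)) => x (σ i) * x (σ j)) * (m - 2) := by
    intro i j k hij hik hjk
    have := moment_step m x hx hsum {i, j} k (by simp [hik.symm, hjk.symm])
    simpa [hN, Finset.prod_pair hij, Finset.card_pair hij] using this
  have hpoly : (fun σ : Perm (Fin (n+m)) => h (pat c σ)) = fun σ =>
      h ![false, false, false]
      + x (σ (c 0)) * (h ![true, false, false] - h ![false, false, false])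
      + x (σ (c 1)) * (h ![false, true, false] - h ![false, false, false])
      + x (σ (c 2)) * (h ![false, false, true] - h ![false, false, false])
      + x (σ (c 0)) * x (σ (c 1)) * (h ![true, true, false] - h ![true, false, false]
        - h ![false, true, false] + h ![false, false, false])
      + x (σ (c 0)) * x (σ (c 2)) * (h ![true, false, true] - h ![true, false, false]
        - h ![false, false, true] + h ![false, false, false])
      + x (σ (c 1)) * x (σ (c 2)) * (h ![false, true, true] - h ![false, true, false]
        - h ![false, false, true] + h ![false, false, false])
      + x (σ (c 0)) * x (σ (c 1)) * x (σ (c 2)) * (h ![true, true, true]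
        - h ![true, true, false] - h ![true, false, true] - h ![false, true, true]
        + h ![true, false, false] + h ![false, true, false] + h ![false, false, true]
        - h ![false, false, false]) := by
    funext σ
    have : pat c σ = ![decide (n ≤ (σ (c 0)).val), decide (n ≤ (σ (c 1)).val),
        decide (n ≤ (σ (c 2)).val)] := by
      funext i
      fin_cases i <;> rfl
    rw [this]
    simp only [x]
    by_cases h0 : n ≤ (σ (c 0)).val <;> by_cases h1 : n ≤ (σ (c 1)).val <;>
      by_cases h2 : n ≤ (σ (c 2)).val <;> simp only [h0, h1, h2, decide_true, decide_false,
        if_true, if_false] <;> ring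
  rw [hpoly]
  simp only [avg_add, avg_mul_const, avg_const]
  have a0 := E1 (c 0)
  have a1 := E1 (c 1)
  have a2 := E1 (c 2)
  have a01 := E2 (c 0) (c 1) (hcne _ _ (by decide))
  have a02 := E2 (c 0) (c 2) (hcne _ _ (by decide))
  have a12 := E2 (c 1) (c 2) (hcne _ _ (by decide))
  have a012 := E3 (c 0) (c 1) (c 2) (hcne _ _ (by decide)) (hcne _ _ (by decide))
    (hcne _ _ (by decide))
  have p0 : (n:ℝ) + m ≠ 0 := by positivity
  have p1 : (n:ℝ) + m - 1 ≠ 0 := by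
    have : (0:ℝ) < n + m - 1 := by linarith
    exact this.ne'
  have p2 : (n:ℝ) + m - 2 ≠ 0 := by
    have : (0:ℝ) < n + m - 2 := by linarith
    exact this.ne'
  rw [← eq_div_iff p0] at a0 a1 a2
  rw [← eq_div_iff p1] at a01 a02 a12
  rw [← eq_div_iff p2] at a012
  rw [a012, a01, a02, a12, a0, a1, a2]
  field_simp
  ring

lemma good_split_small {n m k : ℕ} (hn : 3 ≤ n) (hk : 3 ≤ k) (e : Fin k ↪ Fin (n + m))
    (he : ∀ j, ((e j).val = j.val ∧ j.val < 3) ∨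
      (3 ≤ j.val ∧ n ≤ (e j).val ∧ (e j).val < n + 3))
    (L : List (LazyT k)) (LA : List (LazyT n)) (LB : List (LazyT m))
    (h₀ : ∀ e ∈ L, e.Valid) (hA : Good 3 LA) (hB : Good 3 LB)
    (hpat : ∀ h : (Fin 3 → Bool) → ℝ,
      Ex L (fun π => h (fun i => decide (3 ≤ (π (Fin.castLE hk i)).val)))
        * (((n:ℝ) + m) * (n + m - 1) * (n + m - 2)) =
      h ![false, false, false] * (n * (n - 1) * (n - 2))
      + (h ![true, false, false] + h ![false, true, false] + h ![false, false, true])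
        * (m * n * (n - 1))
      + (h ![true, true, false] + h ![true, false, true] + h ![false, true, true])
        * (m * (m - 1) * n)
      + h ![true, true, true] * (m * (m - 1) * (m - 2))) :
    Good 3 (mapL e L ++ (mapL (Fin.castAddEmb m) LA ++ mapL (Fin.natAddEmb n) LB)) := by
  have hc : ∀ i : Fin 3, (e (Fin.castLE hk i)).val = i.val := by
    intro i
    rcases he (Fin.castLE hk i) with h | h
    · simpa using h.1
    · have := i.2
      simp at h
      omega
  refine good_split (fun i => e (Fin.castLE hk i)) hc (mapL e L) LA LB
    (mapL_valid e L h₀) hA hB ?_ ?_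
  · intro Ψ Ψ' hΨ
    rw [Ex_map, Ex_map]
    congr 1
    funext π
    apply hΨ
    intro i
    rw [pext_apply]
    rcases he (π (Fin.castLE hk i)) with h | h
    · left; omega
    · right; omega
  · intro h
    have hne : (((n:ℝ) + m) * (n + m - 1) * (n + m - 2)) ≠ 0 := by
      have : (3:ℝ) ≤ n := by exact_mod_cast hn
      have : (0:ℝ) ≤ m := by positivity
      have h1 : (0:ℝ) < n + m := by linarith
      have h2 : (0:ℝ) < n + m - 1 := by linarith
      have h3 : (0:ℝ) < n + m - 2 := by linarith
      positivity
    apply mul_right_cancel₀ hne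
    rw [avg_pat hn _ hc, ← hpat, Ex_map]
    congr 2
    funext π
    congr 1
    funext i
    simp only [pat, pext_apply]
    rw [decide_eq_decide]
    rcases he (π (Fin.castLE hk i)) with h | h <;> omega

lemma good_extend {n : ℕ} (hn : 3 ≤ n) (LA : List (LazyT n)) (hA : Good 3 LA) :
    ∃ L : List (LazyT (n + 1)), Good 3 L ∧ L.length = LA.length + 3 := by
  have hn' : (3:ℝ) ≤ n := by exact_mod_cast hn
  have h1 : (0:ℝ) < n - 1 := by linarith
  let e : Fin 4 ↪ Fin (n + 1) := ⟨fun i => if h : i.val < 3 then ⟨i.val, by omega⟩ else Fin.last n, by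
    intro i j hij
    have := i.2
    have := j.2
    ext
    by_cases hi : i.val < 3 <;> by_cases hj : j.val < 3 <;>
      simp [hi, hj, Fin.ext_iff] at hij <;> omega⟩
  have hB : Good 3 ([] : List (LazyT 1)) := by
    refine ⟨by simp, fun ψ _ => ?_⟩
    rw [Ex_nil]
    have : ψ = fun _ => ψ 1 := by
      funext σ
      congr 1
      exact Subsingleton.elim _ _
    rw [this, avg_const]
  refine ⟨_, good_split_small (m := 1) hn (by norm_num) e ?_
    [(0, 3, 1 / ((n:ℝ) - 1)), (1, 3, 1 / (n:ℝ)), (2, 3, 1 / ((n:ℝ) + 1))] LA [] ?_ hA hB ?_, ?_⟩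
  · intro j
    have := j.2
    have hev : e j = if h : j.val < 3 then ⟨j.val, by omega⟩ else Fin.last n := rfl
    by_cases hj : j.val < 3
    · left; rw [hev, dif_pos hj]; exact ⟨rfl, hj⟩
    · right; rw [hev, dif_neg hj, Fin.val_last]; omega
  · intro x hx
    have a1 : 1 / ((n:ℝ) - 1) ≤ 1 := by rw [div_le_one h1]; linarith
    have a2 : 1 / (n:ℝ) ≤ 1 := by rw [div_le_one (by linarith)]; linarith
    have a3 : 1 / ((n:ℝ) + 1) ≤ 1 := by rw [div_le_one (by linarith)]; linarith
    simp only [List.mem_cons, List.not_mem_nil, or_false] at hx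
    rcases hx with rfl | rfl | rfl
    · exact ⟨by simp, by positivity, a1⟩
    · exact ⟨by simp, by positivity, a2⟩
    · exact ⟨by simp, by positivity, a3⟩
  · intro h
    have key : ∀ π : Perm (Fin 4), (fun i : Fin 3 => decide (3 ≤ (π (Fin.castLE (by norm_num) i)).val))
        = ![decide (3 ≤ (π 0).val), decide (3 ≤ (π 1).val), decide (3 ≤ (π 2).val)] := by
      intro π
      funext i
      fin_cases i <;> rfl
    simp only [key, Ex_cons, Ex_nil, Perm.mul_apply, Perm.one_apply, swap_apply_def]
    simp
    field_simp
    ring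
  · simp [mapL_length]; omega

lemma good_double {n : ℕ} (hn : 3 ≤ n) (LA : List (LazyT n)) (hA : Good 3 LA) :
    ∃ L : List (LazyT (n + n)), Good 3 L ∧ L.length = 2 * LA.length + 6 := by
  have hn' : (3:ℝ) ≤ n := by exact_mod_cast hn
  have h1 : (0:ℝ) < 2 * n - 1 := by linarith
  obtain ⟨p, hp0, hp1, hp⟩ : ∃ p : ℝ, 0 ≤ p ∧ p ≤ 1 ∧ p * (1 - p) * (2 * (2 * n - 1)) = n - 2 := by
    have hs0 := Real.sqrt_nonneg (3 / (2 * (n:ℝ) - 1))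
    have hs := Real.mul_self_sqrt (show 0 ≤ 3 / (2 * (n:ℝ) - 1) by positivity)
    have hs1 : Real.sqrt (3 / (2 * (n:ℝ) - 1)) ≤ 1 := by
      rw [Real.sqrt_le_left (by norm_num), one_pow, div_le_one h1]
      linarith
    generalize Real.sqrt (3 / (2 * (n:ℝ) - 1)) = s at *
    refine ⟨(1 - s) / 2, by linarith, by linarith, ?_⟩
    rw [eq_div_iff h1.ne'] at hs
    linear_combination (-1/2) * hs
  let e : Fin 6 ↪ Fin (n + n) := ⟨fun i => if h : i.val < 3 then ⟨i.val, by omega⟩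
      else ⟨n + (i.val - 3), by omega⟩, by
    intro i j hij
    have := i.2
    have := j.2
    ext
    by_cases hi : i.val < 3 <;> by_cases hj : j.val < 3 <;>
      simp [hi, hj, Fin.ext_iff] at hij <;> omega⟩
  refine ⟨_, good_split_small (m := n) hn (by norm_num) e ?_
    [(1, 2, 1 / 2), (0, 1, 2 / 3), (1, 2, 1 / 2), (0, 3, 1 / 2), (1, 4, p), (2, 5, 1 - p)]
    LA LA ?_ hA hA ?_, ?_⟩
  · intro j
    have := j.2
    have hev : e j = if h : j.val < 3 then ⟨j.val, by omega⟩
      else ⟨n + (j.val - 3), by omega⟩ := rfl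
    by_cases hj : j.val < 3
    · left; rw [hev, dif_pos hj]; exact ⟨rfl, hj⟩
    · right; rw [hev, dif_neg hj]; simp only; omega
  · intro x hx
    simp only [List.mem_cons, List.not_mem_nil, or_false] at hx
    rcases hx with rfl | rfl | rfl | rfl | rfl | rfl
    · exact ⟨by simp, by norm_num, by norm_num⟩
    · exact ⟨by simp, by norm_num, by norm_num⟩
    · exact ⟨by simp, by norm_num, by norm_num⟩
    · exact ⟨by simp, by norm_num, by norm_num⟩
    · exact ⟨by simp, hp0, hp1⟩
    · exact ⟨by simp, by simp only; linarith, by simp only; linarith⟩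
  · intro h
    have key : ∀ π : Perm (Fin 6), (fun i : Fin 3 => decide (3 ≤ (π (Fin.castLE (by norm_num) i)).val))
        = ![decide (3 ≤ (π 0).val), decide (3 ≤ (π 1).val), decide (3 ≤ (π 2).val)] := by
      intro π
      funext i
      fin_cases i <;> rfl
    have hEx : Ex [(1, 2, 1 / 2), (0, 1, 2 / 3), (1, 2, 1 / 2), (0, 3, 1 / 2), (1, 4, p),
          ((2 : Fin 6), (5 : Fin 6), 1 - p)]
        (fun π => h ![decide (3 ≤ (π 0).val), decide (3 ≤ (π 1).val), decide (3 ≤ (π 2).val)]) =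
        (p * (1 - p)) / 2 * (h ![false, false, false] + h ![true, true, true])
        + (1 - p * (1 - p)) / 6 *
          (h ![true, false, false] + h ![false, true, false] + h ![false, false, true]
          + h ![true, true, false] + h ![true, false, true] + h ![false, true, true]) := by
      simp only [Ex_cons, Ex_nil, Perm.mul_apply, Perm.one_apply, swap_apply_def]
      simp
      ring
    simp only [key]
    rw [hEx]
    linear_combination (n * (n - 1) * (h ![false, false, false] + h ![true, true, true])
      - n * (n - 1) / 3 *
          (h ![true, false, false] + h ![false, true, false] + h ![false, false, true]
          + h ![true, true, false] + h ![true, false, true] + h ![false, true, true])) * hp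
  · simp [mapL_length]; omega

lemma good_three (n : ℕ) (hn : 6 ≤ n) :
    ∃ L : List (LazyT n), Good 3 L ∧ 12 * L.length + n + 73 ≤ 36 * n := by
  induction n using Nat.strong_induction_on with
  | _ n ih =>
    rcases Nat.lt_or_ge n 12 with h | h
    · rcases Nat.eq_or_lt_of_le hn with h6 | h6
      · subst h6
        obtain ⟨L, hL, hl⟩ := good_base
        exact ⟨L, hL, by omega⟩
      · have : ∀ k, k ≤ 5 → ∃ L : List (LazyT (6 + k)), Good 3 L ∧ L.length = 11 + 3 * k := by
          intro k
          induction k with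
          | zero =>
            intro _
            obtain ⟨L, hL, hl⟩ := good_base
            exact ⟨L, hL, by omega⟩
          | succ k ihk =>
            intro hk
            obtain ⟨L, hL, hl⟩ := ihk (by omega)
            obtain ⟨L', hL', hl'⟩ := good_extend (by omega) L hL
            exact ⟨L', hL', by omega⟩
        obtain ⟨k, rfl⟩ := Nat.exists_eq_add_of_le hn
        obtain ⟨L, hL, hl⟩ := this k (by omega)
        exact ⟨L, hL, by omega⟩
    · rcases Nat.even_or_odd' n with ⟨k, hk | hk⟩
      · obtain ⟨L, hL, hl⟩ := ih k (by omega) (by omega)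
        obtain ⟨L', hL', hl'⟩ := good_double (by omega) L hL
        obtain rfl : n = k + k := by omega
        exact ⟨L', hL', by omega⟩
      · obtain ⟨L, hL, hl⟩ := ih k (by omega) (by omega)
        obtain ⟨L', hL', hl'⟩ := good_double (by omega) L hL
        obtain ⟨L'', hL'', hl''⟩ := good_extend (by omega) L' hL'
        obtain rfl : n = k + k + 1 := by omega
        exact ⟨L'', hL'', by omega⟩

lemma good_final (n : ℕ) : ∀ t, 3 ≤ t → t ≤ n → 6 ≤ n →
    ∃ L : List (LazyT n), Good t L ∧ (216 * L.length : ℤ) ≤ 107 * (t * (2 * n - t - 1)) := by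
  induction n using Nat.strong_induction_on with
  | _ n ih =>
    intro t ht htn hn
    obtain ⟨L3, hL3, hl3⟩ := good_three n hn
    obtain ⟨k, rfl⟩ := Nat.exists_eq_add_of_le (show 3 ≤ n by omega)
    obtain ⟨r, rfl⟩ := Nat.exists_eq_add_of_le ht
    by_cases hc : 3 ≤ r ∧ 6 ≤ k
    · obtain ⟨L, hL, hl⟩ := ih k (by omega) r hc.1 (by omega) hc.2
      refine ⟨_, good_compose L3 L hL3 hL, ?_⟩
      rw [List.length_append, mapL_length]
      zify at *
      nlinarith
    · obtain ⟨L, hL, hl⟩ := good_trivial r k (by omega)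
      refine ⟨_, good_compose L3 L hL3 hL, ?_⟩
      rw [List.length_append, mapL_length]
      have hD : (r * (2 * k - r - 1) : ℤ) ≤ 12 * (k + 1) := by
        rcases Nat.lt_or_ge r 3 with hr | hr
        · interval_cases r <;> push_cast <;> omega
        · have hk : k < 6 := by omega
          have hrk : r ≤ k := by omega
          interval_cases k <;> interval_cases r <;> norm_num
      zify at *
      nlinarith

theorem Ut_beats_trivial :
    ∃ ε : ℝ, 0 < ε ∧ ∀ t n : ℕ, 3 ≤ t → t ≤ n → 6 ≤ n →
      (Ut t n : ℝ) ≤ (1 - ε) * ((t : ℝ) * n - (((t + 1).choose 2 : ℕ) : ℝ)) := by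
  refine ⟨1 / 108, by norm_num, fun t n ht htn hn => ?_⟩
  obtain ⟨L, hL, hl⟩ := good_final n t ht htn hn
  have h1 : (Ut t n : ℝ) ≤ L.length := by exact_mod_cast Ut_le htn L hL
  have h2 : (216 * L.length : ℝ) ≤ 107 * (t * (2 * n - t - 1)) := by exact_mod_cast hl
  rw [Nat.cast_choose_two]
  push_cast
  linarith
end
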